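/- For every integer Δ ≥ 1 and all reals d, δ > 0 there exist ε, μ > 0 and n₀ ∈ ℕ such that the following holds for every integer n ≥ n₀. Let G be a 3-partite 3-uniform hypergraph with parts V₁, V₂, V₃ of sizes n₁, n₂, n₃, where n ≤ n₁ ≤ n₂ ≤ n/δ and n₃ ≥ δn, such that: (i) for all V_i' ⊆ V_i with |V_i'| ≥ ε|V_i| (i ∈ {1,2,3}) one has e_G(V₁',V₂',V₃') ≥ d|V₁'||V₂'||V₃'|; and (ii) d_G(v) ≥ dn² for every vertex v of G. Then for every μ-separable bipartite graph H with parts of sizes n₁ and n₂, with exactly n₃ edges and maximum degree at most Δ, G contains a copy of the 1-expansion of H in which the images of the new expansion vertices lie in V₃. -/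

import Mathlib

open Finset
open scoped Classical

/-- Number of ordered pairs `(x,y) ∈ A × B` with `{x,y}` an edge of `G`. -/
noncomputable def pairCount {V : Type*} (G : SimpleGraph V) (A B : Finset V) : ℕ :=
  ((A ×ˢ B).filter (fun p => G.Adj p.1 p.2)).card

/-- Number of neighbours of `v` in `B`. -/
noncomputable def degIn {V : Type*} (G : SimpleGraph V) (v : V) (B : Finset V) : ℕ :=
  (B.filter (fun w => G.Adj v w)).card

/-- Degree of `v` in `G`. -/
noncomputable def degOf {V : Type*} [Fintype V] (G : SimpleGraph V) (v : V) : ℕ :=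
  ((univ : Finset V).filter (fun w => G.Adj v w)).card

/-- Number of edges of `G`. -/
noncomputable def edgeCnt {V : Type*} [Fintype V] (G : SimpleGraph V) : ℕ :=
  ((univ : Finset (Sym2 V)).filter (fun e => e ∈ G.edgeSet)).card

/-- Number of edges of `H` with one endpoint in `A` and the other in `B`. -/
noncomputable def eBetween {W : Type*} [Fintype W] (H : SimpleGraph W) (A B : Finset W) : ℕ :=
  ((univ : Finset (Sym2 W)).filter
    (fun e => e ∈ H.edgeSet ∧ ∃ x ∈ A, ∃ y ∈ B, e = s(x, y))).card

/-- A graph `H` on `h` vertices is `μ`-separable if there is `X ⊆ V(H)` with `|X| ≤ μ h`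
such that every connected component of `H - X` has at most `μ h` vertices. -/
def Separable {W : Type*} [Fintype W] (H : SimpleGraph W) (μ : ℝ) : Prop :=
  ∃ X : Finset W, (X.card : ℝ) ≤ μ * (Fintype.card W : ℝ) ∧
    ∀ K : (SimpleGraph.induce ((↑X : Set W)ᶜ) H).ConnectedComponent,
      (K.supp.ncard : ℝ) ≤ μ * (Fintype.card W : ℝ)

/-- A transversal copy of `H` in the graph collection `G`. -/
def HasTransversal {V C W : Type*} (G : C → SimpleGraph V) (H : SimpleGraph W) : Prop :=
  ∃ (τ : W → V) (σ : Sym2 W → C),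
    Function.Injective τ ∧ Set.InjOn σ H.edgeSet ∧
    ∀ x y, H.Adj x y → (G (σ s(x, y))).Adj (τ x) (τ y)

/-- Density of a collection of bipartite graphs. -/
noncomputable def colDensity {V C : Type*} (G : C → SimpleGraph V)
    (A B : Finset V) (D : Finset C) : ℝ :=
  (∑ c ∈ D, (pairCount (G c) A B : ℝ)) / ((D.card : ℝ) * (A.card : ℝ) * (B.card : ℝ))

/-- `(ε,d)`-regularity of a collection of bipartite graphs with parts `V₁, V₂`
and colour set `D`. -/
def ColReg {V C : Type*} (ε d : ℝ) (G : C → SimpleGraph V)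
    (V₁ V₂ : Finset V) (D : Finset C) : Prop :=
  d ≤ colDensity G V₁ V₂ D ∧
  ∀ V₁' ⊆ V₁, ∀ V₂' ⊆ V₂, ∀ D' ⊆ D,
    ε * (V₁.card : ℝ) ≤ (V₁'.card : ℝ) → ε * (V₂.card : ℝ) ≤ (V₂'.card : ℝ) →
    ε * (D.card : ℝ) ≤ (D'.card : ℝ) →
    |colDensity G V₁' V₂' D' - colDensity G V₁ V₂ D| < ε

/-- `(ε,d)`-superregularity of a collection of bipartite graphs. -/
def ColSuperReg {V C : Type*} (ε d : ℝ) (G : C → SimpleGraph V)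
    (V₁ V₂ : Finset V) (D : Finset C) : Prop :=
  ColReg ε d G V₁ V₂ D ∧
  (∀ v ∈ V₁, d * (V₂.card : ℝ) * (D.card : ℝ) ≤ ∑ c ∈ D, (degIn (G c) v V₂ : ℝ)) ∧
  (∀ v ∈ V₂, d * (V₁.card : ℝ) * (D.card : ℝ) ≤ ∑ c ∈ D, (degIn (G c) v V₁ : ℝ)) ∧
  (∀ c ∈ D, d * (V₁.card : ℝ) * (V₂.card : ℝ) ≤ (pairCount (G c) V₁ V₂ : ℝ))

/-- `(ε,d)`-half-superregularity of a collection of bipartite graphs. -/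
def ColHalfSuperReg {V C : Type*} (ε d : ℝ) (G : C → SimpleGraph V)
    (V₁ V₂ : Finset V) (D : Finset C) : Prop :=
  (∀ V₁' ⊆ V₁, ∀ V₂' ⊆ V₂, ∀ D' ⊆ D,
    ε * (V₁.card : ℝ) ≤ (V₁'.card : ℝ) → ε * (V₂.card : ℝ) ≤ (V₂'.card : ℝ) →
    ε * (D.card : ℝ) ≤ (D'.card : ℝ) →
    d * (D'.card : ℝ) * (V₁'.card : ℝ) * (V₂'.card : ℝ) ≤
      ∑ c ∈ D', (pairCount (G c) V₁' V₂' : ℝ)) ∧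
  (∀ v ∈ V₁, d * (V₂.card : ℝ) * (D.card : ℝ) ≤ ∑ c ∈ D, (degIn (G c) v V₂ : ℝ)) ∧
  (∀ v ∈ V₂, d * (V₁.card : ℝ) * (D.card : ℝ) ≤ ∑ c ∈ D, (degIn (G c) v V₁ : ℝ)) ∧
  (∀ c ∈ D, d * (V₁.card : ℝ) * (V₂.card : ℝ) ≤ (pairCount (G c) V₁ V₂ : ℝ))

/-- `(ε,d)`-half-superregularity of a bipartite graph (given by an adjacency relation)
with parts `V₁, V₂`. -/
def BipHalfSuper {V : Type*} (ε d : ℝ) (A : V → V → Prop) (V₁ V₂ : Finset V) : Prop :=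
  (∀ U₁ ⊆ V₁, ∀ U₂ ⊆ V₂,
    ε * (V₁.card : ℝ) ≤ (U₁.card : ℝ) → ε * (V₂.card : ℝ) ≤ (U₂.card : ℝ) →
    d * (U₁.card : ℝ) * (U₂.card : ℝ) ≤
      (((U₁ ×ˢ U₂).filter (fun p => A p.1 p.2)).card : ℝ)) ∧
  (∀ x ∈ V₁, d * (V₂.card : ℝ) ≤ ((V₂.filter (fun y => A x y)).card : ℝ)) ∧
  (∀ y ∈ V₂, d * (V₁.card : ℝ) ≤ ((V₁.filter (fun x => A x y)).card : ℝ))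

/-- Number of ordered triples `(x₁,x₂,x₃) ∈ U₁ × U₂ × U₃` with `{x₁,x₂,x₃}` an edge. -/
noncomputable def tripCount {V : Type*} (E : Set (Finset V)) (U₁ U₂ U₃ : Finset V) : ℕ :=
  ((U₁ ×ˢ U₂ ×ˢ U₃).filter
    (fun p => ({p.1, p.2.1, p.2.2} : Finset V) ∈ E)).card

/-- Density of the triple `(U₁,U₂,U₃)` in a `3`-graph. -/
noncomputable def tripDensity {V : Type*} (E : Set (Finset V)) (U₁ U₂ U₃ : Finset V) : ℝ :=
  (tripCount E U₁ U₂ U₃ : ℝ) / ((U₁.card : ℝ) * (U₂.card : ℝ) * (U₃.card : ℝ))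

/-- Degree of a vertex in a hypergraph: the number of edges containing it. -/
noncomputable def hDeg {V : Type*} [Fintype V] (E : Set (Finset V)) (v : V) : ℕ :=
  ((univ : Finset (Finset V)).filter (fun e => e ∈ E ∧ v ∈ e)).card

/-- Weak `(ε,d)`-regularity of a 3-partite triple in a 3-graph. -/
def TripReg {V : Type*} (ε d : ℝ) (E : Set (Finset V)) (V₁ V₂ V₃ : Finset V) : Prop :=
  d ≤ tripDensity E V₁ V₂ V₃ ∧
  ∀ U₁ ⊆ V₁, ∀ U₂ ⊆ V₂, ∀ U₃ ⊆ V₃,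
    ε * (V₁.card : ℝ) ≤ (U₁.card : ℝ) → ε * (V₂.card : ℝ) ≤ (U₂.card : ℝ) →
    ε * (V₃.card : ℝ) ≤ (U₃.card : ℝ) →
    |tripDensity E U₁ U₂ U₃ - tripDensity E V₁ V₂ V₃| < ε

/-- Weak `(ε,d)`-half-superregularity of a 3-partite triple in a 3-graph. -/
def TripHalfSuper {V : Type*} (ε d : ℝ) (E : Set (Finset V)) (V₁ V₂ V₃ : Finset V) : Prop :=
  (∀ U₁ ⊆ V₁, ∀ U₂ ⊆ V₂, ∀ U₃ ⊆ V₃,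
    ε * (V₁.card : ℝ) ≤ (U₁.card : ℝ) → ε * (V₂.card : ℝ) ≤ (U₂.card : ℝ) →
    ε * (V₃.card : ℝ) ≤ (U₃.card : ℝ) →
    d * (U₁.card : ℝ) * (U₂.card : ℝ) * (U₃.card : ℝ) ≤ (tripCount E U₁ U₂ U₃ : ℝ)) ∧
  (∀ x ∈ V₁, d * (V₂.card : ℝ) * (V₃.card : ℝ) ≤ (tripCount E {x} V₂ V₃ : ℝ)) ∧
  (∀ y ∈ V₂, d * (V₁.card : ℝ) * (V₃.card : ℝ) ≤ (tripCount E V₁ {y} V₃ : ℝ)) ∧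
  (∀ z ∈ V₃, d * (V₁.card : ℝ) * (V₂.card : ℝ) ≤ (tripCount E V₁ V₂ {z} : ℝ))

/-- A copy of the 1-expansion of `H` in a 3-graph with edge set `E`. -/
def HasExpansionCopy {V W : Type*} (E : Set (Finset V)) (H : SimpleGraph W) : Prop :=
  ∃ (ρv : W → V) (ρe : Sym2 W → V),
    Function.Injective ρv ∧ Set.InjOn ρe H.edgeSet ∧
    (∀ x, ∀ e ∈ H.edgeSet, ρv x ≠ ρe e) ∧
    ∀ x y, H.Adj x y → ({ρv x, ρv y, ρe s(x, y)} : Finset V) ∈ E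

/-- Number of edges (as functions picking one vertex per part) inside the sets `U i`. -/
noncomputable def kCount {V : Type*} {k : ℕ} (E : Set (Fin k → V)) (U : Fin k → Finset V) : ℕ :=
  ((Fintype.piFinset U).filter (fun e => e ∈ E)).card

/-- Density of a `k`-tuple in a `k`-partite `k`-graph. -/
noncomputable def kDensity {V : Type*} {k : ℕ} (E : Set (Fin k → V)) (U : Fin k → Finset V) : ℝ :=
  (kCount E U : ℝ) / ∏ i, ((U i).card : ℝ)

/-- Degree of `x` as a vertex of the `i`-th part of a `k`-partite `k`-graph. -/
noncomputable def kDegAt {V : Type*} [Fintype V] {k : ℕ} (E : Set (Fin k → V))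
    (i : Fin k) (x : V) : ℕ :=
  ((univ : Finset (Fin k → V)).filter (fun e => e ∈ E ∧ e i = x)).card

/-- Weak ε-regularity of a `k`-tuple in a `k`-partite `k`-graph. -/
def KTupleReg {V : Type*} {k : ℕ} (ε : ℝ) (E : Set (Fin k → V)) (Wp : Fin k → Finset V) : Prop :=
  ∀ U : Fin k → Finset V, (∀ i, U i ⊆ Wp i) →
    (∀ i, ε * ((Wp i).card : ℝ) ≤ ((U i).card : ℝ)) →
    |kDensity E U - kDensity E Wp| < ε

/-- Weak `(ε,d)`-regularity of a `k`-partite `k`-graph with parts `P`. -/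
def KReg {V : Type*} {k : ℕ} (ε d : ℝ) (E : Set (Fin k → V)) (P : Fin k → Finset V) : Prop :=
  d ≤ kDensity E P ∧
  ∀ U : Fin k → Finset V, (∀ i, U i ⊆ P i) →
    (∀ i, ε * ((P i).card : ℝ) ≤ ((U i).card : ℝ)) →
    |kDensity E U - kDensity E P| < ε

/-- Weak `(ε,d)`-superregularity of a `k`-partite `k`-graph with parts `P`. -/
def KSuper {V : Type*} [Fintype V] {k : ℕ} (ε d : ℝ) (E : Set (Fin k → V))
    (P : Fin k → Finset V) : Prop :=
  KReg ε d E P ∧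
  ∀ i, ∀ x ∈ P i, d * (∏ j, ((P j).card : ℝ)) / ((P i).card : ℝ) ≤ (kDegAt E i x : ℝ)

/-- Weak `(ε,d)`-half-superregularity of a `k`-partite `k`-graph with parts `P`. -/
def KHalfSuper {V : Type*} [Fintype V] {k : ℕ} (ε d : ℝ) (E : Set (Fin k → V))
    (P : Fin k → Finset V) : Prop :=
  (∀ U : Fin k → Finset V, (∀ i, U i ⊆ P i) →
    (∀ i, ε * ((P i).card : ℝ) ≤ ((U i).card : ℝ)) →
    d ≤ kDensity E U) ∧
  ∀ i, ∀ x ∈ P i, d * (∏ j, ((P j).card : ℝ)) / ((P i).card : ℝ) ≤ (kDegAt E i x : ℝ)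

/-- An `R`-template: vertex clusters `Vc`, colour clusters `Cc i j` (one for each
edge `ij` of `R`), and for each colour `c ∈ Cc i j` a bipartite graph `Ge c i j`
with parts `Vc i`, `Vc j`.  The graph `G_c` of the collection is the union of the
`Ge c i j` over the edges `ij` of `R` whose colour cluster contains `c`. -/
structure GTemplate (V C : Type*) (r : ℕ) where
  R : SimpleGraph (Fin r)
  Vc : Fin r → Finset V
  Cc : Fin r → Fin r → Finset C
  Ge : C → Fin r → Fin r → SimpleGraph V
  Cc_symm : ∀ i j, Cc i j = Cc j i
  Ge_symm : ∀ c i j, Ge c i j = Ge c j i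
  Vc_disj : ∀ i j, i ≠ j → Disjoint (Vc i) (Vc j)
  Cc_support : ∀ i j, ¬ R.Adj i j → Cc i j = ∅
  Ge_support : ∀ c i j, c ∉ Cc i j → Ge c i j = ⊥
  Ge_bipartite : ∀ c i j x y, (Ge c i j).Adj x y →
    (x ∈ Vc i ∧ y ∈ Vc j) ∨ (x ∈ Vc j ∧ y ∈ Vc i)

namespace GTemplate

variable {V C : Type*} {r : ℕ}

/-- The graph `G_c` of the template: the union of the bipartite pieces. -/
noncomputable def Gc (T : GTemplate V C r) (c : C) : SimpleGraph V :=
  ⨆ i, ⨆ j, T.Ge c i j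

/-- `T` is an `R`-template with parameters `(m, ε, d, δ)`. -/
def IsParam (T : GTemplate V C r) (m ε d δ : ℝ) : Prop :=
  (∀ j, m ≤ ((T.Vc j).card : ℝ) ∧ ((T.Vc j).card : ℝ) ≤ m / δ) ∧
  (∀ i j, T.R.Adj i j → δ * m ≤ ((T.Cc i j).card : ℝ)) ∧
  (∀ i j, T.R.Adj i j →
    ColReg ε d (fun c => T.Ge c i j) (T.Vc i) (T.Vc j) (T.Cc i j))

/-- `T` is a super `R`-template with parameters `(m, ε, d, δ)`. -/
def IsSuperParam (T : GTemplate V C r) (m ε d δ : ℝ) : Prop :=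
  (∀ j, m ≤ ((T.Vc j).card : ℝ) ∧ ((T.Vc j).card : ℝ) ≤ m / δ) ∧
  (∀ i j, T.R.Adj i j → δ * m ≤ ((T.Cc i j).card : ℝ)) ∧
  (∀ i j, T.R.Adj i j →
    ColSuperReg ε d (fun c => T.Ge c i j) (T.Vc i) (T.Vc j) (T.Cc i j))

/-- `T` is a half-super `R`-template with parameters `(m, ε, d, δ)`. -/
def IsHalfSuperParam (T : GTemplate V C r) (m ε d δ : ℝ) : Prop :=
  (∀ j, m ≤ ((T.Vc j).card : ℝ) ∧ ((T.Vc j).card : ℝ) ≤ m / δ) ∧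
  (∀ i j, T.R.Adj i j → δ * m ≤ ((T.Cc i j).card : ℝ)) ∧
  (∀ i j, T.R.Adj i j →
    ColHalfSuperReg ε d (fun c => T.Ge c i j) (T.Vc i) (T.Vc j) (T.Cc i j))

/-- `T` is a semi-super `R`-template with parameters `(m, ε, d, δ)`. -/
def IsSemiSuperParam (T : GTemplate V C r) (m ε d δ : ℝ) : Prop :=
  T.IsParam m ε d δ ∧
  ∀ i j, T.R.Adj i j →
    (∀ v ∈ T.Vc i, d * ((T.Vc j).card : ℝ) * ((T.Cc i j).card : ℝ) ≤
      ∑ c ∈ T.Cc i j, (degIn (T.Ge c i j) v (T.Vc j) : ℝ)) ∧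
    (∀ v ∈ T.Vc j, d * ((T.Vc i).card : ℝ) * ((T.Cc i j).card : ℝ) ≤
      ∑ c ∈ T.Cc i j, (degIn (T.Ge c i j) v (T.Vc i) : ℝ))

/-- The template is rainbow: the colour clusters are pairwise disjoint. -/
def Rainbow (T : GTemplate V C r) : Prop :=
  ∀ i j k l, T.R.Adj i j → T.R.Adj k l → s(i, j) ≠ s(k, l) →
    Disjoint (T.Cc i j) (T.Cc k l)

/-- Adjacency in the `l`-thick graph of the template, between clusters `i` and `j`. -/
def ThickAdj (T : GTemplate V C r) (l : ℝ) (i j : Fin r) (x y : V) : Prop :=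
  l * ((T.Cc i j).card : ℝ) ≤
    (((T.Cc i j).filter (fun c => (T.Ge c i j).Adj x y)).card : ℝ)

end GTemplate

/-! ## Statement 3 -/

namespace BU

/-- A trivial system of distinct representatives. -/
theorem sdr {ι V : Type*} [Nonempty V] (I : Finset ι) (S : ι → Finset V)
    (h : ∀ i ∈ I, I.card ≤ (S i).card) :
    ∃ f : ι → V, Set.InjOn f I ∧ ∀ i ∈ I, f i ∈ S i := by
  have key := (Finset.all_card_le_biUnion_card_iff_exists_injective
    (fun i : I => S i.1)).1 (by
      intro s
      rcases s.eq_empty_or_nonempty with rfl | ⟨i, hi⟩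
      · simp
      · calc s.card ≤ (univ : Finset I).card := card_le_univ s
          _ = I.card := by simp
          _ ≤ (S i.1).card := h i.1 i.2
          _ ≤ _ := card_le_card (subset_biUnion_of_mem (fun i : I => S i.1) hi))
  obtain ⟨f, hf, hfs⟩ := key
  refine ⟨fun i => if hi : i ∈ I then f ⟨i, hi⟩ else Classical.arbitrary V, ?_, ?_⟩
  · intro a ha b hb hab
    simp only [mem_coe] at ha hb
    simp only [ha, hb, dif_pos] at hab
    simpa using hf hab
  · intro i hi
    simpa [hi] using hfs ⟨i, hi⟩

/-- Host and guest data. -/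
structure Ctx (V W : Type) [Fintype W] where
  P : Bool → Finset V
  C : Finset V
  T : V → V → V → Prop
  Tsymm : ∀ u v c, T u v c → T v u c
  H : SimpleGraph W
  side : W → Bool
  hside : ∀ x y, H.Adj x y → side y = !side x
  Δ : ℕ
  hΔ : 1 ≤ Δ
  hdeg : ∀ w, ((univ : Finset W).filter (fun y => H.Adj w y)).card ≤ Δ
  θ : ℝ
  ε : ℝ
  hθ : 0 < θ
  hθ1 : θ ≤ 1
  hε : 0 < ε
  reg : ∀ b, ∀ U ⊆ P (!b), ∀ D ⊆ C, ε * ((P (!b)).card : ℝ) ≤ U.card → ε * (C.card : ℝ) ≤ D.card →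
    (((P b).filter (fun u => ((U.filter (fun v => θ * (D.card : ℝ) ≤
      ((D.filter (fun c => T u v c)).card : ℝ))).card : ℝ) < θ * U.card)).card : ℝ) ≤ ε * (P b).card
  deg : ∀ b, ∀ u ∈ P b, θ * ((P (!b)).card : ℝ) ≤ (((P (!b)).filter (fun v => θ * (C.card : ℝ) ≤
      ((C.filter (fun c => T u v c)).card : ℝ))).card : ℝ)
  cdeg : ∀ c ∈ C, θ * ((P true).card : ℝ) * (P false).card ≤
    ((((P true) ×ˢ (P false)).filter (fun p => T p.1 p.2 c)).card : ℝ)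
  creg : ∀ U₁ ⊆ P true, ∀ U₂ ⊆ P false, ε * ((P true).card : ℝ) ≤ U₁.card →
    ε * ((P false).card : ℝ) ≤ U₂.card →
    ((C.filter (fun c => (((U₁ ×ˢ U₂).filter (fun p => T p.1 p.2 c)).card : ℝ) <
      θ * (U₁.card : ℝ) * U₂.card)).card : ℝ) ≤ ε * C.card

namespace Ctx

variable {V W : Type} [Fintype W] (X : Ctx V W)

/-- neighbours -/
noncomputable def nb (w : W) : Finset W := (univ : Finset W).filter (fun y => X.H.Adj w y)

theorem mem_nb {w y : W} : y ∈ X.nb w ↔ X.H.Adj w y := by simp [nb]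

theorem card_nb (w : W) : (X.nb w).card ≤ X.Δ := X.hdeg w

/-- The pair `u v` has many colours in `D`. -/
def thick (D : Finset V) (u v : V) : Prop :=
  X.θ * (D.card : ℝ) ≤ ((D.filter (fun c => X.T u v c)).card : ℝ)

theorem T_comm (u v c : V) : X.T u v c ↔ X.T v u c := ⟨X.Tsymm _ _ _, X.Tsymm _ _ _⟩

theorem thick_comm (D : Finset V) (u v : V) : X.thick D u v ↔ X.thick D v u := by
  unfold thick
  simp only [X.T_comm u v]

/-- Coloured edges inside `emb`. -/
noncomputable def colE (M : Finset (Sym2 W)) (emb : Finset W) : Finset (Sym2 W) :=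
  (univ : Finset (Sym2 W)).filter (fun e => e ∈ X.H.edgeSet ∧ e ∉ M ∧ ∀ z ∈ e, z ∈ emb)

theorem mem_colE {M : Finset (Sym2 W)} {emb : Finset W} {e : Sym2 W} :
    e ∈ X.colE M emb ↔ e ∈ X.H.edgeSet ∧ e ∉ M ∧ ∀ z ∈ e, z ∈ emb := by simp [colE]

theorem colE_mono (M : Finset (Sym2 W)) {A B : Finset W} (h : A ⊆ B) : X.colE M A ⊆ X.colE M B := by
  intro e he
  rw [mem_colE] at he ⊢
  exact ⟨he.1, he.2.1, fun z hz => h (he.2.2 z hz)⟩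

/-- Edges touching a set. -/
noncomputable def tch (K : Finset W) : Finset (Sym2 W) :=
  (univ : Finset (Sym2 W)).filter (fun e => e ∈ X.H.edgeSet ∧ ∃ z ∈ e, z ∈ K)

theorem mem_tch {K : Finset W} {e : Sym2 W} :
    e ∈ X.tch K ↔ e ∈ X.H.edgeSet ∧ ∃ z ∈ e, z ∈ K := by simp [tch]

theorem card_tch (K : Finset W) : (X.tch K).card ≤ X.Δ * K.card := by
  have : X.tch K ⊆ K.biUnion (fun z => (X.nb z).image (fun y => s(z, y))) := by
    intro e he
    rw [mem_tch] at he
    obtain ⟨he, z, hz, hzK⟩ := he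
    obtain ⟨y, rfl⟩ := hz
    simp only [mem_biUnion, mem_image]
    exact ⟨z, hzK, y, by rw [mem_nb]; exact he, rfl⟩
  calc (X.tch K).card ≤ _ := card_le_card this
    _ ≤ ∑ z ∈ K, ((X.nb z).image (fun y => s(z, y))).card := card_biUnion_le
    _ ≤ ∑ z ∈ K, X.Δ := sum_le_sum fun z _ => card_image_le.trans (X.card_nb z)
    _ = X.Δ * K.card := by simp [mul_comm]

theorem newE_sub (M : Finset (Sym2 W)) (A K : Finset W) :
    X.colE M (A ∪ K) \ X.colE M A ⊆ X.tch K := by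
  intro e he
  rw [mem_sdiff, mem_colE, mem_colE] at he
  rw [mem_tch]
  refine ⟨he.1.1, ?_⟩
  by_contra hcon
  push Not at hcon
  apply he.2
  refine ⟨he.1.1, he.1.2.1, fun z hz => ?_⟩
  have := he.1.2.2 z hz
  have h2 := hcon z hz
  simp only [mem_union] at this
  tauto

/-- Vertex state. -/
structure VS (emb : Finset W) (φ : W → V) : Prop where
  inj : Set.InjOn φ emb
  mem : ∀ z ∈ emb, φ z ∈ X.P (X.side z)

/-- colour validity -/
def Tc (φ : W → V) (e : Sym2 W) (c : V) : Prop := ∀ x y, e = s(x, y) → X.T (φ x) (φ y) c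

theorem Tc_mk (φ : W → V) (x y : W) (c : V) : X.Tc φ s(x, y) c ↔ X.T (φ x) (φ y) c := by
  constructor
  · intro h; exact h x y rfl
  · intro h a b hab
    rw [Sym2.eq_iff] at hab
    rcases hab with ⟨rfl, rfl⟩ | ⟨rfl, rfl⟩
    · exact h
    · exact X.Tsymm _ _ _ h

theorem Tc_congr {φ φ' : W → V} {e : Sym2 W} (h : ∀ z ∈ e, φ' z = φ z) (c : V) :
    X.Tc φ' e c ↔ X.Tc φ e c := by
  induction e using Sym2.ind with
  | _ x y =>
    rw [Tc_mk, Tc_mk, h x (by simp), h y (by simp)]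

/-- Colour state. -/
structure CS (F : Finset (Sym2 W)) (φ : W → V) (σ : Sym2 W → V) : Prop where
  inj : Set.InjOn σ F
  mem : ∀ e ∈ F, σ e ∈ X.C
  col : ∀ e ∈ F, X.Tc φ e (σ e)

/-- Candidates. -/
noncomputable def cand (Pool : W → Finset V) (Ty : Sym2 W → Finset V) (emb : Finset W) (φ : W → V)
    (z : W) : Finset V :=
  (Pool z).filter (fun w => ∀ y ∈ emb, X.H.Adj z y → X.thick (Ty s(z, y)) w (φ y))

def Inv (Pool : W → Finset V) (Ty : Sym2 W → Finset V) (emb : Finset W) (φ : W → V) : Prop :=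
  ∀ z, z ∉ emb → X.θ ^ (X.nb z ∩ emb).card * ((Pool z).card : ℝ) ≤ ((X.cand Pool Ty emb φ z).card : ℝ)

theorem VS.congr {emb : Finset W} {φ φ' : W → V} (h : X.VS emb φ) (hh : ∀ z ∈ emb, φ' z = φ z) :
    X.VS emb φ' := by
  refine ⟨?_, fun z hz => by rw [hh z hz]; exact h.mem z hz⟩
  intro a ha b hb hab
  rw [hh a ha, hh b hb] at hab
  exact h.inj ha hb hab

theorem CS.congr {F : Finset (Sym2 W)} {φ φ' : W → V} {σ : Sym2 W → V} (h : X.CS F φ σ)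
    (hh : ∀ e ∈ F, ∀ z ∈ e, φ' z = φ z) : X.CS F φ' σ :=
  ⟨h.inj, h.mem, fun e he => (X.Tc_congr (hh e he) _).2 (h.col e he)⟩

theorem cand_congr {Pool Pool' : W → Finset V} {Ty Ty' : Sym2 W → Finset V} {emb : Finset W}
    {φ φ' : W → V} {z : W} (hP : Pool' z = Pool z)
    (hT : ∀ y ∈ emb, X.H.Adj z y → Ty' s(z, y) = Ty s(z, y)) (hφ : ∀ y ∈ emb, φ' y = φ y) :
    X.cand Pool' Ty' emb φ' z = X.cand Pool Ty emb φ z := by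
  unfold cand
  rw [hP]
  apply filter_congr
  intro w _
  constructor
  · intro h y hy hzy; have := h y hy hzy; rwa [hT y hy hzy, hφ y hy] at this
  · intro h y hy hzy; rw [hT y hy hzy, hφ y hy]; exact h y hy hzy

theorem cand_free {Pool : W → Finset V} {Ty : Sym2 W → Finset V} {emb : Finset W}
    {φ : W → V} {z : W} (h : ∀ y ∈ emb, ¬ X.H.Adj z y) : X.cand Pool Ty emb φ z = Pool z := by
  unfold cand
  apply filter_true_of_mem
  intro w _ y hy hzy
  exact absurd hzy (h y hy)

theorem nb_free {emb : Finset W} {z : W} (h : ∀ y ∈ emb, ¬ X.H.Adj z y) : X.nb z ∩ emb = ∅ := by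
  ext y
  simp only [mem_inter, mem_nb, notMem_empty, iff_false, not_and]
  exact fun h1 h2 => h y h2 h1

theorem Inv.congr {Pool Pool' : W → Finset V} {Ty Ty' : Sym2 W → Finset V} {emb : Finset W}
    {φ : W → V} (hI : X.Inv Pool Ty emb φ)
    (hP : ∀ z, z ∉ emb → Pool' z ≠ Pool z → ∀ y ∈ emb, ¬ X.H.Adj z y)
    (hT : ∀ z, z ∉ emb → ∀ y ∈ emb, X.H.Adj z y → Ty' s(z, y) = Ty s(z, y)) :
    X.Inv Pool' Ty' emb φ := by
  intro z hz
  by_cases h : Pool' z = Pool z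
  · rw [X.cand_congr h (hT z hz) (fun _ _ => rfl), h]
    exact hI z hz
  · rw [X.cand_free (hP z hz h), X.nb_free (hP z hz h)]
    simp

theorem inv_empty (Pool : W → Finset V) (Ty : Sym2 W → Finset V) (φ : W → V) :
    X.Inv Pool Ty ∅ φ := by
  intro z _
  rw [X.cand_free (by simp)]
  simp

/-- Atypical images for `z`. -/
noncomputable def aty (Pool : W → Finset V) (Ty : Sym2 W → Finset V) (emb : Finset W) (φ : W → V)
    (z : W) : Finset V :=
  (X.P (X.side z)).filter (fun w => ∃ y, y ∉ emb ∧ X.H.Adj z y ∧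
    (((X.cand Pool Ty emb φ y).filter (fun v => X.thick (Ty s(y, z)) v w)).card : ℝ) <
      X.θ * (X.cand Pool Ty emb φ y).card)

/-- pool conditions -/
structure PC (Pool : W → Finset V) (Ty : Sym2 W → Finset V) (emb : Finset W) : Prop where
  sub : ∀ y, y ∉ emb → Pool y ⊆ X.P (X.side y)
  big : ∀ y, y ∉ emb → X.ε * ((X.P (X.side y)).card : ℝ) ≤ X.θ ^ X.Δ * (Pool y).card
  tsub : ∀ e, Ty e ⊆ X.C
  tbig : ∀ e, X.ε * (X.C.card : ℝ) ≤ (Ty e).card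

theorem tau_le (k : ℕ) (h : k ≤ X.Δ) : X.θ ^ X.Δ ≤ X.θ ^ k :=
  pow_le_pow_of_le_one X.hθ.le X.hθ1 h

theorem cand_big {Pool : W → Finset V} {Ty : Sym2 W → Finset V} {emb : Finset W} {φ : W → V}
    (hI : X.Inv Pool Ty emb φ) {z : W} (hz : z ∉ emb) :
    X.θ ^ X.Δ * ((Pool z).card : ℝ) ≤ ((X.cand Pool Ty emb φ z).card : ℝ) := by
  refine le_trans ?_ (hI z hz)
  apply mul_le_mul_of_nonneg_right _ (Nat.cast_nonneg _)
  apply X.tau_le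
  exact (card_le_card inter_subset_left).trans (X.card_nb z)

theorem card_aty {Pool : W → Finset V} {Ty : Sym2 W → Finset V} {emb : Finset W} {φ : W → V}
    (hI : X.Inv Pool Ty emb φ) (hPC : X.PC Pool Ty emb) (z : W) :
    ((X.aty Pool Ty emb φ z).card : ℝ) ≤ X.Δ * X.ε * (X.P (X.side z)).card := by
  let Bd : W → Finset V := fun y => (X.P (X.side z)).filter (fun w =>
    (((X.cand Pool Ty emb φ y).filter (fun v => X.thick (Ty s(y, z)) v w)).card : ℝ) <
      X.θ * (X.cand Pool Ty emb φ y).card)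
  have hsub : X.aty Pool Ty emb φ z ⊆ (X.nb z \ emb).biUnion Bd := by
    intro w hw
    simp only [aty, mem_filter] at hw
    obtain ⟨hw, y, hy, hzy, hlt⟩ := hw
    simp only [mem_biUnion, mem_sdiff, mem_nb]
    exact ⟨y, ⟨hzy, hy⟩, by simp only [Bd, mem_filter]; exact ⟨hw, hlt⟩⟩
  have hB : ∀ y ∈ X.nb z \ emb, ((Bd y).card : ℝ) ≤ X.ε * (X.P (X.side z)).card := by
    intro y hy
    simp only [mem_sdiff, mem_nb] at hy
    have hs := X.hside _ _ hy.1
    have := X.reg (X.side z) (X.cand Pool Ty emb φ y)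
      (by rw [← hs]; exact (filter_subset _ _).trans (hPC.sub y hy.2)) (Ty s(y, z)) (hPC.tsub _)
      (by rw [← hs]; exact (hPC.big y hy.2).trans (X.cand_big hI hy.2)) (hPC.tbig _)
    simp only [Bd]
    simp only [X.thick_comm]
    exact this
  calc ((X.aty Pool Ty emb φ z).card : ℝ) ≤ (((X.nb z \ emb).biUnion Bd).card : ℝ) := by
        exact_mod_cast card_le_card hsub
    _ ≤ ∑ y ∈ X.nb z \ emb, ((Bd y).card : ℝ) := by exact_mod_cast card_biUnion_le
    _ ≤ ∑ y ∈ X.nb z \ emb, X.ε * (X.P (X.side z)).card := sum_le_sum hB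
    _ = ((X.nb z \ emb).card : ℝ) * (X.ε * (X.P (X.side z)).card) := by simp
    _ ≤ X.Δ * (X.ε * (X.P (X.side z)).card) := by
        apply mul_le_mul_of_nonneg_right
        · exact_mod_cast (card_le_card sdiff_subset).trans (X.card_nb z)
        · have := X.hε; positivity
    _ = _ := by ring

/-- Placing a single vertex. -/
theorem place {Pool : W → Finset V} {Ty : Sym2 W → Finset V} {emb : Finset W} {φ : W → V}
    (hV : X.VS emb φ) (hI : X.Inv Pool Ty emb φ) {z : W} (hz : z ∉ emb) {w : V}
    (hw : w ∈ X.P (X.side z)) (hwn : w ∉ emb.image φ) (hty : w ∉ X.aty Pool Ty emb φ z) :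
    X.VS (insert z emb) (Function.update φ z w) ∧
      X.Inv Pool Ty (insert z emb) (Function.update φ z w) := by
  have hag : ∀ y ∈ emb, Function.update φ z w y = φ y := by
    intro y hy
    rw [Function.update_of_ne]
    rintro rfl; exact hz hy
  refine ⟨⟨?_, ?_⟩, ?_⟩
  · rw [coe_insert, Set.injOn_insert (by simpa using hz)]
    refine ⟨(VS.congr X hV hag).inj, ?_⟩
    rintro ⟨y, hy, hyw⟩
    rw [hag y hy, Function.update_self] at hyw
    exact hwn (mem_image.2 ⟨y, hy, hyw⟩)
  · intro y hy
    rcases mem_insert.1 hy with rfl | hy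
    · simpa using hw
    · rw [hag y hy]; exact hV.mem y hy
  · intro y hy
    simp only [mem_insert, not_or] at hy
    by_cases hadj : X.H.Adj z y
    · have h1 : X.cand Pool Ty (insert z emb) (Function.update φ z w) y =
          (X.cand Pool Ty emb φ y).filter (fun v => X.thick (Ty s(y, z)) v w) := by
        unfold cand
        rw [filter_filter]
        apply filter_congr
        intro v _
        simp only [forall_mem_insert, Function.update_self]
        constructor
        · rintro ⟨ha, hb⟩
          refine ⟨fun u hu huy => ?_, ha hadj.symm⟩
          have := hb u hu huy
          rwa [hag u hu] at this
        · rintro ⟨ha, hb⟩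
          refine ⟨fun _ => hb, fun u hu huy => ?_⟩
          rw [hag u hu]; exact ha u hu huy
      have h2 : X.nb y ∩ insert z emb = insert z (X.nb y ∩ emb) := by
        ext u
        simp only [mem_inter, mem_insert, mem_nb]
        constructor
        · tauto
        · rintro (rfl | h)
          · exact ⟨hadj.symm, Or.inl rfl⟩
          · tauto
      rw [h1, h2, card_insert_of_notMem (by simp [hz])]
      have h3 : ¬ ((((X.cand Pool Ty emb φ y).filter (fun v => X.thick (Ty s(y, z)) v w)).card : ℝ) <
          X.θ * (X.cand Pool Ty emb φ y).card) := by
        intro h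
        apply hty
        simp only [aty, mem_filter]
        exact ⟨hw, y, hy.2, hadj, h⟩
      rw [not_lt] at h3
      refine le_trans ?_ h3
      rw [pow_succ, mul_comm _ X.θ, mul_assoc]
      exact mul_le_mul_of_nonneg_left (hI y hy.2) X.hθ.le
    · have h1 : X.cand Pool Ty (insert z emb) (Function.update φ z w) y = X.cand Pool Ty emb φ y := by
        unfold cand
        apply filter_congr
        intro v _
        simp only [forall_mem_insert]
        constructor
        · rintro ⟨-, hb⟩ u hu huy
          have := hb u hu huy
          rwa [hag u hu] at this
        · intro ha
          refine ⟨fun h => absurd h.symm hadj, fun u hu huy => ?_⟩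
          rw [hag u hu]; exact ha u hu huy
      have h2 : X.nb y ∩ insert z emb = X.nb y ∩ emb := by
        ext u
        simp only [mem_inter, mem_insert, mem_nb]
        constructor
        · rintro ⟨h, (rfl | h')⟩
          · exact absurd h.symm hadj
          · exact ⟨h, h'⟩
        · tauto
      rw [h1, h2]
      exact hI y hy.2

/-- Embedding a whole set of vertices. -/
theorem vmulti {Pool : W → Finset V} {Ty : Sym2 W → Finset V} {emb : Finset W} {φ : W → V}
    (hV : X.VS emb φ) (hI : X.Inv Pool Ty emb φ) (hPC : X.PC Pool Ty emb) (Av : W → Finset V)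
    (N : ℕ) (K : Finset W) : K.card ≤ N → Disjoint K emb →
    (∀ z ∈ K, (((Pool z).filter (fun w => w ∈ Av z ∨ w ∈ emb.image φ)).card : ℝ) + N +
      X.Δ * X.ε * (X.P (X.side z)).card < X.θ ^ X.Δ * (Pool z).card) →
    ∃ φ' : W → V, (∀ z, z ∉ K → φ' z = φ z) ∧ X.VS (emb ∪ K) φ' ∧ X.Inv Pool Ty (emb ∪ K) φ' ∧
      (∀ z ∈ K, φ' z ∈ Pool z ∧ φ' z ∉ Av z ∧ φ' z ∉ emb.image φ) ∧
      (∀ x ∈ K, ∀ y ∈ emb ∪ K, X.H.Adj x y → X.thick (Ty s(x, y)) (φ' x) (φ' y)) := by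
  induction K using Finset.induction_on with
  | empty =>
    intro _ _ _
    exact ⟨φ, by simp, by simpa using hV, by simpa using hI, by simp, by simp⟩
  | insert z K hzK ih =>
    intro hN hdisj hroom
    rw [card_insert_of_notMem hzK] at hN
    rw [disjoint_insert_left] at hdisj
    obtain ⟨φ', hag, hV', hI', hmem, hth⟩ := ih (by omega) hdisj.2
      (fun y hy => hroom y (mem_insert_of_mem hy))
    have hzn : z ∉ emb ∪ K := by simp [hdisj.1, hzK]
    have hPC' : X.PC Pool Ty (emb ∪ K) :=
      ⟨fun y hy => hPC.sub y (fun h => hy (mem_union_left _ h)),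
       fun y hy => hPC.big y (fun h => hy (mem_union_left _ h)), hPC.tsub, hPC.tbig⟩
    have hagE : emb.image φ' = emb.image φ := by
      apply image_congr
      intro y hy
      exact hag y (fun h => disjoint_left.1 hdisj.2 h hy)
    -- choose the image
    have hex : ∃ w ∈ X.cand Pool Ty (emb ∪ K) φ' z, w ∉ ((Pool z).filter (fun w => w ∈ Av z ∨ w ∈ emb.image φ)) ∪
        K.image φ' ∪ X.aty Pool Ty (emb ∪ K) φ' z := by
      by_contra hcon
      push Not at hcon
      have h1 : ((X.cand Pool Ty (emb ∪ K) φ' z).card : ℝ) ≤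
          ((((Pool z).filter (fun w => w ∈ Av z ∨ w ∈ emb.image φ)) ∪
          K.image φ' ∪ X.aty Pool Ty (emb ∪ K) φ' z).card : ℝ) := by
        exact_mod_cast card_le_card hcon
      have h2 : ((((Pool z).filter (fun w => w ∈ Av z ∨ w ∈ emb.image φ)) ∪
          K.image φ' ∪ X.aty Pool Ty (emb ∪ K) φ' z).card : ℝ) ≤
          (((Pool z).filter (fun w => w ∈ Av z ∨ w ∈ emb.image φ)).card : ℝ) + (K.image φ').card +
          (X.aty Pool Ty (emb ∪ K) φ' z).card := by
        exact_mod_cast (card_union_le _ _).trans (Nat.add_le_add_right (card_union_le _ _) _)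
      have h3 : ((K.image φ').card : ℝ) ≤ N := by
        exact_mod_cast card_image_le.trans (by omega)
      have h4 := X.card_aty hI' hPC' z
      have h5 := X.cand_big hI' hzn
      have h6 := hroom z (mem_insert_self _ _)
      linarith
    obtain ⟨w, hwc, hwn⟩ := hex
    simp only [mem_union, not_or] at hwn
    have hwP : w ∈ Pool z := (mem_filter.1 hwc).1
    have hwAv : ¬ (w ∈ Av z ∨ w ∈ emb.image φ) := fun h => hwn.1.1 (mem_filter.2 ⟨hwP, h⟩)
    rw [not_or] at hwAv
    obtain ⟨hV2, hI2⟩ := X.place hV' hI' hzn (hPC'.sub z hzn hwP)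
      (by rw [image_union, mem_union, hagE, not_or]; exact ⟨hwAv.2, hwn.1.2⟩) hwn.2
    have hne : ∀ y, y ≠ z → Function.update φ' z w y = φ' y := fun y hy => Function.update_of_ne hy _ _
    refine ⟨Function.update φ' z w, ?_, ?_, ?_, ?_, ?_⟩
    · intro y hy
      simp only [mem_insert, not_or] at hy
      rw [hne y hy.1, hag y hy.2]
    · rw [union_insert]; exact hV2
    · rw [union_insert]; exact hI2
    · intro y hy
      rcases mem_insert.1 hy with rfl | hy
      · rw [Function.update_self]; exact ⟨hwP, hwAv.1, hwAv.2⟩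
      · rw [hne y (fun h => hzK (h ▸ hy))]; exact hmem y hy
    · have hwth : ∀ y ∈ emb ∪ K, X.H.Adj z y → X.thick (Ty s(z, y)) w (φ' y) := (mem_filter.1 hwc).2
      intro x hx y hy hxy
      by_cases hxz : x = z
      · subst hxz
        have hyx : y ≠ x := hxy.ne'
        rw [Function.update_self, hne y hyx]
        apply hwth y _ hxy
        simp only [mem_union, mem_insert] at hy ⊢
        tauto
      · have hx' : x ∈ K := by simpa [hxz] using hx
        rw [hne x hxz]
        by_cases hyz : y = z
        · subst hyz
          rw [Function.update_self, X.thick_comm, Sym2.eq_swap]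
          exact hwth x (mem_union_right _ hx') hxy.symm
        · rw [hne y hyz]
          apply hth x hx' y _ hxy
          simp only [mem_union, mem_insert] at hy ⊢
          tauto

/-- Extending a colouring to a larger set of edges. -/
theorem colour_ext [Nonempty V] {F F' : Finset (Sym2 W)} {φ : W → V} {σ : Sym2 W → V}
    (hC : X.CS F φ σ) (hFF : F ⊆ F') (S : Sym2 W → Finset V)
    (hS : ∀ e ∈ F' \ F, S e ⊆ X.C ∧ (∀ c ∈ S e, X.Tc φ e c) ∧
      ((F' \ F).card : ℝ) + ((S e).filter (fun c => c ∈ F.image σ)).card ≤ (S e).card) :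
    ∃ σ' : Sym2 W → V, (∀ e, e ∉ F' \ F → σ' e = σ e) ∧ X.CS F' φ σ' ∧
      ∀ e ∈ F' \ F, σ' e ∈ S e ∧ σ' e ∉ F.image σ := by
  obtain ⟨f, hf, hfS⟩ := sdr (F' \ F) (fun e => (S e).filter (fun c => c ∉ F.image σ)) (by
    intro e he
    have h1 := (hS e he).2.2
    have h2 := card_filter_add_card_filter_not (s := S e) (fun c => c ∈ F.image σ)
    have h3 : (((S e).filter (fun c => c ∈ F.image σ)).card : ℝ) +
      ((S e).filter (fun c => c ∉ F.image σ)).card = (S e).card := by exact_mod_cast h2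
    have h4 : (((F' \ F).card : ℕ) : ℝ) ≤ (((S e).filter (fun c => c ∉ F.image σ)).card : ℝ) := by
      linarith
    exact_mod_cast h4)
  let σ' : Sym2 W → V := fun e => if e ∈ F' \ F then f e else σ e
  have h1 : ∀ e, e ∉ F' \ F → σ' e = σ e := fun e he => if_neg he
  have h2 : ∀ e ∈ F' \ F, σ' e = f e := fun e he => if_pos he
  have h3 : ∀ e ∈ F' \ F, σ' e ∈ S e ∧ σ' e ∉ F.image σ := by
    intro e he
    rw [h2 e he]
    exact mem_filter.1 (hfS e he)
  have h4 : ∀ e ∈ F, σ' e = σ e := fun e he => h1 e (by simp [he])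
  refine ⟨σ', h1, ⟨?_, ?_, ?_⟩, h3⟩
  · intro a ha b hb hab
    by_cases haF : a ∈ F <;> by_cases hbF : b ∈ F
    · rw [h4 a haF, h4 b hbF] at hab
      exact hC.inj haF hbF hab
    · exfalso
      apply (h3 b (mem_sdiff.2 ⟨hb, hbF⟩)).2
      rw [← hab, h4 a haF]
      exact mem_image_of_mem _ haF
    · exfalso
      apply (h3 a (mem_sdiff.2 ⟨ha, haF⟩)).2
      rw [hab, h4 b hbF]
      exact mem_image_of_mem _ hbF
    · have ha' := mem_sdiff.2 ⟨ha, haF⟩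
      have hb' := mem_sdiff.2 ⟨hb, hbF⟩
      rw [h2 a ha', h2 b hb'] at hab
      exact hf ha' hb' hab
  · intro e he
    by_cases heF : e ∈ F
    · rw [h4 e heF]; exact hC.mem e heF
    · have he' := mem_sdiff.2 ⟨he, heF⟩
      exact (hS e he').1 (h3 e he').1
  · intro e he
    by_cases heF : e ∈ F
    · rw [h4 e heF]; exact hC.col e heF
    · have he' := mem_sdiff.2 ⟨he, heF⟩
      exact (hS e he').2.1 _ (h3 e he').1

/-- Embedding and colouring a whole set. -/
theorem multi [Nonempty V] {Pool : W → Finset V} {Ty : Sym2 W → Finset V} {emb : Finset W} {φ : W → V}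
    {σ : Sym2 W → V} (M : Finset (Sym2 W))
    (hV : X.VS emb φ) (hC : X.CS (X.colE M emb) φ σ) (hI : X.Inv Pool Ty emb φ)
    (hPC : X.PC Pool Ty emb) (Av : W → Finset V) (AvC : Sym2 W → Finset V)
    (N : ℕ) (K : Finset W) (hN : K.card ≤ N) (hd : Disjoint K emb)
    (hroom : ∀ z ∈ K, (((Pool z).filter (fun w => w ∈ Av z ∨ w ∈ emb.image φ)).card : ℝ) + N +
      X.Δ * X.ε * (X.P (X.side z)).card < X.θ ^ X.Δ * (Pool z).card)
    (hcroom : ∀ e ∈ X.colE M (emb ∪ K) \ X.colE M emb,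
      (((Ty e).filter (fun c => c ∈ AvC e ∨ c ∈ (X.colE M emb).image σ)).card : ℝ) + X.Δ * N ≤
        X.θ * (Ty e).card) :
    ∃ (φ' : W → V) (σ' : Sym2 W → V), (∀ z, z ∉ K → φ' z = φ z) ∧
      (∀ e ∈ X.colE M emb, σ' e = σ e) ∧
      X.VS (emb ∪ K) φ' ∧ X.CS (X.colE M (emb ∪ K)) φ' σ' ∧ X.Inv Pool Ty (emb ∪ K) φ' ∧
      (∀ z ∈ K, φ' z ∈ Pool z ∧ φ' z ∉ Av z) ∧
      (∀ x ∈ K, ∀ y ∈ emb ∪ K, X.H.Adj x y → X.thick (Ty s(x, y)) (φ' x) (φ' y)) ∧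
      (∀ e ∈ X.colE M (emb ∪ K) \ X.colE M emb, σ' e ∈ Ty e ∧ σ' e ∉ AvC e) := by
  obtain ⟨φ', hag, hV', hI', hmem, hth⟩ := X.vmulti hV hI hPC Av N K hN hd hroom
  have hC' : X.CS (X.colE M emb) φ' σ := by
    apply CS.congr X hC
    intro e he z hz
    apply hag
    intro hzK
    exact disjoint_left.1 hd hzK ((X.mem_colE.1 he).2.2 z hz)
  have hthick : ∀ e ∈ X.colE M (emb ∪ K) \ X.colE M emb,
      X.θ * ((Ty e).card : ℝ) ≤ ((Ty e).filter (fun c => X.Tc φ' e c)).card := by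
    intro e he
    have het := X.newE_sub M emb K he
    have heu := (X.mem_colE.1 (mem_sdiff.1 he).1).2.2
    rw [X.mem_tch] at het
    obtain ⟨hee, x, hx, hxK⟩ := het
    obtain ⟨y, rfl⟩ := hx
    have := hth x hxK y (heu y (by simp)) hee
    unfold thick at this
    simpa only [X.Tc_mk] using this
  obtain ⟨σ', h1, h2, h3⟩ := X.colour_ext hC' (X.colE_mono M (subset_union_left (s₂ := K)))
    (fun e => (Ty e).filter (fun c => X.Tc φ' e c ∧ c ∉ AvC e)) (by
      intro e he
      refine ⟨(filter_subset _ _).trans (hPC.tsub e), fun c hc => (mem_filter.1 hc).2.1, ?_⟩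
      have e1 : ((X.colE M (emb ∪ K) \ X.colE M emb).card : ℝ) ≤ X.Δ * N := by
        have := (card_le_card (X.newE_sub M emb K)).trans (X.card_tch K)
        have h' : X.Δ * K.card ≤ X.Δ * N := Nat.mul_le_mul_left _ hN
        exact_mod_cast this.trans h'
      have e2 := hcroom e he
      have e3 := hthick e he
      have e4 : ((Ty e).filter (fun c => X.Tc φ' e c)).card +
          (((Ty e).filter (fun c => X.Tc φ' e c ∧ c ∉ AvC e)).filter
            (fun c => c ∈ (X.colE M emb).image σ)).card ≤
          ((Ty e).filter (fun c => X.Tc φ' e c ∧ c ∉ AvC e)).card +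
          ((Ty e).filter (fun c => c ∈ AvC e ∨ c ∈ (X.colE M emb).image σ)).card := by
        set A := (Ty e).filter (fun c => X.Tc φ' e c)
        set B := (Ty e).filter (fun c => X.Tc φ' e c ∧ c ∉ AvC e)
        set D := B.filter (fun c => c ∈ (X.colE M emb).image σ)
        set R := (Ty e).filter (fun c => c ∈ AvC e ∨ c ∈ (X.colE M emb).image σ)
        have s1 : A ⊆ B ∪ (R \ D) := by
          intro c hc
          simp only [A, B, D, R, mem_filter, mem_union, mem_sdiff] at hc ⊢
          tauto
        have s2 : D ⊆ R := by
          intro c hc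
          simp only [B, D, R, mem_filter] at hc ⊢
          tauto
        have s3 := (card_le_card s1).trans (card_union_le _ _)
        have s4 := card_sdiff_add_card_eq_card s2
        omega
      have e4' : (((Ty e).filter (fun c => X.Tc φ' e c)).card : ℝ) +
          (((Ty e).filter (fun c => X.Tc φ' e c ∧ c ∉ AvC e)).filter
            (fun c => c ∈ (X.colE M emb).image σ)).card ≤
          ((Ty e).filter (fun c => X.Tc φ' e c ∧ c ∉ AvC e)).card +
          ((Ty e).filter (fun c => c ∈ AvC e ∨ c ∈ (X.colE M emb).image σ)).card := by
        exact_mod_cast e4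
      linarith)
  refine ⟨φ', σ', hag, ?_, hV', h2, hI', fun z hz => ⟨(hmem z hz).1, (hmem z hz).2.1⟩, hth, ?_⟩
  · intro e he
    exact h1 e (by simp [he])
  · intro e he
    have := mem_filter.1 (h3 e he).1
    exact ⟨this.1, this.2.2⟩

end Ctx
end BU

namespace BU
namespace Ctx

variable {V W : Type} [Fintype W] (X : Ctx V W)

theorem PC.mono {Pool : W → Finset V} {Ty : Sym2 W → Finset V} {emb emb' : Finset W}
    (h : X.PC Pool Ty emb) (hs : emb ⊆ emb') : X.PC Pool Ty emb' :=
  ⟨fun y hy => h.sub y (fun h' => hy (hs h')), fun y hy => h.big y (fun h' => hy (hs h')), h.tsub, h.tbig⟩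

theorem colE_free (M : Finset (Sym2 W)) (emb K : Finset W)
    (h : ∀ x ∈ K, ∀ y ∈ emb ∪ K, ¬ X.H.Adj x y) : X.colE M (emb ∪ K) = X.colE M emb := by
  apply Subset.antisymm _ (X.colE_mono M subset_union_left)
  intro e he
  by_contra hn
  have h1 := X.newE_sub M emb K (mem_sdiff.2 ⟨he, hn⟩)
  rw [mem_tch] at h1
  obtain ⟨he1, x, hx, hxK⟩ := h1
  obtain ⟨y, rfl⟩ := hx
  exact h x hxK y ((X.mem_colE.1 he).2.2 y (by simp)) he1

/-- Covering given host vertices. -/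
theorem cover_vertex {Pool : W → Finset V} {Ty : Sym2 W → Finset V} {emb : Finset W} {φ : W → V}
    (hV : X.VS emb φ) (hI : X.Inv Pool Ty emb φ) (b : Bool) (I : Finset W)
    (hI1 : ∀ x ∈ I, X.side x = b ∧ x ∉ emb)
    (hI2 : ∀ x ∈ I, ∀ y, X.H.Adj x y → ∀ z, X.H.Adj y z → z ∉ emb ∧ (z ∈ I → z = x))
    (Z : Finset V) : Z ⊆ X.P b → Disjoint Z (emb.image φ) → Z.card ≤ I.card →
    (∀ u ∈ Z, ∀ x ∈ I, ∀ y, X.H.Adj x y → X.θ * ((Pool y).card : ℝ) ≤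
      ((Pool y).filter (fun v => X.thick (Ty s(y, x)) v u)).card) →
    ∃ (φ' : W → V) (I' : Finset W), I' ⊆ I ∧ I'.card = Z.card ∧ (∀ z, z ∉ I' → φ' z = φ z) ∧
      X.VS (emb ∪ I') φ' ∧ X.Inv Pool Ty (emb ∪ I') φ' ∧ I'.image φ' = Z := by
  induction Z using Finset.induction_on with
  | empty =>
    intro _ _ _ _
    exact ⟨φ, ∅, by simp, by simp, by simp, by simpa using hV, by simpa using hI, by simp⟩
  | insert u Z huZ ih =>
    intro hZP hZd hcard hty
    rw [card_insert_of_notMem huZ] at hcard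
    rw [disjoint_insert_left] at hZd
    obtain ⟨φ', I', hI'I, hI'c, hag, hV', hInv', him⟩ := ih ((subset_insert _ _).trans hZP) hZd.2 (by omega)
      (fun u hu => hty u (mem_insert_of_mem hu))
    obtain ⟨x, hxI, hxI'⟩ : ∃ x ∈ I, x ∉ I' := by
      by_contra hcon
      push Not at hcon
      have := card_le_card hcon
      omega
    have hxn : x ∉ emb ∪ I' := by simp [(hI1 x hxI).2, hxI']
    have hagE : emb.image φ' = emb.image φ := by
      apply image_congr
      intro y hy
      exact hag y (fun h => (hI1 y (hI'I h)).2 hy)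
    have hu : u ∉ (emb ∪ I').image φ' := by
      rw [image_union, hagE, him, mem_union, not_or]
      exact ⟨hZd.1, huZ⟩
    have hnoaty : u ∉ X.aty Pool Ty (emb ∪ I') φ' x := by
      simp only [aty, mem_filter, not_and, not_exists, not_lt]
      intro _ y hy hxy
      rw [X.cand_free]
      · exact hty u (mem_insert_self _ _) x hxI y hxy
      · intro z hz hyz
        have := hI2 x hxI y hxy z hyz
        rcases mem_union.1 hz with h | h
        · exact this.1 h
        · have h3 := this.2 (hI'I h)
          subst h3
          exact hxI' h
    obtain ⟨hV2, hI2'⟩ := X.place hV' hInv' hxn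
      (by rw [(hI1 x hxI).1]; exact hZP (mem_insert_self _ _)) hu hnoaty
    refine ⟨Function.update φ' x u, insert x I', ?_, ?_, ?_, ?_, ?_, ?_⟩
    · exact insert_subset hxI hI'I
    · rw [card_insert_of_notMem hxI', card_insert_of_notMem huZ, hI'c]
    · intro y hy
      simp only [mem_insert, not_or] at hy
      rw [Function.update_of_ne hy.1, hag y hy.2]
    · rw [union_insert]; exact hV2
    · rw [union_insert]; exact hI2'
    · rw [image_insert, Function.update_self, ← him]
      congr 1
      apply image_congr
      intro y hy
      apply Function.update_of_ne
      rintro rfl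
      exact hxI' hy

/-- Covering one colour. -/
theorem cover_one {Pool : W → Finset V} {Ty : Sym2 W → Finset V} {emb : Finset W} {φ : W → V}
    {σ : Sym2 W → V} (M : Finset (Sym2 W)) (hV : X.VS emb φ) (hI : X.Inv Pool Ty emb φ)
    (hPC : X.PC Pool Ty emb) (hC : X.CS (X.colE M emb) φ σ) (x y : W) (hxy : X.H.Adj x y)
    (hs : X.side x = true) (hx : x ∉ emb) (hy : y ∉ emb) (hnx : ∀ z ∈ emb, ¬ X.H.Adj x z)
    (hny : ∀ z ∈ emb, ¬ X.H.Adj y z) (hM : s(x, y) ∉ M) (c : V) (hc : c ∈ X.C)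
    (hcn : c ∉ (X.colE M emb).image σ) (U : Bool → Finset V) (hU : ∀ b, U b ⊆ X.P b)
    (Av : Finset V) (Bd : ℝ)
    (hBd : ∀ b, (((U b).filter (fun w => w ∈ Av ∨ w ∈ emb.image φ)).card : ℝ) + 1 +
      X.Δ * X.ε * (X.P b).card ≤ Bd)
    (hcount : Bd * (U true).card + Bd * (U false).card <
      (((U true) ×ˢ (U false)).filter (fun p => X.T p.1 p.2 c)).card) :
    ∃ (φ' : W → V) (σ' : Sym2 W → V), (∀ z, z ∉ ({x, y} : Finset W) → φ' z = φ z) ∧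
      (∀ e ∈ X.colE M emb, σ' e = σ e) ∧ X.VS (emb ∪ {x, y}) φ' ∧
      X.CS (X.colE M (emb ∪ {x, y})) φ' σ' ∧ X.Inv Pool Ty (emb ∪ {x, y}) φ' ∧
      (∀ z ∈ ({x, y} : Finset W), φ' z ∈ U (X.side z) ∧ φ' z ∉ Av) ∧
      X.colE M (emb ∪ {x, y}) = insert s(x, y) (X.colE M emb) ∧ σ' s(x, y) = c := by
  have hsy : X.side y = false := by rw [X.hside _ _ hxy, hs]; rfl
  have hBd0 : 0 ≤ Bd := by
    refine le_trans ?_ (hBd true)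
    have := X.hε
    positivity
  -- choose u
  have h1 : ∃ u ∈ U true, u ∉ ((U true).filter (fun w => w ∈ Av ∨ w ∈ emb.image φ)) ∪
      X.aty Pool Ty emb φ x ∧ Bd < (((U false).filter (fun v => X.T u v c)).card : ℝ) := by
    by_contra hcon
    push Not at hcon
    set B := ((U true).filter (fun w => w ∈ Av ∨ w ∈ emb.image φ)) ∪ X.aty Pool Ty emb φ x with hB
    have hBc : (B.card : ℝ) ≤ Bd := by
      have e1 : (B.card : ℝ) ≤ (((U true).filter (fun w => w ∈ Av ∨ w ∈ emb.image φ)).card : ℝ) +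
        (X.aty Pool Ty emb φ x).card := by exact_mod_cast card_union_le _ _
      have e2 := X.card_aty hI hPC x
      rw [hs] at e2
      have := hBd true
      linarith
    have hsum : (((U true) ×ˢ (U false)).filter (fun p => X.T p.1 p.2 c)).card =
        ∑ u ∈ U true, ((U false).filter (fun v => X.T u v c)).card := by
      simp only [card_filter]
      rw [sum_product]
    have : (((((U true) ×ˢ (U false)).filter (fun p => X.T p.1 p.2 c)).card : ℕ) : ℝ) ≤
        ∑ u ∈ U true, (Bd + if u ∈ B then ((U false).card : ℝ) else 0) := by
      rw [hsum, Nat.cast_sum]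
      apply sum_le_sum
      intro u hu
      by_cases huB : u ∈ B
      · rw [if_pos huB]
        have : (((U false).filter (fun v => X.T u v c)).card : ℝ) ≤ (U false).card := by
          exact_mod_cast card_filter_le _ _
        linarith
      · rw [if_neg huB]
        have := hcon u hu huB
        linarith
    rw [sum_add_distrib, sum_const, ← sum_filter, sum_const, nsmul_eq_mul, nsmul_eq_mul] at this
    have h3 : (((U true).filter (fun u => u ∈ B)).card : ℝ) ≤ Bd := by
      refine le_trans ?_ hBc
      exact_mod_cast card_le_card (fun u hu => (mem_filter.1 hu).2)
    have h4 : (((U true).filter (fun u => u ∈ B)).card : ℝ) * (U false).card ≤ Bd * (U false).card :=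
      mul_le_mul_of_nonneg_right h3 (Nat.cast_nonneg _)
    linarith
  obtain ⟨u, huU, huB, hud⟩ := h1
  rw [mem_union, not_or] at huB
  have huav : ¬ (u ∈ Av ∨ u ∈ emb.image φ) := fun h => huB.1 (mem_filter.2 ⟨huU, h⟩)
  rw [not_or] at huav
  obtain ⟨hV1, hI1⟩ := X.place hV hI hx (by rw [hs]; exact hU _ huU) huav.2 huB.2
  set φ1 := Function.update φ x u with hφ1
  have hPC1 : X.PC Pool Ty (insert x emb) := PC.mono X hPC (subset_insert _ _)
  have hyn : y ∉ insert x emb := by simp [hy, hxy.ne']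
  have hag1 : ∀ z ∈ emb, φ1 z = φ z := fun z hz => Function.update_of_ne (by rintro rfl; exact hx hz) _ _
  have hag1i : emb.image φ1 = emb.image φ := image_congr (fun z hz => hag1 z hz)
  have h2 : ∃ v ∈ (U false).filter (fun v => X.T u v c),
      v ∉ ((U false).filter (fun w => w ∈ Av ∨ w ∈ emb.image φ)) ∪ {u} ∪
      X.aty Pool Ty (insert x emb) φ1 y := by
    by_contra hcon
    push Not at hcon
    have e0 := card_le_card hcon
    have e1 : (((U false).filter (fun v => X.T u v c)).card : ℝ) ≤
      (((U false).filter (fun w => w ∈ Av ∨ w ∈ emb.image φ)).card : ℝ) + 1 +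
        (X.aty Pool Ty (insert x emb) φ1 y).card := by
      have := e0.trans ((card_union_le _ _).trans (Nat.add_le_add_right (card_union_le _ _) _))
      rw [card_singleton] at this
      exact_mod_cast this
    have e2 := X.card_aty hI1 hPC1 y
    rw [hsy] at e2
    have := hBd false
    linarith
  obtain ⟨v, hv, hvB⟩ := h2
  rw [mem_filter] at hv
  simp only [mem_union, not_or, mem_singleton] at hvB
  have hvav : ¬ (v ∈ Av ∨ v ∈ emb.image φ) := fun h => hvB.1.1 (mem_filter.2 ⟨hv.1, h⟩)
  rw [not_or] at hvav
  obtain ⟨hV2, hI2⟩ := X.place hV1 hI1 hyn (by rw [hsy]; exact hU _ hv.1)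
    (by rw [image_insert, hag1i, mem_insert, not_or, hφ1, Function.update_self]; exact ⟨hvB.1.2, hvav.2⟩)
    hvB.2
  set φ2 := Function.update φ1 y v with hφ2
  have hphiy : φ2 y = v := Function.update_self _ _ _
  have hphix : φ2 x = u := by
    rw [hφ2, Function.update_of_ne hxy.ne, hφ1, Function.update_self]
  have hemb : emb ∪ {x, y} = insert y (insert x emb) := by
    ext z; simp only [mem_union, mem_insert, mem_singleton]; tauto
  have hag2 : ∀ z, z ∉ ({x, y} : Finset W) → φ2 z = φ z := by
    intro z hz
    simp only [mem_insert, mem_singleton, not_or] at hz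
    rw [hφ2, Function.update_of_ne hz.2, hφ1, Function.update_of_ne hz.1]
  have hen : s(x, y) ∉ X.colE M emb := by
    rw [mem_colE]
    rintro ⟨-, -, h⟩
    exact hx (h x (by simp))
  have hcolE : X.colE M (emb ∪ {x, y}) = insert s(x, y) (X.colE M emb) := by
    ext e
    constructor
    · intro he
      by_cases hn : e ∈ X.colE M emb
      · exact mem_insert_of_mem hn
      · have ht := X.newE_sub M emb {x, y} (mem_sdiff.2 ⟨he, hn⟩)
        rw [mem_tch] at ht
        obtain ⟨he1, z, hz, hzK⟩ := ht
        obtain ⟨w, rfl⟩ := hz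
        have hw := (X.mem_colE.1 he).2.2 w (by simp)
        have hzw : X.H.Adj z w := he1
        simp only [mem_union, mem_insert, mem_singleton] at hzK hw
        rcases hzK with rfl | rfl
        · rcases hw with hw | rfl | rfl
          · exact absurd hzw (hnx w hw)
          · exact absurd rfl hzw.ne
          · exact mem_insert_self _ _
        · rcases hw with hw | rfl | rfl
          · exact absurd hzw (hny w hw)
          · rw [Sym2.eq_swap]; exact mem_insert_self _ _
          · exact absurd rfl hzw.ne
    · intro he
      rcases mem_insert.1 he with rfl | he
      · rw [mem_colE]
        refine ⟨hxy, hM, ?_⟩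
        intro z hz
        rw [Sym2.mem_iff] at hz
        rcases hz with rfl | rfl <;> simp
      · exact X.colE_mono M subset_union_left he
  refine ⟨φ2, Function.update σ s(x, y) c, hag2, ?_, by rw [hemb]; exact hV2, ?_, by rw [hemb]; exact hI2,
    ?_, hcolE, Function.update_self _ _ _⟩
  · intro e he
    apply Function.update_of_ne
    rintro rfl
    exact hen he
  · rw [hcolE]
    have hup : ∀ e ∈ X.colE M emb, Function.update σ s(x, y) c e = σ e := by
      intro e he
      apply Function.update_of_ne
      rintro rfl
      exact hen he
    refine ⟨?_, ?_, ?_⟩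
    · rw [coe_insert, Set.injOn_insert (by simpa using hen)]
      constructor
      · intro a ha b' hb' hab
        rw [hup a ha, hup b' hb'] at hab
        exact hC.inj ha hb' hab
      · rintro ⟨e, he, hec⟩
        rw [Function.update_self, hup e he] at hec
        exact hcn (mem_image.2 ⟨e, he, hec⟩)
    · intro e he
      rcases mem_insert.1 he with rfl | he
      · rwa [Function.update_self]
      · rw [hup e he]; exact hC.mem e he
    · intro e he
      rcases mem_insert.1 he with rfl | he
      · rw [Function.update_self, Tc_mk, hphix, hphiy]; exact hv.2
      · rw [hup e he]
        refine (X.Tc_congr ?_ _).2 (hC.col e he)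
        intro z hz
        apply hag2
        have := (X.mem_colE.1 he).2.2 z hz
        simp only [mem_insert, mem_singleton, not_or]
        exact ⟨fun h => hx (h ▸ this), fun h => hy (h ▸ this)⟩
  · intro z hz
    simp only [mem_insert, mem_singleton] at hz
    rcases hz with rfl | rfl
    · rw [hphix, hs]; exact ⟨huU, huav.1⟩
    · rw [hphiy, hsy]; exact ⟨hv.1, hvav.1⟩

set_option maxHeartbeats 1000000 in
/-- Covering given colours. -/
theorem cover_colour {Pool : W → Finset V} {Ty : Sym2 W → Finset V} {emb : Finset W} {φ : W → V}
    {σ : Sym2 W → V} (M : Finset (Sym2 W)) (hV : X.VS emb φ) (hI : X.Inv Pool Ty emb φ)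
    (hPC : X.PC Pool Ty emb) (hC : X.CS (X.colE M emb) φ σ) (I : Finset W) (mate : W → W)
    (hm : ∀ x ∈ I, X.H.Adj x (mate x) ∧ X.side x = true ∧ s(x, mate x) ∉ M ∧ x ∉ emb ∧ mate x ∉ emb ∧
      (∀ z ∈ emb, ¬ X.H.Adj x z) ∧ (∀ z ∈ emb, ¬ X.H.Adj (mate x) z))
    (hfar : ∀ x ∈ I, ∀ x' ∈ I, x ≠ x' → ∀ z ∈ ({x, mate x} : Finset W), ∀ z' ∈ ({x', mate x'} : Finset W),
      z ≠ z' ∧ ¬ X.H.Adj z z')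
    (U : Bool → Finset V) (hU : ∀ b, U b ⊆ X.P b)
    (Av : Finset V) (Bd : ℝ) (N : ℕ)
    (hBd : ∀ b, (((U b).filter (fun w => w ∈ Av ∨ w ∈ emb.image φ)).card : ℝ) + 2 * N + 1 +
      X.Δ * X.ε * (X.P b).card ≤ Bd)
    (Z : Finset V) : Z ⊆ X.C → Disjoint Z ((X.colE M emb).image σ) → Z.card ≤ I.card → Z.card ≤ N →
    (∀ c ∈ Z, Bd * (U true).card + Bd * (U false).card <
      (((U true) ×ˢ (U false)).filter (fun p => X.T p.1 p.2 c)).card) →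
    ∃ (φ' : W → V) (σ' : Sym2 W → V) (I' : Finset W), I' ⊆ I ∧ I'.card = Z.card ∧
      (∀ z, z ∉ I' ∪ I'.image mate → φ' z = φ z) ∧
      (∀ e ∈ X.colE M emb, σ' e = σ e) ∧ X.VS (emb ∪ (I' ∪ I'.image mate)) φ' ∧
      X.CS (X.colE M (emb ∪ (I' ∪ I'.image mate))) φ' σ' ∧ X.Inv Pool Ty (emb ∪ (I' ∪ I'.image mate)) φ' ∧
      (∀ z ∈ I' ∪ I'.image mate, φ' z ∈ U (X.side z) ∧ φ' z ∉ Av) ∧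
      (X.colE M (emb ∪ (I' ∪ I'.image mate))).image σ' = (X.colE M emb).image σ ∪ Z := by
  induction Z using Finset.induction_on with
  | empty =>
    intro _ _ _ _ _
    exact ⟨φ, σ, ∅, by simp, by simp, by simp, by simp, by simpa using hV, by simpa using hC,
      by simpa using hI, by simp, by simp⟩
  | insert c Z hcZ ih =>
    intro hZC hZd hcard hN hcnt
    rw [card_insert_of_notMem hcZ] at hcard hN
    rw [disjoint_insert_left] at hZd
    obtain ⟨φ', σ', I', hI'I, hI'c, hag, hcag, hV', hC', hInv', hUK, him⟩ :=
      ih ((subset_insert _ _).trans hZC) hZd.2 (by omega) (by omega)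
      (fun u hu => hcnt u (mem_insert_of_mem hu))
    obtain ⟨x, hxI, hxI'⟩ : ∃ x ∈ I, x ∉ I' := by
      by_contra hcon
      push Not at hcon
      have := card_le_card hcon
      omega
    set K := I' ∪ I'.image mate with hK
    obtain ⟨hadj, hsx, hxM, hxe, hye, hnx, hny⟩ := hm x hxI
    have hKx : ∀ z' ∈ K, ∀ z ∈ ({x, mate x} : Finset W), z ≠ z' ∧ ¬ X.H.Adj z z' := by
      intro z' hz' z hz
      simp only [hK, mem_union, mem_image] at hz'
      rcases hz' with h | ⟨x', h, rfl⟩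
      · exact hfar x hxI z' (hI'I h) (by rintro rfl; exact hxI' h) z hz z' (by simp)
      · exact hfar x hxI x' (hI'I h) (by rintro rfl; exact hxI' h) z hz _ (by simp)
    have hKemb : ∀ z ∈ K, z ∉ emb := by
      intro z hz
      simp only [hK, mem_union, mem_image] at hz
      rcases hz with h | ⟨x', h, rfl⟩
      · exact (hm z (hI'I h)).2.2.2.1
      · exact (hm x' (hI'I h)).2.2.2.2.1
    have hagE : emb.image φ' = emb.image φ := by
      apply image_congr
      intro y hy
      exact hag y (fun h => hKemb y h hy)
    have hKc : K.card ≤ 2 * Z.card := by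
      have := card_union_le I' (I'.image mate)
      have h2 := card_image_le (s := I') (f := mate)
      rw [← hK] at this
      omega
    obtain ⟨φ2, σ2, hag2, hcag2, hV2, hC2, hI2, hUK2, hcolE, hσ2⟩ :=
      X.cover_one M hV' hInv' (PC.mono X hPC subset_union_left) hC' x (mate x) hadj hsx
      (by rw [mem_union, not_or]; exact ⟨hxe, fun h => (hKx x h x (by simp)).1 rfl⟩)
      (by rw [mem_union, not_or]; exact ⟨hye, fun h => (hKx _ h (mate x) (by simp)).1 rfl⟩)
      (by
        intro z hz
        rcases mem_union.1 hz with h | h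
        · exact hnx z h
        · exact (hKx z h x (by simp)).2)
      (by
        intro z hz
        rcases mem_union.1 hz with h | h
        · exact hny z h
        · exact (hKx z h _ (by simp)).2)
      hxM c (hZC (mem_insert_self _ _))
      (by rw [him, mem_union, not_or]; exact ⟨hZd.1, hcZ⟩) U hU Av Bd
      (by
        intro b
        have e1 : ((U b).filter (fun w => w ∈ Av ∨ w ∈ (emb ∪ K).image φ')).card ≤
          ((U b).filter (fun w => w ∈ Av ∨ w ∈ emb.image φ)).card + 2 * N := by
          have : (U b).filter (fun w => w ∈ Av ∨ w ∈ (emb ∪ K).image φ') ⊆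
            ((U b).filter (fun w => w ∈ Av ∨ w ∈ emb.image φ)) ∪ K.image φ' := by
            intro w hw
            rw [image_union, hagE] at hw
            simp only [mem_filter, mem_union] at hw ⊢
            tauto
          have e2 := (card_le_card this).trans (card_union_le _ _)
          have e3 := card_image_le (s := K) (f := φ')
          omega
        have e1' : (((U b).filter (fun w => w ∈ Av ∨ w ∈ (emb ∪ K).image φ')).card : ℝ) ≤
          ((U b).filter (fun w => w ∈ Av ∨ w ∈ emb.image φ)).card + 2 * N := by exact_mod_cast e1
        have := hBd b
        linarith)
      (hcnt c (mem_insert_self _ _))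
    have hKeq : emb ∪ (insert x I' ∪ (insert x I').image mate) = (emb ∪ K) ∪ {x, mate x} := by
      ext z
      simp only [hK, image_insert, mem_union, mem_insert, mem_singleton]
      tauto
    have hK2 : insert x I' ∪ (insert x I').image mate = K ∪ {x, mate x} := by
      ext z
      simp only [hK, image_insert, mem_union, mem_insert, mem_singleton]
      tauto
    refine ⟨φ2, σ2, insert x I', insert_subset hxI hI'I, ?_, ?_, ?_, ?_, ?_, ?_, ?_, ?_⟩
    · rw [card_insert_of_notMem hxI', card_insert_of_notMem hcZ, hI'c]
    · intro z hz
      rw [hK2, mem_union, not_or] at hz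
      rw [hag2 z hz.2, hag z hz.1]
    · intro e he
      rw [hcag2 e (X.colE_mono M subset_union_left he), hcag e he]
    · rw [hKeq]; exact hV2
    · rw [hKeq]; exact hC2
    · rw [hKeq]; exact hI2
    · intro z hz
      by_cases hz2 : z ∈ ({x, mate x} : Finset W)
      · exact hUK2 z hz2
      · rw [hK2, mem_union] at hz
        rw [hag2 z hz2]
        exact hUK z (hz.resolve_right hz2)
    · rw [hKeq, hcolE, image_insert, hσ2, image_congr (g := σ') (fun e he => hcag2 e he), him]
      ext w
      simp only [mem_insert, mem_union]
      tauto

end Ctx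
end BU

namespace BU

theorem exists_sum_le {ι κ : Type*} (S : Finset ι) (Q : Finset κ) (hS : S.Nonempty) (f : κ → ι → ℝ)
    (t : κ → ℝ) (u : κ → ℝ) (hu : ∀ p ∈ Q, 0 ≤ u p) (h : ∀ p ∈ Q, ∑ v ∈ S, f p v ≤ S.card * t p) :
    ∃ v ∈ S, ∑ p ∈ Q, u p * f p v ≤ ∑ p ∈ Q, u p * t p := by
  apply exists_le_of_sum_le hS
  rw [sum_comm, sum_const, nsmul_eq_mul, mul_sum]
  apply sum_le_sum
  intro p hp
  rw [← mul_sum]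
  have := mul_le_mul_of_nonneg_left (h p hp) (hu p hp)
  linarith

/-- Derandomised injective choice. -/
theorem derand {ι V κ : Type*} [Nonempty V] (Q : Finset κ) (S : ι → Finset V) (Gd : κ → ι → Prop)
    (Tg : κ → V → Prop) (β r : ℝ) (hβ : 0 ≤ β) (N : ℕ) (A₀ : Finset ι) : A₀.card ≤ N →
    (∀ a ∈ A₀, N < (S a).card ∧ ((S a).card : ℝ) ≤ r) →
    (∀ p ∈ Q, ∀ a ∈ A₀, Gd p a → β * r + N ≤ ((S a).filter (fun v => Tg p v)).card) →
    ∀ (w : κ → ℝ), (∀ p ∈ Q, 0 ≤ w p) → β ≤ 1 →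
    ∃ σ : ι → V, Set.InjOn σ A₀ ∧ (∀ a ∈ A₀, σ a ∈ S a) ∧
      ∑ p ∈ Q, w p * (1 / 2 : ℝ) ^ (A₀.filter (fun a => Gd p a ∧ Tg p (σ a))).card ≤
      ∑ p ∈ Q, w p * (1 - β / 2) ^ (A₀.filter (fun a => Gd p a)).card := by
  induction A₀ using Finset.induction_on with
  | empty =>
    intro _ _ _ w _ _
    exact ⟨fun _ => Classical.arbitrary V, by simp, by simp, by simp⟩
  | insert a A haA ih =>
    intro hN hS hT w hw hβ1
    rw [card_insert_of_notMem haA] at hN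
    obtain ⟨σ, hσ, hσS, hsum⟩ := ih (by omega) (fun x hx => hS x (mem_insert_of_mem hx))
      (fun p hp x hx => hT p hp x (mem_insert_of_mem hx))
      (fun p => w p * (if Gd p a then (1 - β / 2) else 1))
      (fun p hp => mul_nonneg (hw p hp) (by split_ifs <;> linarith)) hβ1
    set S' := S a \ A.image σ with hS'
    have hu : (A.image σ).card ≤ A.card := card_image_le
    have hS'ne : S'.Nonempty := by
      rw [← card_pos]
      have h1 := le_card_sdiff (A.image σ) (S a)
      rw [← hS'] at h1
      have h2 := (hS a (mem_insert_self _ _)).1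
      omega
    have hcard : (S'.card : ℝ) ≤ r := by
      refine le_trans ?_ (hS a (mem_insert_self _ _)).2
      exact_mod_cast card_le_card sdiff_subset
    obtain ⟨v, hv, hvs⟩ := exists_sum_le S' Q hS'ne
      (fun p v => if Gd p a ∧ Tg p v then (1 / 2 : ℝ) else 1)
      (fun p => if Gd p a then (1 - β / 2) else 1)
      (fun p => w p * (1 / 2 : ℝ) ^ (A.filter (fun a => Gd p a ∧ Tg p (σ a))).card)
      (fun p hp => mul_nonneg (hw p hp) (by positivity))
      (by
        intro p hp
        by_cases hg : Gd p a
        · simp only [hg, true_and, if_true]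
          have h1 : ∑ v ∈ S', (if Tg p v then (1 / 2 : ℝ) else 1) =
              S'.card - (1 / 2) * (S'.filter (fun v => Tg p v)).card := by
            have : ∀ v ∈ S', (if Tg p v then (1 / 2 : ℝ) else 1) =
              1 - (1 / 2) * (if Tg p v then (1 : ℝ) else 0) := by
              intro v _; split_ifs <;> norm_num
            rw [sum_congr rfl this, sum_sub_distrib, ← mul_sum]
            simp
          have h2 : ((S a).filter (fun v => Tg p v)).card ≤ (S'.filter (fun v => Tg p v)).card + A.card := by
            have : (S a).filter (fun v => Tg p v) ⊆ S'.filter (fun v => Tg p v) ∪ A.image σ := by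
              intro v hv
              simp only [hS', mem_filter, mem_union, mem_sdiff] at hv ⊢
              tauto
            have := (card_le_card this).trans (card_union_le _ _)
            omega
          have h2' : (((S a).filter (fun v => Tg p v)).card : ℝ) ≤ (S'.filter (fun v => Tg p v)).card + N := by
            have : ((S a).filter (fun v => Tg p v)).card ≤ (S'.filter (fun v => Tg p v)).card + N := by omega
            exact_mod_cast this
          have h3 := hT p hp a (mem_insert_self _ _) hg
          have h4 : β * S'.card ≤ β * r := mul_le_mul_of_nonneg_left hcard hβ
          rw [h1]
          nlinarith
        · simp [hg])
    rw [hS', mem_sdiff] at hv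
    have hne : ∀ x ∈ A, Function.update σ a v x = σ x := fun x hx =>
      Function.update_of_ne (by rintro rfl; exact haA hx) _ _
    refine ⟨Function.update σ a v, ?_, ?_, ?_⟩
    · rw [coe_insert, Set.injOn_insert (by simpa using haA)]
      refine ⟨?_, ?_⟩
      · intro x hx y hy hxy
        rw [hne x hx, hne y hy] at hxy
        exact hσ hx hy hxy
      · rintro ⟨y, hy, hyw⟩
        rw [hne y hy, Function.update_self] at hyw
        exact hv.2 (mem_image.2 ⟨y, hy, hyw⟩)
    · intro x hx
      rcases mem_insert.1 hx with rfl | hx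
      · rw [Function.update_self]; exact hv.1
      · rw [hne x hx]; exact hσS x hx
    · have e1 : ∀ p ∈ Q, w p * (1 / 2 : ℝ) ^ ((insert a A).filter
          (fun x => Gd p x ∧ Tg p (Function.update σ a v x))).card =
          (w p * (1 / 2 : ℝ) ^ (A.filter (fun a => Gd p a ∧ Tg p (σ a))).card) *
            (if Gd p a ∧ Tg p v then (1 / 2 : ℝ) else 1) := by
        intro p _
        have hf : A.filter (fun x => Gd p x ∧ Tg p (Function.update σ a v x)) =
            A.filter (fun x => Gd p x ∧ Tg p (σ x)) := by
          apply filter_congr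
          intro x hx
          rw [hne x hx]
        rw [filter_insert, Function.update_self, hf]
        split_ifs with hc
        · rw [card_insert_of_notMem (by simp [haA]), pow_succ]; ring
        · ring
      have e2 : ∀ p ∈ Q, w p * (1 - β / 2) ^ ((insert a A).filter (fun x => Gd p x)).card =
          (w p * (if Gd p a then (1 - β / 2) else 1)) * (1 - β / 2) ^ (A.filter (fun x => Gd p x)).card := by
        intro p _
        rw [filter_insert]
        split_ifs with hc
        · rw [card_insert_of_notMem (by simp [haA]), pow_succ]; ring
        · ring
      rw [sum_congr rfl e1, sum_congr rfl e2]
      refine hvs.trans (le_trans (le_of_eq ?_) hsum)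
      apply sum_congr rfl
      intro p _
      ring

theorem dc {ι V : Type*} (A : Finset ι) (B : Finset V) (K : ι → V → Prop) :
    ∑ a ∈ A, ((B.filter (fun b => K a b)).card : ℝ) = ∑ b ∈ B, ((A.filter (fun a => K a b)).card : ℝ) := by
  have := sum_card_bipartiteAbove_eq_sum_card_bipartiteBelow (s := A) (t := B) K
  unfold bipartiteAbove bipartiteBelow at this
  exact_mod_cast this

theorem bsg_aux (α η p r : ℝ) (h : 0 < η) :
    α ^ 2 / (2 * η) * (p ^ 2 * (η * r)) = α ^ 2 / 2 * p ^ 2 * r := by field_simp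

theorem bsg_aux2 (α : ℝ) (h : 0 < α) : α ^ 2 / (2 * (α ^ 3 / 16)) = 8 / α := by field_simp; norm_num

set_option maxHeartbeats 1000000 in
/-- Balog–Szemerédi–Gowers style lemma. -/
theorem bsg {ι V : Type*} (A : Finset ι) (B : Finset V) (K : ι → V → Prop) (α : ℝ) (hα : 0 < α)
    (hA : A.Nonempty) (hB : B.Nonempty)
    (hdeg : ∀ a ∈ A, α * (B.card : ℝ) ≤ (B.filter (fun b => K a b)).card) :
    ∃ A₁ ⊆ A, ∃ B₁ ⊆ B, α / 4 * A.card ≤ A₁.card ∧ α / 2 * B.card ≤ B₁.card ∧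
      ∀ a₁ ∈ A₁, ∀ b₁ ∈ B₁, α ^ 2 / 8 * A.card ≤ ((A.filter (fun a => K a b₁ ∧
        α ^ 3 / 16 * B.card ≤ (B.filter (fun b => K a b ∧ K a₁ b)).card)).card : ℝ) := by
  obtain ⟨η, hη⟩ : ∃ η : ℝ, η = α ^ 3 / 16 := ⟨_, rfl⟩
  rw [← hη]
  have hη0 : 0 < η := by rw [hη]; positivity
  have hp : (0 : ℝ) < A.card := by exact_mod_cast hA.card_pos
  have hr : (0 : ℝ) < B.card := by exact_mod_cast hB.card_pos
  obtain ⟨bad, hbadd⟩ : ∃ bad : ι → ι → Prop, ∀ a a', bad a a' ↔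
    ((B.filter (fun b => K a b ∧ K a' b)).card : ℝ) < η * B.card := ⟨_, fun _ _ => Iff.rfl⟩
  let co : V → Finset ι := fun b => A.filter (fun a => K a b)
  have hco1 : α * A.card * B.card ≤ ∑ b ∈ B, ((co b).card : ℝ) := by
    rw [← dc A B K]
    calc α * A.card * B.card = ∑ a ∈ A, α * B.card := by simp; ring
      _ ≤ _ := sum_le_sum hdeg
  have hco2 : α ^ 2 * (A.card : ℝ) ^ 2 * B.card ≤ ∑ b ∈ B, ((co b).card : ℝ) ^ 2 := by
    have h := sq_sum_le_card_mul_sum_sq (s := B) (f := fun b => ((co b).card : ℝ))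
    have h2 : (α * A.card * B.card) ^ 2 ≤ (∑ b ∈ B, ((co b).card : ℝ)) ^ 2 :=
      pow_le_pow_left₀ (by positivity) hco1 2
    have h3 : (B.card : ℝ) * (α ^ 2 * (A.card : ℝ) ^ 2 * B.card) ≤
        B.card * ∑ b ∈ B, ((co b).card : ℝ) ^ 2 := by nlinarith
    exact le_of_mul_le_mul_left h3 hr
  let bc : V → ℝ := fun b => ∑ a ∈ co b, (((co b).filter (fun a' => bad a a')).card : ℝ)
  have hbc : ∑ b ∈ B, bc b ≤ (A.card : ℝ) ^ 2 * (η * B.card) := by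
    have e1 : ∀ b ∈ B, bc b = ∑ a ∈ A, ∑ a' ∈ A, if (K a b ∧ K a' b ∧ bad a a') then (1 : ℝ) else 0 := by
      intro b _
      simp only [bc, co]
      rw [sum_filter]
      apply sum_congr rfl
      intro a _
      split_ifs with h
      · rw [filter_filter, card_filter, Nat.cast_sum]
        apply sum_congr rfl
        intro a' _
        simp [h]
      · simp [h]
    rw [sum_congr rfl e1, sum_comm]
    have e2 : ∀ a ∈ A, ∑ b ∈ B, ∑ a' ∈ A, (if (K a b ∧ K a' b ∧ bad a a') then (1 : ℝ) else 0) ≤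
        A.card * (η * B.card) := by
      intro a _
      rw [sum_comm]
      calc _ ≤ ∑ a' ∈ A, η * B.card := by
            apply sum_le_sum
            intro a' _
            by_cases hb : bad a a'
            · have : ∑ b ∈ B, (if (K a b ∧ K a' b ∧ bad a a') then (1 : ℝ) else 0) =
                ((B.filter (fun b => K a b ∧ K a' b)).card : ℝ) := by
                rw [card_filter, Nat.cast_sum]
                apply sum_congr rfl
                intro b _
                simp [hb]
              rw [this]
              exact ((hbadd _ _).1 hb).le
            · simp only [hb, and_false, if_false, sum_const_zero]
              positivity
        _ = _ := by simp
    calc _ ≤ ∑ a ∈ A, (A.card : ℝ) * (η * B.card) := sum_le_sum e2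
      _ = _ := by simp; ring
  obtain ⟨b, hb, hbb⟩ : ∃ b ∈ B, α ^ 2 / 2 * (A.card : ℝ) ^ 2 ≤
      ((co b).card : ℝ) ^ 2 - α ^ 2 / (2 * η) * bc b := by
    apply exists_le_of_sum_le hB
    rw [sum_const, nsmul_eq_mul, sum_sub_distrib, ← mul_sum]
    have h1 : α ^ 2 / (2 * η) * ∑ b ∈ B, bc b ≤ α ^ 2 / (2 * η) * ((A.card : ℝ) ^ 2 * (η * B.card)) :=
      mul_le_mul_of_nonneg_left hbc (by positivity)
    have h2 : α ^ 2 / (2 * η) * ((A.card : ℝ) ^ 2 * (η * B.card)) =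
      α ^ 2 / 2 * (A.card : ℝ) ^ 2 * B.card := bsg_aux _ _ _ _ hη0
    nlinarith
  set A2 := co b with hA2
  have hA2A : A2 ⊆ A := filter_subset _ _
  have hbc0 : 0 ≤ bc b := by positivity
  have hA2c : α / 2 * A.card ≤ A2.card := by
    have h1 : (α / 2 * A.card) ^ 2 ≤ (A2.card : ℝ) ^ 2 := by
      have : 0 ≤ α ^ 2 / (2 * η) * bc b := by positivity
      have h2 : 0 ≤ α ^ 2 * (A.card : ℝ) ^ 2 := by positivity
      nlinarith
    exact le_of_sq_le_sq h1 (Nat.cast_nonneg _) |> fun h => h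
  have hA2p : (0 : ℝ) < A2.card := lt_of_lt_of_le (by positivity) hA2c
  have hbadb : bc b ≤ α / 8 * (A2.card : ℝ) ^ 2 := by
    have h1 : α ^ 2 / (2 * η) * bc b ≤ (A2.card : ℝ) ^ 2 := by
      have h2 : 0 ≤ α ^ 2 / 2 * (A.card : ℝ) ^ 2 := by positivity
      linarith
    have h3 : α ^ 2 / (2 * η) = 8 / α := by rw [hη]; exact bsg_aux2 α hα
    rw [h3, div_mul_eq_mul_div, div_le_iff₀ hα] at h1
    linarith
  let A1 := A2.filter (fun a => ((A2.filter (fun a' => bad a a')).card : ℝ) ≤ α / 4 * A2.card)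
  let B1 := B.filter (fun b₁ => α / 2 * (A2.card : ℝ) ≤ (A2.filter (fun a => K a b₁)).card)
  have hA1c : (A2.card : ℝ) / 2 ≤ A1.card := by
    have h1 : α / 4 * A2.card * ((A2.card : ℝ) - A1.card) ≤ bc b := by
      have h2 : (A2.filter (fun a => ¬ (((A2.filter (fun a' => bad a a')).card : ℝ) ≤ α / 4 * A2.card))).card =
          (A2.card : ℝ) - A1.card := by
        have := card_filter_add_card_filter_not (s := A2) (fun a => ((A2.filter (fun a' => bad a a')).card : ℝ) ≤ α / 4 * A2.card)
        rw [eq_sub_iff_add_eq, add_comm]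
        exact_mod_cast this
      rw [← h2]
      calc α / 4 * A2.card * _ = ∑ a ∈ A2.filter (fun a => ¬ (((A2.filter (fun a' => bad a a')).card : ℝ) ≤ α / 4 * A2.card)), α / 4 * (A2.card : ℝ) := by
            rw [sum_const, nsmul_eq_mul]; ring
        _ ≤ ∑ a ∈ A2.filter (fun a => ¬ (((A2.filter (fun a' => bad a a')).card : ℝ) ≤ α / 4 * A2.card)), ((A2.filter (fun a' => bad a a')).card : ℝ) := by
            apply sum_le_sum
            intro a ha
            have := (mem_filter.1 ha).2
            exact (not_le.1 this).le
        _ ≤ bc b := by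
            apply sum_le_sum_of_subset_of_nonneg (filter_subset _ _)
            intros; positivity
    have h5 : α / 4 * A2.card * ((A2.card : ℝ) - A1.card) ≤ α / 4 * A2.card * (A2.card / 2) := by
      nlinarith
    have := le_of_mul_le_mul_left h5 (by positivity)
    linarith
  have hB1c : α / 2 * (B.card : ℝ) ≤ B1.card := by
    have h1 : α * B.card * A2.card ≤ ∑ b₁ ∈ B, ((A2.filter (fun a => K a b₁)).card : ℝ) := by
      rw [← dc A2 B K]
      calc α * B.card * A2.card = ∑ a ∈ A2, α * (B.card : ℝ) := by simp; ring
        _ ≤ _ := sum_le_sum (fun a ha => hdeg a (hA2A ha))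
    have h2 : ∑ b₁ ∈ B, ((A2.filter (fun a => K a b₁)).card : ℝ) ≤
        ∑ b₁ ∈ B, (α / 2 * A2.card + if b₁ ∈ B1 then (A2.card : ℝ) else 0) := by
      apply sum_le_sum
      intro b₁ hb₁
      split_ifs with h
      · have : ((A2.filter (fun a => K a b₁)).card : ℝ) ≤ A2.card := by exact_mod_cast card_filter_le _ _
        have h3 : 0 ≤ α / 2 * (A2.card : ℝ) := by positivity
        linarith
      · have : ¬ (α / 2 * (A2.card : ℝ) ≤ (A2.filter (fun a => K a b₁)).card) :=
          fun h' => h (mem_filter.2 ⟨hb₁, h'⟩)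
        linarith [not_le.1 this]
    rw [sum_add_distrib, sum_const, nsmul_eq_mul, ← sum_filter, sum_const, nsmul_eq_mul] at h2
    have h3 : ((B.filter (fun b₁ => b₁ ∈ B1)).card : ℝ) ≤ B1.card := by
      exact_mod_cast card_le_card (fun x hx => (mem_filter.1 hx).2)
    have h4 := mul_le_mul_of_nonneg_right h3 hA2p.le
    have h5 : (α / 2 * (B.card : ℝ)) * A2.card ≤ B1.card * A2.card := by nlinarith
    exact le_of_mul_le_mul_right h5 hA2p
  refine ⟨A1, (filter_subset _ _).trans hA2A, B1, filter_subset _ _, by linarith, hB1c, ?_⟩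
  intro a₁ ha₁ b₁ hb₁
  have h1 := (mem_filter.1 ha₁).2
  have h2 := (mem_filter.1 hb₁).2
  have hsub : A2.filter (fun a => K a b₁) ⊆ (A.filter (fun a => K a b₁ ∧
        η * B.card ≤ (B.filter (fun b => K a b ∧ K a₁ b)).card)) ∪ A2.filter (fun a' => bad a₁ a') := by
    intro a ha
    simp only [mem_union, mem_filter] at ha ⊢
    by_cases hbad : bad a₁ a
    · right; exact ⟨ha.1, hbad⟩
    · left
      refine ⟨hA2A ha.1, ha.2, ?_⟩
      have := not_lt.1 (fun h => hbad ((hbadd _ _).2 h))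
      simp only [and_comm (a := K a _)]
      exact this
  have h3 : ((A2.filter (fun a => K a b₁)).card : ℝ) ≤ (A.filter (fun a => K a b₁ ∧
        η * B.card ≤ (B.filter (fun b => K a b ∧ K a₁ b)).card)).card + (A2.filter (fun a' => bad a₁ a')).card := by
    exact_mod_cast (card_le_card hsub).trans (card_union_le _ _)
  nlinarith

end BU

namespace BU

set_option maxHeartbeats 1000000 in
/-- The absorber. -/
theorem absorber {ι V : Type*} [Nonempty V] (A : Finset ι) (B : Finset V) (K : ι → V → Prop) (α : ℝ)
    (hα : 0 < α) (hα1 : α ≤ 1) (hA : A.Nonempty) (hB : B.Nonempty)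
    (hdeg : ∀ a ∈ A, α * (B.card : ℝ) ≤ (B.filter (fun b => K a b)).card) (l s g : ℕ)
    (hl : (l : ℝ) ≤ α ^ 2 / 16 * A.card) (hAB : (A.card : ℝ) ≤ α ^ 3 / 64 * B.card)
    (hls : ((l + s : ℕ) : ℝ) ≤ α ^ 3 / 64 * B.card) (hg : (g : ℝ) ≤ α ^ 2 / 16 * A.card)
    (hpot : (A.card : ℝ) * B.card * 2 ^ l * (1 - α ^ 3 / 64) ^ g < 1) :
    ∃ B0 B1 : Finset V, B0 ⊆ B ∧ B1 ⊆ B ∧ Disjoint B0 B1 ∧ B1.card = l + s ∧ B0.card + l = A.card ∧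
      ∀ U ⊆ B1, U.card = l → ∃ f : ι → V, Set.InjOn f A ∧ A.image f = B0 ∪ U ∧ ∀ a ∈ A, K a (f a) := by
  have hp : (0 : ℝ) < A.card := by exact_mod_cast hA.card_pos
  have hr : (0 : ℝ) < B.card := by exact_mod_cast hB.card_pos
  obtain ⟨A1, hA1, B1', hB1', hA1c, hB1c, hgood⟩ := bsg A B K α hα hA hB hdeg
  have hα2 : α ^ 2 ≤ α := by nlinarith
  have hα3 : α ^ 3 ≤ α ^ 2 := by nlinarith [sq_nonneg α]
  have hα3' : 0 < α ^ 3 := by positivity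
  have hα2' : 0 < α ^ 2 := by positivity
  obtain ⟨A1', hA1'sub, hA1'c⟩ : ∃ t ⊆ A1, t.card = l := by
    apply exists_subset_card_eq
    have : (l : ℝ) ≤ A1.card := by nlinarith
    exact_mod_cast this
  obtain ⟨B1, hB1sub, hB1card⟩ : ∃ t ⊆ B1', t.card = l + s := by
    apply exists_subset_card_eq
    have : ((l + s : ℕ) : ℝ) ≤ B1'.card := by nlinarith
    exact_mod_cast this
  have hA1'A := hA1'sub.trans hA1
  have hB1B := hB1sub.trans hB1'
  set A0 := A \ A1' with hA0
  let S : ι → Finset V := fun a => (B.filter (fun b => K a b)) \ B1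
  obtain ⟨Gd, hGd⟩ : ∃ Gd : ι × V → ι → Prop, ∀ p a, Gd p a ↔ K a p.2 ∧
    α ^ 3 / 16 * B.card ≤ ((B.filter (fun b => K a b ∧ K p.1 b)).card : ℝ) := ⟨_, fun _ _ => Iff.rfl⟩
  have hA0N : A0.card ≤ A.card := card_le_card sdiff_subset
  have hB1r : (B1.card : ℝ) ≤ α ^ 3 / 64 * B.card := by rw [hB1card]; exact hls
  obtain ⟨σ, hσ, hσS, hsum⟩ := derand (A1' ×ˢ B1) S Gd (fun p v => K p.1 v) (α ^ 3 / 32) B.card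
    (by positivity) A.card A0 hA0N
    (by
      intro a ha
      have haA : a ∈ A := (mem_sdiff.1 ha).1
      constructor
      · have h1 : (B.filter (fun b => K a b)).card ≤ (S a).card + B1.card := by
          have := le_card_sdiff B1 (B.filter (fun b => K a b))
          simp only [S]
          omega
        have h1' : ((B.filter (fun b => K a b)).card : ℝ) ≤ (S a).card + B1.card := by exact_mod_cast h1
        have h2 := hdeg a haA
        have h3 : (A.card : ℝ) < (S a).card := by nlinarith
        exact_mod_cast h3
      · exact_mod_cast card_le_card (sdiff_subset.trans (filter_subset _ _)))
    (by
      intro p hp a ha hgd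
      have h1 : (B.filter (fun b => K a b ∧ K p.1 b)).card ≤ ((S a).filter (fun v => K p.1 v)).card + B1.card := by
        have : B.filter (fun b => K a b ∧ K p.1 b) ⊆ ((S a).filter (fun v => K p.1 v)) ∪ B1 := by
          intro v hv
          simp only [S, mem_filter, mem_union, mem_sdiff] at hv ⊢
          tauto
        exact (card_le_card this).trans (card_union_le _ _)
      have h1' : ((B.filter (fun b => K a b ∧ K p.1 b)).card : ℝ) ≤
        ((S a).filter (fun v => K p.1 v)).card + B1.card := by exact_mod_cast h1
      have h2 := ((hGd _ _).1 hgd).2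
      nlinarith)
    (fun _ => 1) (by intros; norm_num) (by nlinarith)
  have hB0B1 : Disjoint (A0.image σ) B1 := by
    rw [disjoint_left]
    intro v hv
    obtain ⟨a, ha, rfl⟩ := mem_image.1 hv
    exact (mem_sdiff.1 (hσS a ha)).2
  have hσB : ∀ a ∈ A0, σ a ∈ B ∧ K a (σ a) := by
    intro a ha
    exact mem_filter.1 (mem_sdiff.1 (hσS a ha)).1
  have hc0 : (A0.image σ).card + l = A.card := by
    rw [card_image_of_injOn hσ, hA0, ← hA1'c, card_sdiff_add_card_eq_card hA1'A]
  have hhits : ∀ a₁ ∈ A1', ∀ b₁ ∈ B1, l ≤ (A0.filter (fun a => Gd (a₁, b₁) a ∧ K a₁ (σ a))).card := by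
    intro a₁ ha₁ b₁ hb₁
    by_contra hcon
    push Not at hcon
    have h1 : (1 / 2 : ℝ) ^ l ≤ ∑ p ∈ A1' ×ˢ B1, 1 * (1 / 2 : ℝ) ^ (A0.filter (fun a => Gd p a ∧ K p.1 (σ a))).card := by
      refine le_trans ?_ (single_le_sum (f := fun p => 1 * (1 / 2 : ℝ) ^ (A0.filter (fun a => Gd p a ∧ K p.1 (σ a))).card)
        (fun p _ => by positivity) (mk_mem_product ha₁ hb₁))
      simp only [one_mul]
      exact pow_le_pow_of_le_one (by norm_num) (by norm_num) hcon.le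
    have h2 : ∑ p ∈ A1' ×ˢ B1, 1 * (1 - α ^ 3 / 32 / 2) ^ (A0.filter (fun a => Gd p a)).card ≤
        ∑ p ∈ A1' ×ˢ B1, (1 - α ^ 3 / 64) ^ g := by
      apply sum_le_sum
      intro p hp'
      rw [one_mul, show α ^ 3 / 32 / 2 = α ^ 3 / 64 by ring]
      apply pow_le_pow_of_le_one (by nlinarith) (by linarith)
      have hp1 := mem_product.1 hp'
      have e1 := hgood p.1 (hA1'sub hp1.1) p.2 (hB1sub hp1.2)
      have e2 : (A.filter (fun a => Gd p a)).card ≤ (A0.filter (fun a => Gd p a)).card + l := by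
        have : A.filter (fun a => Gd p a) ⊆ A0.filter (fun a => Gd p a) ∪ A1' := by
          intro a ha
          simp only [hA0, mem_filter, mem_union, mem_sdiff] at ha ⊢
          tauto
        have := (card_le_card this).trans (card_union_le _ _)
        rwa [hA1'c] at this
      have e2' : ((A.filter (fun a => Gd p a)).card : ℝ) ≤ (A0.filter (fun a => Gd p a)).card + l := by
        exact_mod_cast e2
      have e3 : α ^ 2 / 8 * A.card ≤ ((A.filter (fun a => Gd p a)).card : ℝ) := by
        simp only [hGd]; exact e1
      have e4 : (g : ℝ) ≤ (A0.filter (fun a => Gd p a)).card := by nlinarith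
      exact_mod_cast e4
    rw [sum_const, card_product, nsmul_eq_mul] at h2
    have hpow : 0 ≤ (1 - α ^ 3 / 64) ^ g := pow_nonneg (by nlinarith) _
    have h3 : ((A1'.card * B1.card : ℕ) : ℝ) * (1 - α ^ 3 / 64) ^ g ≤ (A.card : ℝ) * B.card * (1 - α ^ 3 / 64) ^ g := by
      apply mul_le_mul_of_nonneg_right _ hpow
      exact_mod_cast Nat.mul_le_mul (card_le_card hA1'A) (card_le_card hB1B)
    have h4 : (1 / 2 : ℝ) ^ l ≤ (A.card : ℝ) * B.card * (1 - α ^ 3 / 64) ^ g :=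
      h1.trans (hsum.trans (h2.trans h3))
    have h5 : (1 / 2 : ℝ) ^ l * 2 ^ l = 1 := by rw [← mul_pow]; norm_num
    have h6 := mul_le_mul_of_nonneg_right h4 (by positivity : (0 : ℝ) ≤ 2 ^ l)
    rw [h5] at h6
    nlinarith
  refine ⟨A0.image σ, B1, ?_, hB1B, hB0B1, hB1card, hc0, ?_⟩
  · intro v hv
    obtain ⟨a, ha, rfl⟩ := mem_image.1 hv
    exact (hσB a ha).1
  intro U hU hUl
  obtain ⟨e⟩ : Nonempty (A1' ≃ U) := by
    apply Fintype.card_eq.1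
    simp [hA1'c, hUl]
  let E : ι → V := fun a => if h : a ∈ A1' then (e ⟨a, h⟩ : V) else Classical.arbitrary V
  have hE : ∀ a (h : a ∈ A1'), E a = e ⟨a, h⟩ := fun a h => dif_pos h
  have hEU : ∀ a ∈ A1', E a ∈ U := by
    intro a h; rw [hE a h]; exact (e ⟨a, h⟩).2
  have hEinj : Set.InjOn E A1' := by
    intro a ha b hb hab
    rw [hE a ha, hE b hb] at hab
    have := e.injective (Subtype.ext hab)
    simpa using this
  have hEsurj : ∀ u ∈ U, ∃ a ∈ A1', E a = u := by
    intro u hu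
    obtain ⟨a, ha⟩ := e.surjective ⟨u, hu⟩
    exact ⟨a.1, a.2, by rw [hE a.1 a.2]; simp [ha]⟩
  have : Nonempty ι := ⟨hA.choose⟩
  obtain ⟨x, hx, hxS⟩ := sdr A1' (fun a₁ => A0.filter (fun a => Gd (a₁, E a₁) a ∧ K a₁ (σ a))) (by
    intro a₁ ha₁
    rw [hA1'c]
    exact hhits a₁ ha₁ _ (hU (hEU a₁ ha₁)))
  have hx0 : ∀ a ∈ A1', x a ∈ A0 ∧ K (x a) (E a) ∧ K a (σ (x a)) := by
    intro a ha
    have := mem_filter.1 (hxS a ha)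
    exact ⟨this.1, ((hGd _ _).1 this.2.1).1, this.2.2⟩
  let f : ι → V := fun a => if a ∈ A1' then σ (x a) else
    if h : ∃ a₁ ∈ A1', x a₁ = a then E h.choose else σ a
  have hf1 : ∀ a ∈ A1', f a = σ (x a) := fun a ha => if_pos ha
  have hf2 : ∀ a ∈ A1', f (x a) = E a := by
    intro a ha
    have hn : x a ∉ A1' := (mem_sdiff.1 (hx0 a ha).1).2
    have hex : ∃ a₁ ∈ A1', x a₁ = x a := ⟨a, ha, rfl⟩
    have : f (x a) = E hex.choose := by
      simp only [f, if_neg hn]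
      rw [dif_pos hex]
    rw [this]
    congr 1
    exact hx hex.choose_spec.1 ha hex.choose_spec.2
  have hf3 : ∀ a ∈ A0, (¬ ∃ a₁ ∈ A1', x a₁ = a) → f a = σ a := by
    intro a ha hex
    have hn : a ∉ A1' := (mem_sdiff.1 ha).2
    simp only [f, if_neg hn]
    rw [dif_neg hex]
  have hsplit : ∀ a ∈ A, a ∈ A1' ∨ a ∈ A0 := by
    intro a ha
    simp only [hA0, mem_sdiff]; tauto
  have him : A.image f = A0.image σ ∪ U := by
    apply Subset.antisymm
    · intro v hv
      obtain ⟨a, ha, rfl⟩ := mem_image.1 hv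
      rw [mem_union]
      rcases hsplit a ha with h | h
      · left; rw [hf1 a h]; exact mem_image_of_mem _ (hx0 a h).1
      · by_cases hex : ∃ a₁ ∈ A1', x a₁ = a
        · obtain ⟨a₁, h1, rfl⟩ := hex
          right; rw [hf2 a₁ h1]; exact hEU a₁ h1
        · left; rw [hf3 a h hex]; exact mem_image_of_mem _ h
    · intro v hv
      rcases mem_union.1 hv with hv | hv
      · obtain ⟨a, ha, rfl⟩ := mem_image.1 hv
        by_cases hex : ∃ a₁ ∈ A1', x a₁ = a
        · obtain ⟨a₁, h1, rfl⟩ := hex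
          exact mem_image.2 ⟨a₁, hA1'A h1, hf1 a₁ h1⟩
        · exact mem_image.2 ⟨a, (mem_sdiff.1 ha).1, hf3 a ha hex⟩
      · obtain ⟨a, ha, rfl⟩ := hEsurj v hv
        exact mem_image.2 ⟨x a, (mem_sdiff.1 (hx0 a ha).1).1, hf2 a ha⟩
  refine ⟨f, ?_, him, ?_⟩
  · apply injOn_of_card_image_eq
    rw [him, card_union_of_disjoint (disjoint_of_subset_right hU hB0B1), hUl, hc0]
  · intro a ha
    rcases hsplit a ha with h | h
    · rw [hf1 a h]; exact (hx0 a h).2.2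
    · by_cases hex : ∃ a₁ ∈ A1', x a₁ = a
      · obtain ⟨a₁, h1, rfl⟩ := hex
        rw [hf2 a₁ h1]; exact (hx0 a₁ h1).2.1
      · rw [hf3 a h hex]; exact (hσB a h).2

end BU

namespace BU

/-- Size parameters. -/
structure Par where
  m3 : ℕ
  l3 : ℕ
  s3 : ℕ
  m : ℕ
  l : ℕ
  s : ℕ
  q : ℕ
  k : ℕ
  s0 : ℕ
  x0 : ℕ
  lam : ℕ

namespace Ctx

variable {V W : Type} [Fintype W] (X : Ctx V W)

/-- Balls around a set. -/
noncomputable def ball : ℕ → Finset W → Finset W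
  | 0, A => A
  | (k + 1), A => ball k A ∪ (ball k A).biUnion X.nb

theorem ball_succ (k : ℕ) (A : Finset W) : X.ball k A ⊆ X.ball (k + 1) A := subset_union_left

theorem ball_adj {k : ℕ} {A : Finset W} {u v : W} (hu : u ∈ X.ball k A) (h : X.H.Adj u v) :
    v ∈ X.ball (k + 1) A :=
  mem_union_right _ (mem_biUnion.2 ⟨u, hu, X.mem_nb.2 h⟩)

theorem ball_mono {j k : ℕ} (h : j ≤ k) (A : Finset W) : X.ball j A ⊆ X.ball k A := by
  induction h with
  | refl => exact Subset.refl _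
  | step _ ih => exact ih.trans (X.ball_succ _ _)

/-- Layout of the guest graph. -/
structure Lay where
  S : Finset W
  Q : Finset W
  lab : W → ℕ
  gl : ℕ
  mate : W → W
  I : Fin 3 → Option Bool → Finset W
  hlab : ∀ x y, X.H.Adj x y → x ∉ Q → y ∉ Q → lab x = lab y
  hgl : ∀ x, lab x < gl
  hS : ∀ x ∈ S, ∀ y, X.H.Adj x y → y ∈ S ∪ Q
  hSQ : ∀ x ∈ S, x ∉ Q
  hmate : ∀ i o, ∀ x ∈ I i o, X.H.Adj x (mate x) ∧ X.side x = true
  hball : ∀ i o, ∀ x ∈ I i o, X.ball 3 {x, mate x} ⊆ S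
  hfar : ∀ i o, ∀ x ∈ I i o, ∀ i' o', ∀ x' ∈ I i' o', ∀ z, z ∈ X.ball 3 {x, mate x} →
    z ∈ X.ball 3 {x', mate x'} → x = x' ∧ i = i' ∧ o = o'

namespace Lay

variable {X} (L : X.Lay)

noncomputable def R (k : ℕ) (x : W) : Finset W := X.ball k {x, L.mate x}

noncomputable def Zn (i : Fin 3) (o : Option Bool) (k : ℕ) : Finset W := (L.I i o).biUnion (L.R k)

noncomputable def ctr (b : Bool) (x : W) : W := if b then x else L.mate x

noncomputable def VM : Finset W := L.Zn 0 none 0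

noncomputable def Bf (b : Bool) : Finset W := (L.I 0 (some b)).image (L.ctr b)

noncomputable def BF : Finset W := L.Bf true ∪ L.Bf false

noncomputable def NB : Finset W := L.BF.biUnion X.nb

noncomputable def Lt : Finset W := (univ : Finset (Option Bool)).biUnion (fun o => L.Zn 2 o 2)

noncomputable def Out : Finset W := univ \ (L.S ∪ L.Q)

noncomputable def M : Finset (Sym2 W) := (L.I 0 none).image (fun x => s(x, L.mate x))

/-- special zone: colours of `C1` -/
noncomputable def Sp : Finset W := L.BF ∪ L.Lt ∪ L.Out

noncomputable def Pool2 (P1 : Bool → Finset V) (z : W) : Finset V :=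
  if z ∈ L.Lt ∪ L.Out then P1 (X.side z) else X.P (X.side z)

noncomputable def Ty2 (C1 : Finset V) (e : Sym2 W) : Finset V :=
  if ∃ z ∈ e, z ∈ L.Sp then C1 else X.C

theorem mem_ctr (b : Bool) (x : W) : L.ctr b x ∈ L.R 0 x := by
  unfold ctr R ball
  split_ifs <;> simp

theorem R_mono {j k : ℕ} (h : j ≤ k) (x : W) : L.R j x ⊆ L.R k x := X.ball_mono h _

theorem far {i o x i' o' x' u v} (hx : x ∈ L.I i o) (hx' : x' ∈ L.I i' o') (hu : u ∈ L.R 2 x)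
    (hv : v ∈ L.R 3 x') (h : u = v ∨ X.H.Adj u v) : x = x' ∧ i = i' ∧ o = o' := by
  apply L.hfar i o x hx i' o' x' hx' v _ hv
  rcases h with rfl | h
  · exact X.ball_succ _ _ hu
  · exact X.ball_adj hu h

theorem zn_sep {i o i' o' u v} (hu : u ∈ L.Zn i o 2) (hv : v ∈ L.Zn i' o' 3)
    (h : u = v ∨ X.H.Adj u v) : i = i' ∧ o = o' := by
  obtain ⟨x, hx, hux⟩ := mem_biUnion.1 hu
  obtain ⟨x', hx', hvx⟩ := mem_biUnion.1 hv
  exact (L.far hx hx' hux hvx h).2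

theorem Zn_mono (i o) {j k : ℕ} (h : j ≤ k) : L.Zn i o j ⊆ L.Zn i o k := by
  intro z hz
  obtain ⟨x, hx, hux⟩ := mem_biUnion.1 hz
  exact mem_biUnion.2 ⟨x, hx, L.R_mono h x hux⟩

theorem Zn_S (i o) : L.Zn i o 3 ⊆ L.S := by
  intro z hz
  obtain ⟨x, hx, hux⟩ := mem_biUnion.1 hz
  exact L.hball i o x hx hux

theorem mem_Bf {b z} (h : z ∈ L.Bf b) : ∃ x ∈ L.I 0 (some b), L.ctr b x = z := mem_image.1 h

theorem mem_BF {z} : z ∈ L.BF ↔ ∃ b, z ∈ L.Bf b := by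
  unfold BF
  rw [mem_union]
  constructor
  · rintro (h | h)
    exacts [⟨_, h⟩, ⟨_, h⟩]
  · rintro ⟨b, h⟩
    cases b
    · exact Or.inr h
    · exact Or.inl h

theorem Bf_Zn (b) : L.Bf b ⊆ L.Zn 0 (some b) 0 := by
  intro z hz
  obtain ⟨x, hx, rfl⟩ := L.mem_Bf hz
  exact mem_biUnion.2 ⟨x, hx, L.mem_ctr b x⟩

theorem BF_Zn {z} (h : z ∈ L.BF) : ∃ b, z ∈ L.Zn 0 (some b) 0 := by
  obtain ⟨b, hb⟩ := L.mem_BF.1 h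
  exact ⟨b, L.Bf_Zn b hb⟩

theorem Zn_adj {i o k u v} (hu : u ∈ L.Zn i o k) (h : X.H.Adj u v) : v ∈ L.Zn i o (k + 1) := by
  obtain ⟨x, hx, hux⟩ := mem_biUnion.1 hu
  exact mem_biUnion.2 ⟨x, hx, X.ball_adj hux h⟩

theorem NB_Zn {z} (h : z ∈ L.NB) : ∃ b, z ∈ L.Zn 0 (some b) 1 := by
  obtain ⟨y, hy, hz⟩ := mem_biUnion.1 h
  obtain ⟨b, hb⟩ := L.BF_Zn hy
  exact ⟨b, L.Zn_adj hb (X.mem_nb.1 hz)⟩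

theorem Lt_Zn {z} : z ∈ L.Lt ↔ ∃ o, z ∈ L.Zn 2 o 2 := by simp [Lt]

theorem mem_Out {z} : z ∈ L.Out ↔ z ∉ L.S ∧ z ∉ L.Q := by simp [Out]

theorem Lt_S : L.Lt ⊆ L.S := by
  intro z hz
  obtain ⟨o, ho⟩ := L.Lt_Zn.1 hz
  exact L.Zn_S _ _ (L.Zn_mono _ _ (by norm_num) ho)

theorem BF_S : L.BF ⊆ L.S := by
  intro z hz
  obtain ⟨o, ho⟩ := L.BF_Zn hz
  exact L.Zn_S _ _ (L.Zn_mono _ _ (by norm_num) ho)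

theorem VM_S : L.VM ⊆ L.S := (L.Zn_mono _ _ (by norm_num)).trans (L.Zn_S 0 none)

theorem NB_S : L.NB ⊆ L.S := by
  intro z hz
  obtain ⟨o, ho⟩ := L.NB_Zn hz
  exact L.Zn_S _ _ (L.Zn_mono _ _ (by norm_num) ho)

/-- Stage 0 vertices have neighbours only in stage 0 zones. -/
theorem early_zone {z} (h : z ∈ L.VM ∪ L.NB) : ∃ o, z ∈ L.Zn 0 o 1 := by
  rcases mem_union.1 h with h | h
  · exact ⟨none, L.Zn_mono _ _ (by norm_num) h⟩
  · obtain ⟨b, hb⟩ := L.NB_Zn h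
    exact ⟨_, hb⟩

theorem zone_ne {i o i' o' u v} (hne : i ≠ i') (hu : u ∈ L.Zn i o 2) (hv : v ∈ L.Zn i' o' 3) :
    u ≠ v ∧ ¬ X.H.Adj u v :=
  ⟨fun h => hne (L.zn_sep hu hv (Or.inl h)).1, fun h => hne (L.zn_sep hu hv (Or.inr h)).1⟩

theorem BF_early {z} (h : z ∈ L.BF) : z ∉ L.VM ∪ L.NB := by
  intro h2
  rcases mem_union.1 h2 with h2 | h2
  · obtain ⟨b, hb⟩ := L.BF_Zn h
    have := (L.zn_sep (L.Zn_mono _ _ (by norm_num) hb) (L.Zn_mono _ _ (by norm_num) h2) (Or.inl rfl)).2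
    simp at this
  · obtain ⟨y, hy, hz⟩ := mem_biUnion.1 h2
    rw [X.mem_nb] at hz
    obtain ⟨b, hb⟩ := L.mem_BF.1 h
    obtain ⟨b', hb'⟩ := L.mem_BF.1 hy
    obtain ⟨x, hx, rfl⟩ := L.mem_Bf hb
    obtain ⟨x', hx', rfl⟩ := L.mem_Bf hb'
    obtain ⟨rfl, -, hbb⟩ := L.far hx' hx (L.R_mono (by norm_num) _ (L.mem_ctr b' x'))
      (L.R_mono (by norm_num) _ (L.mem_ctr b x)) (Or.inr hz)
    simp only [Option.some.injEq] at hbb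
    subst hbb
    exact hz.ne rfl

theorem BF_VM {z y} (h : z ∈ L.BF) (hy : y ∈ L.VM) : ¬ X.H.Adj z y := by
  intro hzy
  obtain ⟨b, hb⟩ := L.BF_Zn h
  have := (L.zn_sep (L.Zn_mono _ _ (by norm_num) hb) (L.Zn_mono _ _ (by norm_num) hy) (Or.inr hzy)).2
  simp at this

theorem LtOut_early {z y} (h : z ∈ L.Lt ∪ L.Out) (hy : y ∈ L.VM ∪ L.NB) : z ≠ y ∧ ¬ X.H.Adj z y := by
  obtain ⟨o, ho⟩ := L.early_zone hy
  rcases mem_union.1 h with h | h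
  · obtain ⟨o', ho'⟩ := L.Lt_Zn.1 h
    exact L.zone_ne (by decide) ho' (L.Zn_mono _ _ (by norm_num) ho)
  · rw [L.mem_Out] at h
    have hyS : y ∈ L.S := L.Zn_S _ _ (L.Zn_mono _ _ (by norm_num) ho)
    refine ⟨by rintro rfl; exact h.1 hyS, fun hzy => ?_⟩
    have := L.hS y hyS z hzy.symm
    rw [mem_union] at this
    tauto

theorem nb_BF {z y} (h : z ∈ L.BF) (hy : X.H.Adj z y) : y ∈ L.NB :=
  mem_biUnion.2 ⟨z, h, X.mem_nb.2 hy⟩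

theorem side_ctr {i o b x} (h : x ∈ L.I i o) : X.side (L.ctr b x) = b := by
  obtain ⟨h1, h2⟩ := L.hmate i o x h
  unfold ctr
  cases b
  · simp only [Bool.false_eq_true, if_false]
    rw [X.hside _ _ h1, h2]; rfl
  · simpa using h2

theorem ctr_inj {i o b x x'} (h : x ∈ L.I i o) (h' : x' ∈ L.I i o) (he : L.ctr b x = L.ctr b x') : x = x' :=
  (L.far h h' (L.R_mono (by norm_num) _ (L.mem_ctr b x))
    (L.R_mono (by norm_num) _ (L.mem_ctr b x')) (Or.inl he)).1

theorem card_Bf (b) : (L.Bf b).card = (L.I 0 (some b)).card := by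
  unfold Bf
  apply card_image_of_injOn
  intro x hx x' hx' h
  exact L.ctr_inj hx hx' h

theorem side_Bf {b z} (h : z ∈ L.Bf b) : X.side z = b := by
  obtain ⟨x, hx, rfl⟩ := L.mem_Bf h
  exact L.side_ctr hx

theorem card_M : L.M.card = (L.I 0 none).card := by
  unfold M
  apply card_image_of_injOn
  intro x hx x' hx' h
  simp only [Sym2.eq_iff] at h
  rcases h with h | h
  · exact h.1
  · refine (L.far (u := x) (v := x) hx hx' ?_ ?_ (Or.inl rfl)).1
    · apply L.R_mono (j := 0) (by norm_num); simp [R, ball]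
    · apply L.R_mono (j := 0) (by norm_num); simp [R, ball, h.1]

theorem M_edge {e} (h : e ∈ L.M) : e ∈ X.H.edgeSet ∧ ∀ z ∈ e, z ∈ L.VM := by
  obtain ⟨x, hx, rfl⟩ := mem_image.1 h
  refine ⟨(L.hmate _ _ x hx).1, ?_⟩
  intro z hz
  apply mem_biUnion.2
  refine ⟨x, hx, ?_⟩
  rw [Sym2.mem_iff] at hz
  rcases hz with rfl | rfl <;> simp [R, ball]

/-- Numeric conditions. -/
structure Num (p : Par) : Prop where
  cardI0 : (L.I 0 none).card = p.m3
  cardB : ∀ b, (L.I 0 (some b)).card = p.m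
  cardE : ∀ b, X.ε * (X.P b).card ≤ (L.I 1 (some b)).card
  cardE3 : X.ε * X.C.card ≤ (L.I 1 none).card
  cardL : ∀ o, p.q ≤ (L.I 2 o).card
  cardS : (L.S ∪ L.Q).card ≤ p.s0
  cardQ : L.Q.card ≤ p.x0
  cardLt : L.Lt.card ≤ p.lam
  cardK : ∀ t, (L.Out.filter (fun z => L.lab z = t)).card ≤ p.k
  sidec : ∀ b, ((univ : Finset W).filter (fun z => X.side z = b)).card = (X.P b).card
  edgec : ((univ : Finset (Sym2 W)).filter (fun e => e ∈ X.H.edgeSet)).card = X.C.card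
  m3pos : 0 < p.m3
  mpos : 0 < p.m
  qpos : 0 < p.q
  hsz : ∀ b, ((p.m + p.s : ℕ) : ℝ) + 2 * p.s0 + X.Δ * X.ε * (X.P b).card < X.θ ^ X.Δ / 2 * (X.P b).card
  hcz : ((p.m3 + p.s3 : ℕ) : ℝ) + 2 * (X.Δ * p.s0) ≤ X.θ / 2 * X.C.card
  ac1 : (p.l3 : ℝ) ≤ (X.θ / 2) ^ 2 / 16 * p.m3
  ac2 : (p.m3 : ℝ) ≤ (X.θ / 2) ^ 3 / 64 * (X.C.card / 2)
  ac3 : ((p.l3 + p.s3 : ℕ) : ℝ) ≤ (X.θ / 2) ^ 3 / 64 * (X.C.card / 2)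
  ac4 : ∃ g : ℕ, (g : ℝ) ≤ (X.θ / 2) ^ 2 / 16 * p.m3 ∧
    (p.m3 : ℝ) * X.C.card * 2 ^ p.l3 * (1 - (X.θ / 2) ^ 3 / 64) ^ g < 1
  av1 : (p.l : ℝ) ≤ (X.θ ^ X.Δ / 2) ^ 2 / 16 * p.m
  av2 : ∀ b, (p.m : ℝ) ≤ (X.θ ^ X.Δ / 2) ^ 3 / 64 * ((X.P b).card / 2)
  av3 : ∀ b, ((p.l + p.s : ℕ) : ℝ) ≤ (X.θ ^ X.Δ / 2) ^ 3 / 64 * ((X.P b).card / 2)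
  av4 : ∃ g : ℕ, (g : ℝ) ≤ (X.θ ^ X.Δ / 2) ^ 2 / 16 * p.m ∧
    ∀ b, (p.m : ℝ) * (X.P b).card * 2 ^ p.l * (1 - (X.θ ^ X.Δ / 2) ^ 3 / 64) ^ g < 1
  pc1 : ∀ b, X.ε * (X.P b).card ≤ X.θ ^ X.Δ * ((p.l + p.s : ℕ) : ℝ)
  pc2 : X.ε * X.C.card ≤ ((p.l3 + p.s3 : ℕ) : ℝ)
  ec : ∃ Bd : ℝ, (∀ b, ((p.m + p.s : ℕ) : ℝ) + 3 * p.s0 + 1 + X.Δ * X.ε * (X.P b).card ≤ Bd) ∧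
    Bd * (X.P true).card + Bd * (X.P false).card < X.θ * (X.P true).card * (X.P false).card
  dq1 : ∀ b, X.ε * (X.P b).card ≤ X.θ ^ X.Δ * p.q
  dq2 : X.ε * X.C.card ≤ p.q
  dq3 : ∀ b, (p.k : ℝ) + X.Δ * X.ε * (X.P b).card < X.θ ^ X.Δ * p.q
  dq4 : (X.Δ : ℝ) * p.k ≤ X.θ * p.q
  dq5 : ∀ b, ((X.Δ * p.x0 + p.s + p.q + p.k : ℕ) : ℝ) + X.Δ * X.ε * (X.P b).card <
    X.θ ^ X.Δ * ((p.l + p.s : ℕ) : ℝ)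
  dq6 : ((X.Δ * p.x0 + p.s3 + p.q + X.Δ * p.k : ℕ) : ℝ) ≤ X.θ * ((p.l3 + p.s3 : ℕ) : ℝ)
  ls1 : p.lam + X.Δ * p.x0 ≤ p.s
  ls2 : X.Δ * (p.lam + 2 * p.m) + X.Δ * p.x0 ≤ p.s3
  el1 : ∀ b, ((X.Δ * p.x0 + p.s + p.q + 2 * p.lam : ℕ) : ℝ) + X.Δ * X.ε * (X.P b).card <
    X.θ ^ X.Δ * ((p.l + p.s : ℕ) : ℝ)
  el2 : ((X.Δ * p.x0 + p.s3 + p.q + 2 * (X.Δ * p.lam) : ℕ) : ℝ) ≤ X.θ * ((p.l3 + p.s3 : ℕ) : ℝ)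
  el3 : ∀ b, 2 * (((X.Δ * p.x0 + p.s + p.q + p.lam + 2 * p.q + 1 : ℕ) : ℝ) + X.Δ * X.ε * (X.P b).card) <
    X.θ * ((p.l + p.s : ℕ) : ℝ)
  pd : Disjoint (X.P true) (X.P false)
  fn : (p.s3 : ℝ) ≤ X.θ * ((p.l3 + p.s3 : ℕ) : ℝ)

/-- Vertex absorbing property. -/
def AbsV (p : Par) (φ : W → V) (C1 : Finset V) (P0 P1 : Bool → Finset V) (b : Bool) : Prop :=
  ∀ U ⊆ P1 b, U.card = p.l → ∃ f : W → V, Set.InjOn f (L.Bf b) ∧ (L.Bf b).image f = P0 b ∪ U ∧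
    ∀ z ∈ L.Bf b, ∀ y, X.H.Adj z y → X.thick C1 (f z) (φ y)

def AbsC (p : Par) (φ : W → V) (C0 C1 : Finset V) : Prop :=
  ∀ U ⊆ C1, U.card = p.l3 → ∃ f : W → V, Set.InjOn f (L.I 0 none) ∧ (L.I 0 none).image f = C0 ∪ U ∧
    ∀ x ∈ L.I 0 none, X.T (φ x) (φ (L.mate x)) (f x)

/-- The main invariant. -/
structure Good (p : Par) (C0 C1 : Finset V) (P0 P1 : Bool → Finset V) (emb : Finset W) (φ : W → V)
    (σ : Sym2 W → V) : Prop where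
  vs : X.VS emb φ
  cs : X.CS (X.colE L.M emb) φ σ
  inv : X.Inv (L.Pool2 P1) (L.Ty2 C1) emb φ
  p0 : ∀ b, P0 b ⊆ X.P b
  p1 : ∀ b, P1 b ⊆ X.P b
  p01 : ∀ b, Disjoint (P0 b) (P1 b)
  p0c : ∀ b, (P0 b).card + p.l = p.m
  p1c : ∀ b, (P1 b).card = p.l + p.s
  c0 : C0 ⊆ X.C
  c1 : C1 ⊆ X.C
  c01 : Disjoint C0 C1
  c0c : C0.card + p.l3 = p.m3
  c1c : C1.card = p.l3 + p.s3
  absV : ∀ b, L.AbsV p φ C1 P0 P1 b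
  absC : L.AbsC p φ C0 C1
  early : L.VM ∪ L.NB ⊆ emb
  buf : Disjoint L.BF emb
  p0u : ∀ b, ∀ z ∈ emb, φ z ∉ P0 b
  c0u : ∀ e ∈ X.colE L.M emb, σ e ∉ C0

theorem Good.ext {L : X.Lay} {p : Par} {C0 C1 : Finset V} {P0 P1 : Bool → Finset V} {emb emb' : Finset W}
    {φ φ' : W → V} {σ σ' : Sym2 W → V} (h : L.Good p C0 C1 P0 P1 emb φ σ) (he : emb ⊆ emb')
    (hφ : ∀ z ∈ emb, φ' z = φ z) (hσ : ∀ e ∈ X.colE L.M emb, σ' e = σ e) (vs : X.VS emb' φ')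
    (cs : X.CS (X.colE L.M emb') φ' σ') (inv : X.Inv (L.Pool2 P1) (L.Ty2 C1) emb' φ')
    (buf : Disjoint L.BF emb') (hp : ∀ b, ∀ z ∈ emb', z ∉ emb → φ' z ∉ P0 b)
    (hc : ∀ e ∈ X.colE L.M emb', e ∉ X.colE L.M emb → σ' e ∉ C0) :
    L.Good p C0 C1 P0 P1 emb' φ' σ' where
  vs := vs
  cs := cs
  inv := inv
  p0 := h.p0
  p1 := h.p1
  p01 := h.p01
  p0c := h.p0c
  p1c := h.p1c
  c0 := h.c0
  c1 := h.c1
  c01 := h.c01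
  c0c := h.c0c
  c1c := h.c1c
  absV := by
    intro b U hU hUc
    obtain ⟨f, h1, h2, h3⟩ := h.absV b U hU hUc
    refine ⟨f, h1, h2, fun z hz y hzy => ?_⟩
    have hy : y ∈ emb := h.early (mem_union_right _ (L.nb_BF (L.mem_BF.2 ⟨b, hz⟩) hzy))
    rw [hφ y hy]
    exact h3 z hz y hzy
  absC := by
    intro U hU hUc
    obtain ⟨f, h1, h2, h3⟩ := h.absC U hU hUc
    refine ⟨f, h1, h2, fun x hx => ?_⟩
    have hx1 : x ∈ emb := h.early (mem_union_left _ (mem_biUnion.2 ⟨x, hx, by simp [R, ball]⟩))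
    have hx2 : L.mate x ∈ emb := h.early (mem_union_left _ (mem_biUnion.2 ⟨x, hx, by simp [R, ball]⟩))
    rw [hφ x hx1, hφ _ hx2]
    exact h3 x hx
  early := h.early.trans he
  buf := buf
  p0u := by
    intro b z hz
    by_cases hze : z ∈ emb
    · rw [hφ z hze]; exact h.p0u b z hze
    · exact hp b z hz hze
  c0u := by
    intro e hee
    by_cases h' : e ∈ X.colE L.M emb
    · rw [hσ e h']; exact h.c0u e h'
    · exact hc e hee h'

end Lay
end Ctx
end BU

namespace BU
namespace Ctx
namespace Lay

variable {V W : Type} [Fintype W] {X : Ctx V W} (L : X.Lay)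

theorem filt_or (S A B : Finset V) : (S.filter (fun w => w ∈ A ∨ w ∈ B)).card ≤ A.card + B.card := by
  refine (card_le_card (t := A ∪ B) ?_).trans (card_union_le _ _)
  intro w hw
  rw [mem_filter] at hw
  exact mem_union.2 hw.2

theorem Num.Ppos {L : X.Lay} {p : Par} (h : L.Num p) (b : Bool) : (0 : ℝ) < (X.P b).card := by
  have h1 := h.hsz b
  by_contra hc
  have h0 : ((X.P b).card : ℝ) = 0 := le_antisymm (not_lt.1 hc) (Nat.cast_nonneg _)
  rw [h0] at h1
  have : (0 : ℝ) ≤ ((p.m + p.s : ℕ) : ℝ) + 2 * p.s0 := by positivity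
  linarith

theorem Num.Cpos {L : X.Lay} {p : Par} (h : L.Num p) : (0 : ℝ) < X.C.card := by
  have h1 := h.hcz
  have h2 := h.m3pos
  have h3 : (1 : ℝ) ≤ ((p.m3 + p.s3 : ℕ) : ℝ) := by exact_mod_cast (by omega)
  have h4 : (0 : ℝ) ≤ 2 * (X.Δ * p.s0) := by positivity
  have h5 := X.hθ
  by_contra hc
  have h0 : (X.C.card : ℝ) = 0 := le_antisymm (not_lt.1 hc) (Nat.cast_nonneg _)
  rw [h0] at h1
  linarith

theorem tau_pos : 0 < X.θ ^ X.Δ := pow_pos X.hθ _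
theorem tau_one : X.θ ^ X.Δ ≤ 1 := pow_le_one₀ X.hθ.le X.hθ1

theorem Num.eP {L : X.Lay} {p : Par} (h : L.Num p) (b : Bool) :
    X.ε * ((X.P b).card : ℝ) ≤ X.θ ^ X.Δ / 2 * (X.P b).card := by
  have h1 := h.hsz b
  have h2 : (1 : ℝ) ≤ X.Δ := by exact_mod_cast X.hΔ
  have h3 : (0 : ℝ) ≤ ((p.m + p.s : ℕ) : ℝ) + 2 * p.s0 := by positivity
  have h4 : 0 ≤ X.ε * ((X.P b).card : ℝ) := mul_nonneg X.hε.le (Nat.cast_nonneg _)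
  nlinarith

theorem Num.eC {L : X.Lay} {p : Par} (h : L.Num p) : X.ε * (X.C.card : ℝ) ≤ X.C.card := by
  have h1 := h.pc2
  have h2 := h.ac3
  have h3 : (X.θ / 2) ^ 3 / 64 ≤ 1 := by
    have := X.hθ1
    have := X.hθ
    have : (X.θ / 2) ^ 3 ≤ 1 := pow_le_one₀ (by linarith) (by linarith)
    linarith
  have := h.Cpos
  nlinarith

theorem image_card_le {emb : Finset W} {φ : W → V} {k : ℕ} (h : emb.card ≤ k) :
    ((emb.image φ).card : ℝ) ≤ k := by exact_mod_cast card_image_le.trans h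

theorem colE_tch (M : Finset (Sym2 W)) (emb : Finset W) : X.colE M emb ⊆ X.tch emb := by
  intro e he
  rw [X.mem_colE] at he
  rw [X.mem_tch]
  refine ⟨he.1, ?_⟩
  induction e using Sym2.ind with
  | _ x y => exact ⟨x, by simp, he.2.2 x (by simp)⟩

theorem colE_card (M : Finset (Sym2 W)) (emb : Finset W) : (X.colE M emb).card ≤ X.Δ * emb.card :=
  (card_le_card (colE_tch M emb)).trans (X.card_tch emb)

theorem colE_empty (M : Finset (Sym2 W)) : X.colE M ∅ = ∅ := by
  rw [← card_eq_zero]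
  have := colE_card (X := X) M ∅
  simpa using this

/-- Colour absorber stage. -/
theorem phaseA [Nonempty V] {p : Par} (hN : L.Num p) : ∃ (C0 C1 : Finset V) (φ : W → V) (σ : Sym2 W → V),
    X.VS L.VM φ ∧ X.CS (X.colE L.M L.VM) φ σ ∧ X.Inv (fun z => X.P (X.side z)) (fun _ => X.C) L.VM φ ∧
    C0 ⊆ X.C ∧ C1 ⊆ X.C ∧ Disjoint C0 C1 ∧ C0.card + p.l3 = p.m3 ∧ C1.card = p.l3 + p.s3 ∧
    L.AbsC p φ C0 C1 ∧ ∀ e ∈ X.colE L.M L.VM, σ e ∉ C0 ∪ C1 := by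
  obtain ⟨φ0⟩ : Nonempty (W → V) := ⟨fun _ => Classical.arbitrary V⟩
  obtain ⟨σ0⟩ : Nonempty (Sym2 W → V) := ⟨fun _ => Classical.arbitrary V⟩
  have hτ := tau_pos (X := X)
  have hVM : L.VM.card ≤ p.s0 :=
    (card_le_card (L.VM_S.trans subset_union_left)).trans hN.cardS
  have hcz := hN.hcz
  have hCp := hN.Cpos
  have hθ := X.hθ
  have hθ1 := X.hθ1
  obtain ⟨φ, σ, -, -, hV, hC, hI, -, hth, -⟩ := X.multi (Pool := fun z => X.P (X.side z))
    (Ty := fun _ => X.C) (emb := ∅) (φ := φ0) (σ := σ0) L.M ⟨by simp, by simp⟩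
    (by rw [colE_empty]; exact ⟨by simp, by simp, by simp⟩) (X.inv_empty _ _ _)
    ⟨fun _ _ => Subset.refl _, fun y _ => by
      have := hN.eP (X.side y)
      have := hN.Ppos (X.side y)
      nlinarith, fun _ => Subset.refl _, fun _ => hN.eC⟩ (fun _ => ∅) (fun _ => ∅) p.s0 L.VM hVM (by simp)
    (by
      intro z _
      have := hN.hsz (X.side z)
      have := hN.Ppos (X.side z)
      have h3 : (0 : ℝ) ≤ ((p.m + p.s : ℕ) : ℝ) + p.s0 := by positivity
      simp only [notMem_empty, image_empty, or_self, filter_false, card_empty, Nat.cast_zero]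
      nlinarith)
    (by
      intro e _
      rw [colE_empty]
      have h3 : (0 : ℝ) ≤ ((p.m3 + p.s3 : ℕ) : ℝ) + X.Δ * p.s0 := by positivity
      simp only [notMem_empty, image_empty, or_self, filter_false, card_empty, Nat.cast_zero]
      nlinarith)
  simp only [empty_union] at hV hC hI hth
  set B := X.C \ (X.colE L.M L.VM).image σ with hB
  have hused : (((X.colE L.M L.VM).image σ).card : ℝ) ≤ X.Δ * p.s0 := by
    exact_mod_cast card_image_le.trans ((colE_card _ _).trans (Nat.mul_le_mul_left _ hVM))
  have hms : (0 : ℝ) ≤ ((p.m3 + p.s3 : ℕ) : ℝ) := by positivity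
  have hBc : (X.C.card : ℝ) ≤ B.card + X.Δ * p.s0 := by
    have : X.C.card ≤ B.card + ((X.colE L.M L.VM).image σ).card := by
      rw [hB]; have := le_card_sdiff ((X.colE L.M L.VM).image σ) X.C; omega
    have : (X.C.card : ℝ) ≤ B.card + ((X.colE L.M L.VM).image σ).card := by exact_mod_cast this
    linarith
  have hBC : (B.card : ℝ) ≤ X.C.card := by exact_mod_cast card_le_card sdiff_subset
  have hB2 : (X.C.card : ℝ) / 2 ≤ B.card := by nlinarith
  have hα : 0 < X.θ / 2 := by linarith
  have hα3 : 0 < (X.θ / 2) ^ 3 / 64 := by positivity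
  have hα31 : (X.θ / 2) ^ 3 ≤ 1 := pow_le_one₀ (by linarith) (by linarith)
  obtain ⟨g, hg1, hg2⟩ := hN.ac4
  have hB0 : B.Nonempty := by
    rw [← card_pos]
    have : (0 : ℝ) < B.card := by linarith
    exact_mod_cast this
  obtain ⟨C0, C1, h1, h2, h3, h4, h5, h6⟩ := absorber (L.I 0 none) B
    (fun x c => X.T (φ x) (φ (L.mate x)) c) (X.θ / 2) hα (by linarith)
    (by rw [← card_pos, hN.cardI0]; exact hN.m3pos) hB0
    (by
      intro x hx
      have hxV : x ∈ L.VM := mem_biUnion.2 ⟨x, hx, by simp [R, ball]⟩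
      have hmV : L.mate x ∈ L.VM := mem_biUnion.2 ⟨x, hx, by simp [R, ball]⟩
      have ht := hth x hxV _ hmV (L.hmate _ _ x hx).1
      unfold thick at ht
      have hsub : X.C.filter (fun c => X.T (φ x) (φ (L.mate x)) c) ⊆
          B.filter (fun c => X.T (φ x) (φ (L.mate x)) c) ∪ (X.colE L.M L.VM).image σ := by
        intro c hc
        rw [mem_filter] at hc
        rw [mem_union, mem_filter, hB, mem_sdiff]
        tauto
      have hcc : ((X.C.filter (fun c => X.T (φ x) (φ (L.mate x)) c)).card : ℝ) ≤
          (B.filter (fun c => X.T (φ x) (φ (L.mate x)) c)).card + ((X.colE L.M L.VM).image σ).card := by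
        exact_mod_cast (card_le_card hsub).trans (card_union_le _ _)
      nlinarith)
    p.l3 p.s3 g (by rw [hN.cardI0]; exact hN.ac1)
    (by rw [hN.cardI0]; refine hN.ac2.trans ?_; gcongr)
    (hN.ac3.trans (by gcongr)) (by rw [hN.cardI0]; exact hg1)
    (by
      rw [hN.cardI0]
      refine lt_of_le_of_lt ?_ hg2
      have : 0 ≤ 1 - (X.θ / 2) ^ 3 / 64 := by linarith
      gcongr)
  refine ⟨C0, C1, φ, σ, hV, hC, hI, h1.trans sdiff_subset, h2.trans sdiff_subset, h3, ?_, h4, h6, ?_⟩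
  · rw [h5, hN.cardI0]
  · intro e he hc
    have := union_subset h1 h2 hc
    rw [hB, mem_sdiff] at this
    exact this.2 (mem_image_of_mem _ he)

set_option maxHeartbeats 1000000 in
theorem phaseAB [Nonempty V] {p : Par} (hN : L.Num p) :
    ∃ (C0 C1 : Finset V) (P0 P1 : Bool → Finset V) (φ : W → V) (σ : Sym2 W → V),
      L.Good p C0 C1 P0 P1 (L.VM ∪ L.NB) φ σ ∧ (∀ b, ∀ z ∈ L.VM ∪ L.NB, φ z ∉ P1 b) ∧
      ∀ e ∈ X.colE L.M (L.VM ∪ L.NB), σ e ∉ C1 := by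
  obtain ⟨C0, C1, φ, σ, hV, hC, hI, hC0, hC1, hC01, hC0c, hC1c, hA, hσ⟩ := L.phaseA hN
  have hτ := tau_pos (X := X)
  have hτ1 := tau_one (X := X)
  have hcz := hN.hcz
  have hCp := hN.Cpos
  have hθ := X.hθ
  have hθ1 := X.hθ1
  have hemb : (L.VM ∪ L.NB).card ≤ p.s0 :=
    (card_le_card ((union_subset L.VM_S L.NB_S).trans subset_union_left)).trans hN.cardS
  have hVM : L.VM.card ≤ p.s0 := (card_le_card subset_union_left).trans hemb
  obtain ⟨Ty1, hTy1⟩ : ∃ Ty1 : Sym2 W → Finset V, Ty1 = fun e => if ∃ z ∈ e, z ∈ L.BF then C1 else X.C := ⟨_, rfl⟩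
  have hT1 : ∀ e, (∃ z ∈ e, z ∈ L.BF) → Ty1 e = C1 := by
    intro e he; rw [hTy1]; exact if_pos he
  have hT2 : ∀ e, ¬ (∃ z ∈ e, z ∈ L.BF) → Ty1 e = X.C := by
    intro e he; rw [hTy1]; exact if_neg he
  have hBVM : ∀ z ∈ L.BF, z ∉ L.VM := fun z hz h => L.BF_early hz (mem_union_left _ h)
  have hI1 : X.Inv (fun z => X.P (X.side z)) Ty1 L.VM φ := by
    apply Inv.congr X hI
    · intro z _ h; exact absurd rfl h
    · intro z _ y hy hzy
      apply hT2
      rintro ⟨w, hw, hwB⟩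
      rw [Sym2.mem_iff] at hw
      rcases hw with rfl | rfl
      · exact L.BF_VM hwB hy hzy
      · exact hBVM _ hwB hy
  have hPC1 : X.PC (fun z => X.P (X.side z)) Ty1 L.VM := by
    refine ⟨fun _ _ => Subset.refl _, fun y _ => ?_, fun e => ?_, fun e => ?_⟩
    · have := hN.eP (X.side y)
      have := hN.Ppos (X.side y)
      nlinarith
    · by_cases he : ∃ z ∈ e, z ∈ L.BF
      · rw [hT1 e he]; exact hC1
      · rw [hT2 e he]
    · by_cases he : ∃ z ∈ e, z ∈ L.BF
      · rw [hT1 e he, hC1c]; exact hN.pc2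
      · rw [hT2 e he]; exact hN.eC
  have hun : L.VM ∪ L.NB \ L.VM = L.VM ∪ L.NB := union_sdiff_self_eq_union
  have hC01c : ((C0 ∪ C1).card : ℝ) ≤ ((p.m3 + p.s3 : ℕ) : ℝ) := by
    have := card_union_le C0 C1
    exact_mod_cast (by omega)
  obtain ⟨φ', σ', hag, hσag, hV', hC', hI', -, -, hcol⟩ := X.multi L.M hV hC hI1 hPC1 (fun _ => ∅)
    (fun _ => C0 ∪ C1) p.s0 (L.NB \ L.VM)
    ((card_le_card (sdiff_subset.trans subset_union_right)).trans hemb) sdiff_disjoint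
    (by
      intro z _
      have := hN.hsz (X.side z)
      have := hN.Ppos (X.side z)
      have h3 : (0 : ℝ) ≤ ((p.m + p.s : ℕ) : ℝ) := by positivity
      have h4 : (((X.P (X.side z)).filter (fun w => w ∈ (∅ : Finset V) ∨ w ∈ L.VM.image φ)).card : ℝ) ≤ p.s0 := by
        have := filt_or (X.P (X.side z)) ∅ (L.VM.image φ)
        have h5 : (L.VM.image φ).card ≤ p.s0 := card_image_le.trans hVM
        simp only [card_empty, zero_add] at this
        exact_mod_cast this.trans h5
      nlinarith)
    (by
      intro e he
      rw [hun] at he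
      have hee := (X.mem_colE.1 (mem_sdiff.1 he).1).2.2
      rw [hT2 e (by rintro ⟨z, hz, hzB⟩; exact L.BF_early hzB (hee z hz))]
      have h4 := filt_or X.C (C0 ∪ C1) ((X.colE L.M L.VM).image σ)
      have h5 : ((X.colE L.M L.VM).image σ).card ≤ X.Δ * p.s0 :=
        card_image_le.trans ((colE_card _ _).trans (Nat.mul_le_mul_left _ hVM))
      have h6 : ((X.C.filter (fun w => w ∈ C0 ∪ C1 ∨ w ∈ (X.colE L.M L.VM).image σ)).card : ℝ) ≤
        (C0 ∪ C1).card + X.Δ * p.s0 := by exact_mod_cast h4.trans (by omega)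
      nlinarith)
  rw [hun] at hV' hC' hI' hcol
  have hagV : ∀ z ∈ L.VM, φ' z = φ z := fun z hz => hag z (by simp [hz])
  -- vertex absorbers
  have key : ∀ b, ∃ P0 P1 : Finset V, P0 ⊆ X.P b \ (L.VM ∪ L.NB).image φ' ∧
      P1 ⊆ X.P b \ (L.VM ∪ L.NB).image φ' ∧ Disjoint P0 P1 ∧ P1.card = p.l + p.s ∧ P0.card + p.l = p.m ∧
      ∀ U ⊆ P1, U.card = p.l → ∃ f : W → V, Set.InjOn f (L.Bf b) ∧ (L.Bf b).image f = P0 ∪ U ∧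
        ∀ z ∈ L.Bf b, ∀ y, X.H.Adj z y → X.thick C1 (f z) (φ' y) := by
    intro b
    have hPp := hN.Ppos b
    have hsz := hN.hsz b
    have h3 : (0 : ℝ) ≤ ((p.m + p.s : ℕ) : ℝ) := by positivity
    have hE : 0 ≤ X.Δ * X.ε * (X.P b).card := by have := X.hε; positivity
    set B := X.P b \ (L.VM ∪ L.NB).image φ' with hB
    have hused : (((L.VM ∪ L.NB).image φ').card : ℝ) ≤ p.s0 := image_card_le hemb
    have hBc : ((X.P b).card : ℝ) ≤ B.card + p.s0 := by
      have : (X.P b).card ≤ B.card + ((L.VM ∪ L.NB).image φ').card := by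
        rw [hB]; have := le_card_sdiff ((L.VM ∪ L.NB).image φ') (X.P b); omega
      have : ((X.P b).card : ℝ) ≤ B.card + ((L.VM ∪ L.NB).image φ').card := by exact_mod_cast this
      linarith
    have hBC : (B.card : ℝ) ≤ (X.P b).card := by exact_mod_cast card_le_card sdiff_subset
    have hB2 : ((X.P b).card : ℝ) / 2 ≤ B.card := by nlinarith
    have hα31 : (X.θ ^ X.Δ / 2) ^ 3 ≤ 1 := pow_le_one₀ (by linarith) (by linarith)
    have hα3 : 0 < (X.θ ^ X.Δ / 2) ^ 3 / 64 := by positivity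
    obtain ⟨g, hg1, hg2⟩ := hN.av4
    have hcard : (L.Bf b).card = p.m := by rw [L.card_Bf, hN.cardB]
    apply absorber (L.Bf b) B (fun z w => ∀ y, X.H.Adj z y → X.thick C1 w (φ' y)) (X.θ ^ X.Δ / 2)
      (by linarith) (by linarith) (by rw [← card_pos, hcard]; exact hN.mpos)
      (by rw [← card_pos]
          have : (0 : ℝ) < B.card := by linarith
          exact_mod_cast this) _ p.l p.s g (by rw [hcard]; exact hN.av1)
      (by rw [hcard]; refine (hN.av2 b).trans ?_; gcongr)
      ((hN.av3 b).trans (by gcongr)) (by rw [hcard]; exact hg1)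
      (by
        rw [hcard]
        refine lt_of_le_of_lt ?_ (hg2 b)
        have : 0 ≤ 1 - (X.θ ^ X.Δ / 2) ^ 3 / 64 := by linarith
        gcongr) |>.imp
    · intro P0 h
      obtain ⟨P1, h1, h2, h3, h4, h5, h6⟩ := h
      exact ⟨P1, h1, h2, h3, h4, by rw [h5, hcard], h6⟩
    · intro z hz
      have hzB : z ∈ L.BF := L.mem_BF.2 ⟨b, hz⟩
      have hc := X.cand_big hI' (L.BF_early hzB)
      have hsd := L.side_Bf hz
      have hsub : X.cand (fun z => X.P (X.side z)) Ty1 (L.VM ∪ L.NB) φ' z ⊆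
          B.filter (fun w => ∀ y, X.H.Adj z y → X.thick C1 w (φ' y)) ∪ (L.VM ∪ L.NB).image φ' := by
        intro w hw
        rw [cand, mem_filter] at hw
        have hw2 : ∀ y, X.H.Adj z y → X.thick C1 w (φ' y) := by
          intro y hy
          have := hw.2 y (mem_union_right _ (L.nb_BF hzB hy)) hy
          rwa [hT1 _ ⟨z, by simp, hzB⟩] at this
        have hw1 := hw.1
        rw [hsd] at hw1
        rw [mem_union, mem_filter, hB, mem_sdiff]
        tauto
      have hcc := (card_le_card hsub).trans (card_union_le _ _)
      have hcc' : ((X.cand (fun z => X.P (X.side z)) Ty1 (L.VM ∪ L.NB) φ' z).card : ℝ) ≤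
        (B.filter (fun w => ∀ y, X.H.Adj z y → X.thick C1 w (φ' y))).card +
          ((L.VM ∪ L.NB).image φ').card := by exact_mod_cast hcc
      simp only [hsd] at hc
      have hm := mul_le_mul_of_nonneg_left hBC (by linarith : 0 ≤ X.θ ^ X.Δ / 2)
      have hs0 : (0 : ℝ) ≤ p.s0 := Nat.cast_nonneg _
      have hfin : X.θ ^ X.Δ / 2 * (B.card : ℝ) ≤
        (B.filter (fun w => ∀ y, X.H.Adj z y → X.thick C1 w (φ' y))).card := by linarith
      convert hfin
  choose P0 P1 k1 k2 k3 k4 k5 k6 using key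
  have hfinC : ∀ e ∈ X.colE L.M (L.VM ∪ L.NB), σ' e ∉ C0 ∪ C1 := by
    intro e he
    by_cases h : e ∈ X.colE L.M L.VM
    · rw [hσag e h]; exact hσ e h
    · exact (hcol e (mem_sdiff.2 ⟨he, h⟩)).2
  refine ⟨C0, C1, P0, P1, φ', σ', ⟨hV', hC', ?_, fun b => (k1 b).trans sdiff_subset,
    fun b => (k2 b).trans sdiff_subset, k3, k5, k4, hC0, hC1, hC01, hC0c, hC1c, k6, ?_, Subset.refl _, ?_, ?_, ?_⟩, ?_, ?_⟩
  · apply Inv.congr X hI'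
    · intro z _ h y hy
      have : z ∈ L.Lt ∪ L.Out := by
        by_contra hc
        exact h (if_neg hc)
      exact (L.LtOut_early this hy).2
    · intro z _ y hy hzy
      have hsp : ∀ w ∈ s(z, y), w ∈ L.Sp → w ∈ L.BF := by
        intro w hw hwS
        by_contra hwB
        have : w ∈ L.Lt ∪ L.Out := by
          simp only [Sp, mem_union] at hwS ⊢; tauto
        rw [Sym2.mem_iff] at hw
        rcases hw with rfl | rfl
        · exact (L.LtOut_early this hy).2 hzy
        · exact (L.LtOut_early this hy).1 rfl
      by_cases he : ∃ w ∈ s(z, y), w ∈ L.BF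
      · rw [hT1 _ he]
        obtain ⟨w, hw, hwB⟩ := he
        exact if_pos ⟨w, hw, by simp [Sp, hwB]⟩
      · rw [hT2 _ he]
        apply if_neg
        rintro ⟨w, hw, hwB⟩
        exact he ⟨w, hw, hsp w hw hwB⟩
  · intro U hU hUc
    obtain ⟨f, h1, h2, h3⟩ := hA U hU hUc
    refine ⟨f, h1, h2, fun x hx => ?_⟩
    rw [hagV x (mem_biUnion.2 ⟨x, hx, by simp [R, ball]⟩),
      hagV (L.mate x) (mem_biUnion.2 ⟨x, hx, by simp [R, ball]⟩)]
    exact h3 x hx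
  · rw [disjoint_left]
    exact fun z hz => L.BF_early hz
  · intro b z hz hc
    have := k1 b hc
    rw [mem_sdiff] at this
    exact this.2 (mem_image_of_mem _ hz)
  · intro e he hc
    exact hfinC e he (mem_union_left _ hc)
  · intro b z hz hc
    have := k2 b hc
    rw [mem_sdiff] at this
    exact this.2 (mem_image_of_mem _ hz)
  · intro e he hc
    exact hfinC e he (mem_union_right _ hc)

/-- Pool conditions for the main pools. -/
theorem Good.pc {L : X.Lay} {p : Par} {C0 C1 : Finset V} {P0 P1 : Bool → Finset V} {emb : Finset W}
    {φ : W → V} {σ : Sym2 W → V} (h : L.Good p C0 C1 P0 P1 emb φ σ) (hN : L.Num p) (emb' : Finset W) :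
    X.PC (L.Pool2 P1) (L.Ty2 C1) emb' := by
  have hτ := tau_pos (X := X)
  refine ⟨fun y _ => ?_, fun y _ => ?_, fun e => ?_, fun e => ?_⟩
  · unfold Pool2; split_ifs
    · exact h.p1 _
    · exact Subset.refl _
  · unfold Pool2; split_ifs
    · rw [h.p1c]; exact hN.pc1 _
    · have := hN.eP (X.side y)
      have := hN.Ppos (X.side y)
      nlinarith
  · unfold Ty2; split_ifs
    · exact h.c1
    · exact Subset.refl _
  · unfold Ty2; split_ifs
    · rw [h.c1c]; exact hN.pc2
    · exact hN.eC

end Lay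
end Ctx
end BU

namespace BU
namespace Ctx
namespace Lay

variable {V W : Type} [Fintype W] {X : Ctx V W} {L : X.Lay}

theorem Zn0_BF {i o z} (hi : i ≠ 0) (h : z ∈ L.Zn i o 2) : z ∉ L.BF := by
  intro hz
  obtain ⟨b, hb⟩ := L.BF_Zn hz
  exact (L.zone_ne hi h (L.Zn_mono _ _ (by norm_num) hb)).1 rfl

theorem ctr_sub {i o b} : (L.I i o).image (L.ctr b) ⊆ L.Zn i o 0 := by
  intro z hz
  obtain ⟨x, hx, rfl⟩ := mem_image.1 hz
  exact mem_biUnion.2 ⟨x, hx, L.mem_ctr b x⟩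

theorem Good.p0d {p : Par} {C0 C1 : Finset V} {P0 P1 : Bool → Finset V} {emb : Finset W}
    {φ : W → V} {σ : Sym2 W → V} (hG : L.Good p C0 C1 P0 P1 emb φ σ) (hN : L.Num p) {b b' : Bool} {u : V}
    (hu : u ∈ X.P b) (h0 : u ∉ P0 b) : u ∉ P0 b' := by
  intro h
  have hpd := hN.pd
  have h2 := hG.p0 b' h
  rw [disjoint_left] at hpd
  cases b <;> cases b'
  · exact h0 h
  · exact hpd h2 hu
  · exact hpd hu h2
  · exact h0 h

/-- Covering vertices with zone centres. -/
theorem Good.coverV {p : Par} {C0 C1 : Finset V} {P0 P1 : Bool → Finset V} {emb : Finset W}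
    {φ : W → V} {σ : Sym2 W → V} (hG : L.Good p C0 C1 P0 P1 emb φ σ) (hN : L.Num p) (i : Fin 3) (hi : i ≠ 0)
    (b : Bool) (hz : ∀ z ∈ L.Zn i (some b) 2, z ∉ emb) (Z : Finset V) (hZ : Z ⊆ X.P b)
    (hZd : Disjoint Z (emb.image φ)) (hZ0 : Disjoint Z (P0 b)) (hZc : Z.card ≤ (L.I i (some b)).card)
    (htyp : ∀ u ∈ Z, ∀ x ∈ L.Zn i (some b) 0, ∀ y ∈ L.Zn i (some b) 1, X.side y = !b →
      X.θ * ((L.Pool2 P1 y).card : ℝ) ≤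
      ((L.Pool2 P1 y).filter (fun v => X.thick (L.Ty2 C1 s(y, x)) v u)).card) :
    ∃ (φ' : W → V) (I' : Finset W), I' ⊆ L.Zn i (some b) 0 ∧ (∀ z ∈ I', X.side z = b) ∧
      (∀ z, z ∉ I' → φ' z = φ z) ∧
      L.Good p C0 C1 P0 P1 (emb ∪ I') φ' σ ∧ I'.image φ' = Z ∧ X.colE L.M (emb ∪ I') = X.colE L.M emb := by
  set J := (L.I i (some b)).image (L.ctr b) with hJ
  have hJ0 : J ⊆ L.Zn i (some b) 0 := ctr_sub
  have hJs : ∀ x ∈ J, X.side x = b := by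
    intro x hx
    obtain ⟨x0, hx0, rfl⟩ := mem_image.1 hx
    exact L.side_ctr hx0
  have hJ2 : ∀ x ∈ J, ∀ z, z ∈ J → (∃ y, X.H.Adj x y ∧ X.H.Adj y z) → z = x := by
    rintro x hx z hz' ⟨y, hxy, hyz⟩
    obtain ⟨x0, hx0, rfl⟩ := mem_image.1 hx
    obtain ⟨z0, hz0, rfl⟩ := mem_image.1 hz'
    have := L.far (u := y) (v := L.ctr b z0) hx0 hz0
      (L.R_mono (by norm_num : 1 ≤ 2) _ (X.ball_adj (L.mem_ctr b x0) hxy))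
      (L.R_mono (by norm_num) _ (L.mem_ctr b z0)) (Or.inr hyz)
    rw [this.1]
  have hJc : J.card = (L.I i (some b)).card := by
    apply card_image_of_injOn
    intro x hx x' hx' h
    exact L.ctr_inj hx hx' h
  obtain ⟨φ', I', h1, h2, h3, h4, h5, h6⟩ := X.cover_vertex hG.vs hG.inv b J
    (fun x hx => ⟨hJs x hx, hz x (L.Zn_mono _ _ (by norm_num) (hJ0 hx))⟩)
    (fun x hx y hxy z hyz => ⟨hz z (L.Zn_adj (L.Zn_adj (hJ0 hx) hxy) hyz), fun hzJ => hJ2 x hx z hzJ ⟨y, hxy, hyz⟩⟩)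
    Z hZ hZd (by rw [hJc]; exact hZc)
    (fun u hu x hx y hxy => htyp u hu x (hJ0 hx) y (L.Zn_adj (hJ0 hx) hxy) (by
      rw [X.hside _ _ hxy, hJs x hx]))
  have hdis : ∀ z ∈ I', z ∉ emb := fun z hz' => hz z (L.Zn_mono _ _ (by norm_num) (hJ0 (h1 hz')))
  have hcE : X.colE L.M (emb ∪ I') = X.colE L.M emb := by
    apply X.colE_free
    intro x hx y hy hxy
    rcases mem_union.1 hy with hy | hy
    · exact hz y (L.Zn_mono _ _ (by norm_num) (L.Zn_adj (hJ0 (h1 hx)) hxy)) hy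
    · have e1 := hJs x (h1 hx)
      have e2 := hJs y (h1 hy)
      have e3 := X.hside _ _ hxy
      rw [e1, e2] at e3
      simp at e3
  refine ⟨φ', I', h1.trans hJ0, fun z hz' => hJs z (h1 hz'), h3, ?_, h6, hcE⟩
  have hag : ∀ z ∈ emb, φ' z = φ z := fun z hz' => h3 z (fun hI => hdis z hI hz')
  apply hG.ext subset_union_left hag (fun _ _ => rfl) h4
  · rw [hcE]
    apply CS.congr X hG.cs
    intro e he z hze
    exact hag z ((X.mem_colE.1 he).2.2 z hze)
  · exact h5
  · rw [disjoint_union_right]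
    refine ⟨hG.buf, ?_⟩
    rw [disjoint_right]
    intro z hz'
    exact Zn0_BF hi (L.Zn_mono _ _ (by norm_num) (hJ0 (h1 hz')))
  · intro b' z hz' hze
    have hzI : z ∈ I' := by rw [mem_union] at hz'; tauto
    have hzZ : φ' z ∈ Z := by rw [← h6]; exact mem_image_of_mem _ hzI
    exact hG.p0d hN (hZ hzZ) (disjoint_left.1 hZ0 hzZ)
  · intro e he hne
    rw [hcE] at he
    exact absurd he hne

/-- Covering colours with zone edges. -/
theorem Good.coverC {p : Par} {C0 C1 : Finset V} {P0 P1 : Bool → Finset V} {emb : Finset W}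
    {φ : W → V} {σ : Sym2 W → V} (hG : L.Good p C0 C1 P0 P1 emb φ σ) (hN : L.Num p) (i : Fin 3) (hi : i ≠ 0)
    (hz : ∀ z ∈ L.Zn i none 1, z ∉ emb) (U : Bool → Finset V) (hU : ∀ b, U b ⊆ X.P b)
    (Av : Finset V) (hAv : ∀ b, ∀ u ∈ U b, u ∉ Av → u ∉ P0 b) (Bd : ℝ) (N : ℕ)
    (hBd : ∀ b, (((U b).filter (fun w => w ∈ Av ∨ w ∈ emb.image φ)).card : ℝ) + 2 * N + 1 +
      X.Δ * X.ε * (X.P b).card ≤ Bd)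
    (Z : Finset V) (hZ : Z ⊆ X.C) (hZd : Disjoint Z ((X.colE L.M emb).image σ)) (hZ0 : Disjoint Z C0)
    (hZc : Z.card ≤ (L.I i none).card) (hZN : Z.card ≤ N)
    (hcount : ∀ c ∈ Z, Bd * (U true).card + Bd * (U false).card <
      (((U true) ×ˢ (U false)).filter (fun p => X.T p.1 p.2 c)).card) :
    ∃ (φ' : W → V) (σ' : Sym2 W → V) (K : Finset W), K ⊆ L.Zn i none 0 ∧
      (∀ z, z ∉ K → φ' z = φ z) ∧ (∀ e ∈ X.colE L.M emb, σ' e = σ e) ∧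
      L.Good p C0 C1 P0 P1 (emb ∪ K) φ' σ' ∧ (∀ z ∈ K, φ' z ∈ U (X.side z) ∧ φ' z ∉ Av) ∧
      (X.colE L.M (emb ∪ K)).image σ' = (X.colE L.M emb).image σ ∪ Z := by
  have hx0 : ∀ x ∈ L.I i none, x ∈ L.Zn i none 0 := fun x hx => mem_biUnion.2 ⟨x, hx, by simp [R, ball]⟩
  have hm0 : ∀ x ∈ L.I i none, L.mate x ∈ L.Zn i none 0 := fun x hx => mem_biUnion.2 ⟨x, hx, by simp [R, ball]⟩
  have hz0 : ∀ z ∈ L.Zn i none 0, z ∉ emb := fun z h => hz z (L.Zn_mono _ _ (by norm_num) h)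
  obtain ⟨φ', σ', I', h1, h2, h3, h4, h5, h6, h7, h8, h9⟩ := X.cover_colour L.M hG.vs hG.inv (hG.pc hN emb)
    hG.cs (L.I i none) L.mate (by
      intro x hx
      refine ⟨(L.hmate _ _ x hx).1, (L.hmate _ _ x hx).2, ?_, hz0 x (hx0 x hx), hz0 _ (hm0 x hx), ?_, ?_⟩
      · intro hM
        exact hz0 x (hx0 x hx) (hG.early (mem_union_left _ ((L.M_edge hM).2 x (by simp))))
      · intro z hze hxz
        exact hz z (L.Zn_adj (hx0 x hx) hxz) hze
      · intro z hze hxz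
        exact hz z (L.Zn_adj (hm0 x hx) hxz) hze) (by
      intro x hx x' hx' hne z hzz z' hzz'
      have hzR : z ∈ L.R 2 x := L.R_mono (by norm_num : 0 ≤ 2) _ hzz
      have hzR' : z' ∈ L.R 3 x' := L.R_mono (by norm_num : 0 ≤ 3) _ hzz'
      exact ⟨fun h => hne (L.far hx hx' hzR hzR' (Or.inl h)).1,
        fun h => hne (L.far hx hx' hzR hzR' (Or.inr h)).1⟩) U hU Av Bd N hBd Z hZ hZd hZc hZN hcount
  have hK : I' ∪ I'.image L.mate ⊆ L.Zn i none 0 := by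
    intro z hz'
    rcases mem_union.1 hz' with hz' | hz'
    · exact hx0 z (h1 hz')
    · obtain ⟨x, hx, rfl⟩ := mem_image.1 hz'
      exact hm0 x (h1 hx)
  refine ⟨φ', σ', I' ∪ I'.image L.mate, hK, h3, h4, ?_, h8, h9⟩
  have hag : ∀ z ∈ emb, φ' z = φ z := fun z hz' => h3 z (fun hI => hz0 z (hK hI) hz')
  apply hG.ext subset_union_left hag h4 h5 h6 h7
  · rw [disjoint_union_right]
    refine ⟨hG.buf, ?_⟩
    rw [disjoint_right]
    intro z hz'
    exact Zn0_BF hi (L.Zn_mono _ _ (by norm_num) (hK hz'))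
  · intro b' z hz' hze
    have hzI : z ∈ I' ∪ I'.image L.mate := by rw [mem_union] at hz'; tauto
    have := h8 z hzI
    exact hG.p0d hN (hU _ this.1) (hAv _ _ this.1 this.2)
  · intro e he _ hc
    have : σ' e ∈ (X.colE L.M emb).image σ ∪ Z := by rw [← h9]; exact mem_image_of_mem _ he
    rcases mem_union.1 this with h | h
    · obtain ⟨e', he', hee⟩ := mem_image.1 h
      rw [← hee] at hc
      exact hG.c0u e' he' hc
    · exact disjoint_left.1 hZ0 h hc

/-- General extension of a good state. -/
theorem Good.multi [Nonempty V] {p : Par} {C0 C1 : Finset V} {P0 P1 : Bool → Finset V} {emb : Finset W}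
    {φ : W → V} {σ : Sym2 W → V} (hG : L.Good p C0 C1 P0 P1 emb φ σ) (hN : L.Num p) (Av AvC : Finset V)
    (N : ℕ) (K : Finset W) (hK : K.card ≤ N) (hd : Disjoint K emb) (hB : Disjoint L.BF K)
    (hAv : ∀ z ∈ K, ∀ u ∈ L.Pool2 P1 z, u ∉ Av → u ∉ P0 (X.side z))
    (hAvC : ∀ e ∈ X.colE L.M (emb ∪ K) \ X.colE L.M emb, ∀ c ∈ L.Ty2 C1 e, c ∉ AvC → c ∉ C0)
    (hroom : ∀ z ∈ K, (((L.Pool2 P1 z).filter (fun w => w ∈ Av ∨ w ∈ emb.image φ)).card : ℝ) + N +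
      X.Δ * X.ε * (X.P (X.side z)).card < X.θ ^ X.Δ * (L.Pool2 P1 z).card)
    (hcroom : ∀ e ∈ X.colE L.M (emb ∪ K) \ X.colE L.M emb,
      (((L.Ty2 C1 e).filter (fun c => c ∈ AvC ∨ c ∈ (X.colE L.M emb).image σ)).card : ℝ) + X.Δ * N ≤
        X.θ * (L.Ty2 C1 e).card) :
    ∃ (φ' : W → V) (σ' : Sym2 W → V), (∀ z, z ∉ K → φ' z = φ z) ∧ (∀ e ∈ X.colE L.M emb, σ' e = σ e) ∧
      L.Good p C0 C1 P0 P1 (emb ∪ K) φ' σ' ∧ (∀ z ∈ K, φ' z ∈ L.Pool2 P1 z ∧ φ' z ∉ Av) ∧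
      (∀ e ∈ X.colE L.M (emb ∪ K) \ X.colE L.M emb, σ' e ∈ L.Ty2 C1 e ∧ σ' e ∉ AvC) := by
  obtain ⟨φ', σ', h1, h2, h3, h4, h5, h6, -, h8⟩ := X.multi L.M hG.vs hG.cs hG.inv (hG.pc hN emb)
    (fun _ => Av) (fun _ => AvC) N K hK hd hroom hcroom
  refine ⟨φ', σ', h1, h2, ?_, h6, h8⟩
  apply hG.ext subset_union_left (fun z hz => h1 z (disjoint_right.1 hd hz)) h2 h3 h4 h5
  · rw [disjoint_union_right]; exact ⟨hG.buf, hB⟩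
  · intro b z hz hze
    have hzK : z ∈ K := by rw [mem_union] at hz; tauto
    have h6' := h6 z hzK
    exact hG.p0d hN (h3.mem z hz) (hAv z hzK _ h6'.1 h6'.2)
  · intro e he hne
    have he' := mem_sdiff.2 ⟨he, hne⟩
    exact hAvC e he' _ (h8 e he').1 (h8 e he').2

end Lay
end Ctx
end BU

namespace BU
namespace Ctx
namespace Lay

variable {V W : Type} [Fintype W] {X : Ctx V W} {L : X.Lay}

/-- Uncovered vertices outside the reservoirs are typical. -/
def Clean (C1 : Finset V) (P0 P1 : Bool → Finset V) (emb : Finset W) (φ : W → V) : Prop :=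
  ∀ b, ∀ u ∈ X.P b, u ∉ P0 b → u ∉ P1 b → u ∉ emb.image φ →
    X.θ * ((P1 (!b)).card : ℝ) ≤ ((P1 (!b)).filter (fun v => X.thick C1 v u)).card

def CleanC (L : X.Lay) (C0 C1 : Finset V) (P1 : Bool → Finset V) (emb : Finset W) (σ : Sym2 W → V) : Prop :=
  ∀ c ∈ X.C, c ∉ C0 → c ∉ C1 → c ∉ (X.colE L.M emb).image σ →
    X.θ * ((P1 true).card : ℝ) * (P1 false).card ≤
      (((P1 true) ×ˢ (P1 false)).filter (fun p => X.T p.1 p.2 c)).card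

theorem zone1 {o z k} (h : z ∈ L.Zn 1 o k) (hk : k ≤ 2) : z ∉ L.Sp := by
  have h2 := L.Zn_mono 1 o hk h
  have h3 := L.Zn_mono 1 o (by omega : k ≤ 3) h
  intro hz
  simp only [Sp, mem_union] at hz
  rcases hz with (hz | hz) | hz
  · exact Zn0_BF (by decide) h2 hz
  · obtain ⟨o', ho'⟩ := L.Lt_Zn.1 hz
    exact (L.zone_ne (by decide) ho' h3).1 rfl
  · exact (L.mem_Out.1 hz).1 (L.Zn_S _ _ h3)

theorem zone1_early {o z k} (h : z ∈ L.Zn 1 o k) (hk : k ≤ 2) : z ∉ L.VM ∪ L.NB := by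
  intro hz
  obtain ⟨o', ho'⟩ := L.early_zone hz
  exact (L.zone_ne (by decide) (L.Zn_mono _ _ hk h) (L.Zn_mono _ _ (by norm_num) ho')).1 rfl

theorem zone_disj {i o i' o' z k k'} (h : z ∈ L.Zn i o k) (hk : k ≤ 2) (h' : z ∈ L.Zn i' o' k') (hk' : k' ≤ 3) :
    i = i' ∧ o = o' :=
  L.zn_sep (L.Zn_mono _ _ hk h) (L.Zn_mono _ _ hk' h') (Or.inl rfl)

theorem Pool2_P {P1 : Bool → Finset V} {z} (h : z ∉ L.Sp) : L.Pool2 P1 z = X.P (X.side z) := by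
  apply if_neg
  intro hz
  apply h
  simp only [Sp, mem_union] at hz ⊢
  tauto

theorem Ty2_C {C1 : Finset V} {e} (h : ∀ z ∈ e, z ∉ L.Sp) : L.Ty2 C1 e = X.C := by
  apply if_neg
  rintro ⟨z, hz, hzS⟩
  exact h z hz hzS

theorem embC_Sp {z} (h : z ∈ (L.S ∪ L.Q) \ (L.Lt ∪ L.BF)) : z ∉ L.Sp := by
  simp only [mem_sdiff, mem_union] at h
  intro hz
  simp only [Sp, mem_union, L.mem_Out] at hz
  tauto

theorem Sp_embC {z} (h : z ∉ L.Sp) : z ∈ (L.S ∪ L.Q) \ (L.Lt ∪ L.BF) := by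
  simp only [Sp, mem_union, L.mem_Out] at h
  simp only [mem_sdiff, mem_union]
  tauto

theorem early_embC {z} (h : z ∈ L.VM ∪ L.NB) : z ∉ L.Sp := by
  intro hz
  simp only [Sp, mem_union] at hz
  rcases hz with (hz | hz) | hz
  · exact L.BF_early hz h
  · exact (L.LtOut_early (mem_union_left _ hz) h).1 rfl
  · exact (L.LtOut_early (mem_union_right _ hz) h).1 rfl

set_option maxHeartbeats 2000000 in
theorem phaseC [Nonempty V] {p : Par} (hN : L.Num p) :
    ∃ (C0 C1 : Finset V) (P0 P1 : Bool → Finset V) (φ : W → V) (σ : Sym2 W → V),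
      L.Good p C0 C1 P0 P1 ((L.S ∪ L.Q) \ (L.Lt ∪ L.BF)) φ σ ∧
      (∀ b, ∀ z ∈ (L.S ∪ L.Q) \ (L.Lt ∪ L.BF), φ z ∉ P1 b) ∧
      (∀ e ∈ X.colE L.M ((L.S ∪ L.Q) \ (L.Lt ∪ L.BF)), σ e ∉ C1) ∧
      Clean (X := X) C1 P0 P1 ((L.S ∪ L.Q) \ (L.Lt ∪ L.BF)) φ ∧
      L.CleanC C0 C1 P1 ((L.S ∪ L.Q) \ (L.Lt ∪ L.BF)) σ := by
  obtain ⟨C0, C1, P0, P1, φ0, σ0, hG0, hP10, hC10⟩ := L.phaseAB hN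
  have hpd := hN.pd
  have hτ := tau_pos (X := X)
  have hτ1 := tau_one (X := X)
  have hP1d : ∀ b b' u, u ∈ X.P b → u ∉ P1 b → u ∉ P1 b' := by
    intro b b' u hu h0 h
    have h2 := hG0.p1 b' h
    rw [disjoint_left] at hpd
    cases b <;> cases b'
    · exact h0 h
    · exact hpd h2 hu
    · exact hpd hu h2
    · exact h0 h
  have hC1b := hN.pc2
  rw [← hG0.c1c] at hC1b
  have hP1b : ∀ b, X.ε * ((X.P b).card : ℝ) ≤ (P1 b).card := by
    intro b
    have := hN.pc1 b
    rw [hG0.p1c b]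
    have h0 : (0 : ℝ) ≤ ((p.l + p.s : ℕ) : ℝ) := Nat.cast_nonneg _
    nlinarith
  obtain ⟨bad, hbad⟩ : ∃ bad : Bool → Finset V, ∀ b u, u ∈ bad b ↔ u ∈ X.P b ∧
      (((P1 (!b)).filter (fun v => X.thick C1 u v)).card : ℝ) < X.θ * (P1 (!b)).card :=
    ⟨fun b => (X.P b).filter (fun u =>
      (((P1 (!b)).filter (fun v => X.thick C1 u v)).card : ℝ) < X.θ * (P1 (!b)).card),
      fun b u => by simp⟩
  have hbadc : ∀ b, ((bad b).card : ℝ) ≤ X.ε * (X.P b).card := by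
    intro b
    have := X.reg b (P1 (!b)) (hG0.p1 _) C1 hG0.c1 (hP1b _) hC1b
    convert this using 3
    ext u
    rw [hbad, mem_filter]
    rfl
  have hbadI : ∀ b, (bad b).card ≤ (L.I 1 (some b)).card := by
    intro b
    have := (hbadc b).trans (hN.cardE b)
    exact_mod_cast this
  obtain ⟨badC, hbadC⟩ : ∃ badC : Finset V, ∀ c, c ∈ badC ↔ c ∈ X.C ∧
      ((((P1 true) ×ˢ (P1 false)).filter (fun p => X.T p.1 p.2 c)).card : ℝ) <
        X.θ * ((P1 true).card : ℝ) * (P1 false).card :=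
    ⟨X.C.filter (fun c => ((((P1 true) ×ˢ (P1 false)).filter (fun p => X.T p.1 p.2 c)).card : ℝ) <
        X.θ * ((P1 true).card : ℝ) * (P1 false).card), fun c => by simp⟩
  have hbadCI : badC.card ≤ (L.I 1 none).card := by
    have := X.creg (P1 true) (hG0.p1 _) (P1 false) (hG0.p1 _) (hP1b _) (hP1b _)
    have h2 : (badC.card : ℝ) ≤ X.ε * X.C.card := by
      convert this using 3
      ext u
      rw [hbadC, mem_filter]
    exact_mod_cast h2.trans hN.cardE3
  -- typicality at early covers
  have htyp : ∀ b, ∀ u ∈ X.P b, ∀ x ∈ L.Zn 1 (some b) 0, ∀ y ∈ L.Zn 1 (some b) 1, X.side y = !b →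
      X.θ * ((L.Pool2 P1 y).card : ℝ) ≤
      ((L.Pool2 P1 y).filter (fun v => X.thick (L.Ty2 C1 s(y, x)) v u)).card := by
    intro b u hu x hx y hy hsy
    have hyS := zone1 hy (by norm_num)
    have hxS := zone1 hx (by norm_num)
    rw [Pool2_P hyS, Ty2_C (by
      intro z hz; rw [Sym2.mem_iff] at hz; rcases hz with rfl | rfl <;> assumption), hsy]
    simp only [X.thick_comm _ _ u]
    exact X.deg b u hu
  -- first vertex cover
  obtain ⟨φ1, I1, hI1, -, hag1, hG1, him1, hcE1⟩ := hG0.coverV hN 1 (by decide) true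
    (fun z hz => zone1_early hz le_rfl) (bad true \ (P0 true ∪ P1 true ∪ (L.VM ∪ L.NB).image φ0))
    (fun u hu => ((hbad _ _).1 (mem_sdiff.1 hu).1).1)
    (by rw [disjoint_left]; intro u hu h; exact (mem_sdiff.1 hu).2 (mem_union_right _ h))
    (by rw [disjoint_left]; intro u hu h; exact (mem_sdiff.1 hu).2 (mem_union_left _ (mem_union_left _ h)))
    ((card_le_card sdiff_subset).trans (hbadI _))
    (fun u hu => htyp _ u ((hbad _ _).1 (mem_sdiff.1 hu).1).1)
  have hz2 : ∀ z ∈ L.Zn 1 (some false) 2, z ∉ L.VM ∪ L.NB ∪ I1 := by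
    intro z hz h
    rcases mem_union.1 h with h | h
    · exact zone1_early hz le_rfl h
    · have := (zone_disj (hI1 h) (by norm_num) hz (by norm_num)).2
      simp at this
  obtain ⟨φ2, I2, hI2, -, hag2, hG2, him2, hcE2⟩ := hG1.coverV hN 1 (by decide) false
    hz2 (bad false \ (P0 false ∪ P1 false ∪ (L.VM ∪ L.NB ∪ I1).image φ1))
    (fun u hu => ((hbad _ _).1 (mem_sdiff.1 hu).1).1)
    (by rw [disjoint_left]; intro u hu h; exact (mem_sdiff.1 hu).2 (mem_union_right _ h))
    (by rw [disjoint_left]; intro u hu h; exact (mem_sdiff.1 hu).2 (mem_union_left _ (mem_union_left _ h)))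
    ((card_le_card sdiff_subset).trans (hbadI _))
    (fun u hu => htyp _ u ((hbad _ _).1 (mem_sdiff.1 hu).1).1)
  set emb2 := L.VM ∪ L.NB ∪ I1 ∪ I2 with hemb2
  have hz3 : ∀ z ∈ L.Zn 1 none 1, z ∉ emb2 := by
    intro z hz h
    rcases mem_union.1 h with h | h
    · rcases mem_union.1 h with h | h
      · exact zone1_early hz (by norm_num) h
      · have := (zone_disj (hI1 h) (by norm_num) hz (by norm_num)).2
        simp at this
    · have := (zone_disj (hI2 h) (by norm_num) hz (by norm_num)).2
      simp at this
  have hsub2 : emb2 ⊆ (L.S ∪ L.Q) \ (L.Lt ∪ L.BF) := by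
    intro z h
    apply Sp_embC
    rcases mem_union.1 h with h | h
    · rcases mem_union.1 h with h | h
      · exact early_embC h
      · exact zone1 (hI1 h) (by norm_num)
    · exact zone1 (hI2 h) (by norm_num)
  have hcardC : ((L.S ∪ L.Q) \ (L.Lt ∪ L.BF)).card ≤ p.s0 := (card_le_card sdiff_subset).trans hN.cardS
  set Av := P0 true ∪ P0 false ∪ P1 true ∪ P1 false with hAvd
  have hAv0 : ∀ b u, u ∉ Av → u ∉ P0 b ∧ u ∉ P1 b := by
    intro b u hu
    simp only [hAvd, mem_union, not_or] at hu
    cases b <;> tauto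
  have hfilt : ∀ b (A : Finset V) (k : ℕ), A.card ≤ k →
      (((X.P b).filter (fun w => w ∈ Av ∨ w ∈ A)).card : ℝ) ≤ ((p.m + p.s : ℕ) : ℝ) + k := by
    intro b A k hk
    have h1 : (X.P b).filter (fun w => w ∈ Av ∨ w ∈ A) ⊆ P0 b ∪ P1 b ∪ A := by
      intro w hw
      rw [mem_filter] at hw
      by_contra hcon
      simp only [mem_union, not_or] at hcon
      rcases hw.2 with h | h
      · have a1 := fun b' => hG0.p0d hN (b' := b') hw.1 hcon.1.1
        have a2 := fun b' => hP1d b b' w hw.1 hcon.1.2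
        simp only [hAvd, mem_union] at h
        rcases h with ((h | h) | h) | h
        exacts [a1 _ h, a1 _ h, a2 _ h, a2 _ h]
      · exact hcon.2 h
    have h2 := card_le_card h1
    have h3 := card_union_le (P0 b ∪ P1 b) A
    have h4 := card_union_le (P0 b) (P1 b)
    have h5 := hG0.p0c b
    have h6 := hG0.p1c b
    exact_mod_cast (by omega)
  obtain ⟨Bd, hBd1, hBd2⟩ := hN.ec
  set ZC := badC \ (C0 ∪ C1 ∪ (X.colE L.M emb2).image σ0) with hZC
  have hZCc : ZC.card ≤ (L.I 1 none).card := (card_le_card sdiff_subset).trans hbadCI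
  have hIs0 : (L.I 1 none).card ≤ p.s0 := by
    refine (card_le_card ?_).trans hN.cardS
    intro x hx
    apply mem_union_left
    apply L.Zn_S 1 none
    apply L.Zn_mono 1 none (by norm_num : 0 ≤ 3)
    exact mem_biUnion.2 ⟨x, hx, by simp [R, ball]⟩
  obtain ⟨φ3, σ3, K3, hK3, hag3, hσ3, hG3, hv3, him3⟩ := hG2.coverC hN 1 (by decide) hz3 X.P
    (fun _ => Subset.refl _) Av (fun b u _ hu => (hAv0 b u hu).1) Bd p.s0
    (by
      intro b
      refine le_trans ?_ (hBd1 b)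
      have := hfilt b (emb2.image φ2) p.s0 (card_image_le.trans ((card_le_card hsub2).trans hcardC))
      linarith) ZC (fun c hc => ((hbadC c).1 (mem_sdiff.1 hc).1).1)
    (by rw [disjoint_left]; intro u hu h; exact (mem_sdiff.1 hu).2 (mem_union_right _ h))
    (by rw [disjoint_left]; intro u hu h; exact (mem_sdiff.1 hu).2 (mem_union_left _ (mem_union_left _ h)))
    hZCc (hZCc.trans hIs0)
    (fun c hc => hBd2.trans_le (X.cdeg c ((hbadC c).1 (mem_sdiff.1 hc).1).1))
  set emb3 := emb2 ∪ K3 with hemb3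
  have hsub3 : emb3 ⊆ (L.S ∪ L.Q) \ (L.Lt ∪ L.BF) := by
    apply union_subset hsub2
    intro z hz
    exact Sp_embC (zone1 (hK3 hz) (by norm_num))
  set embC := (L.S ∪ L.Q) \ (L.Lt ∪ L.BF) with hembC
  have hun : emb3 ∪ embC \ emb3 = embC := union_sdiff_of_subset hsub3
  have hcz := hN.hcz
  have hCp := hN.Cpos
  have hθ := X.hθ
  obtain ⟨φ4, σ4, hag4, hσ4, hG4, hv4, hc4⟩ := hG3.multi hN Av (C0 ∪ C1) p.s0 (embC \ emb3)
    ((card_le_card sdiff_subset).trans hcardC) sdiff_disjoint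
    (by
      rw [disjoint_left]; intro z hz h
      have := (mem_sdiff.1 h).1
      rw [hembC] at this
      exact (mem_sdiff.1 this).2 (mem_union_right _ hz))
    (fun z _ u _ hu => (hAv0 _ u hu).1)
    (fun e _ c _ hc h => hc (mem_union_left _ h))
    (by
      intro z hz
      have hzS := embC_Sp (mem_sdiff.1 hz).1
      rw [Pool2_P hzS]
      have h1 := hfilt (X.side z) (emb3.image φ3) p.s0 (card_image_le.trans ((card_le_card hsub3).trans hcardC))
      have h2 := hN.hsz (X.side z)
      have h3 := hN.Ppos (X.side z)
      have h4 : 0 < X.θ ^ X.Δ * (X.P (X.side z)).card := by positivity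
      linarith)
    (by
      intro e he
      rw [hun] at he
      have hee := (X.mem_colE.1 (mem_sdiff.1 he).1).2.2
      rw [Ty2_C (fun z hz => embC_Sp (hee z hz))]
      have h4 := filt_or X.C (C0 ∪ C1) ((X.colE L.M emb3).image σ3)
      have h5 : ((X.colE L.M emb3).image σ3).card ≤ X.Δ * p.s0 :=
        card_image_le.trans ((colE_card _ _).trans (Nat.mul_le_mul_left _
          ((card_le_card hsub3).trans hcardC)))
      have h7 : (C0 ∪ C1).card ≤ p.m3 + p.s3 := by
        have := card_union_le C0 C1
        have := hG0.c0c
        have := hG0.c1c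
        omega
      have h6 : ((X.C.filter (fun w => w ∈ C0 ∪ C1 ∨ w ∈ (X.colE L.M emb3).image σ3)).card : ℝ) ≤
        ((p.m3 + p.s3 : ℕ) : ℝ) + X.Δ * p.s0 := by exact_mod_cast h4.trans (by omega)
      have h8 : 0 < X.θ * X.C.card := by positivity
      linarith)
  rw [hun] at hG4 hc4
  -- transfer of agreement
  have ag43 : ∀ z ∈ emb3, φ4 z = φ3 z := fun z hz => hag4 z (by simp [hz])
  have ag32 : ∀ z ∈ emb2, φ3 z = φ2 z := fun z hz => hag3 z (fun h => hz3 z (L.Zn_mono _ _ (by norm_num) (hK3 h)) hz)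
  have ag21 : ∀ z ∈ L.VM ∪ L.NB ∪ I1, φ2 z = φ1 z :=
    fun z hz => hag2 z (fun h => hz2 z (L.Zn_mono _ _ (by norm_num) (hI2 h)) hz)
  have ag10 : ∀ z ∈ L.VM ∪ L.NB, φ1 z = φ0 z :=
    fun z hz => hag1 z (fun h => zone1_early (hI1 h) (by norm_num) hz)
  have s12 : L.VM ∪ L.NB ∪ I1 ⊆ emb2 := subset_union_left
  have s23 : emb2 ⊆ emb3 := subset_union_left
  refine ⟨C0, C1, P0, P1, φ4, σ4, hG4, ?_, ?_, ?_, ?_⟩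
  · intro b z hz
    by_cases h3 : z ∈ emb3
    · rw [ag43 z h3]
      by_cases h2 : z ∈ emb2
      · rw [ag32 z h2]
        by_cases h1 : z ∈ L.VM ∪ L.NB ∪ I1
        · rw [ag21 z h1]
          by_cases h0 : z ∈ L.VM ∪ L.NB
          · rw [ag10 z h0]; exact hP10 b z h0
          · have hzI : z ∈ I1 := by rw [mem_union] at h1; tauto
            have := mem_image_of_mem φ1 hzI
            rw [him1, mem_sdiff] at this
            simp only [mem_union, not_or] at this
            exact hP1d true b _ ((hbad _ _).1 this.1).1 this.2.1.2
        · have hzI : z ∈ I2 := by rw [hemb2, mem_union] at h2; tauto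
          have := mem_image_of_mem φ2 hzI
          rw [him2, mem_sdiff] at this
          simp only [mem_union, not_or] at this
          exact hP1d false b _ ((hbad _ _).1 this.1).1 this.2.1.2
      · have hzI : z ∈ K3 := by rw [hemb3, mem_union] at h3; tauto
        exact (hAv0 b _ (hv3 z hzI).2).2
    · exact (hAv0 b _ (hv4 z (mem_sdiff.2 ⟨hz, h3⟩)).2).2
  · intro e he
    by_cases h3 : e ∈ X.colE L.M emb3
    · rw [hσ4 e h3]
      have := mem_image_of_mem σ3 h3
      rw [him3, hcE2, hcE1] at this
      rcases mem_union.1 this with h | h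
      · obtain ⟨e', he', hee⟩ := mem_image.1 h
        rw [← hee]; exact hC10 e' he'
      · intro hc
        exact (mem_sdiff.1 h).2 (mem_union_left _ (mem_union_right _ hc))
    · intro hc
      exact (hc4 e (mem_sdiff.2 ⟨he, h3⟩)).2 (mem_union_right _ hc)
  · -- clean
    intro b u hu h0 h1 hfree
    by_contra hcon
    push Not at hcon
    have hub : u ∈ bad b := by
      rw [hbad]
      refine ⟨hu, ?_⟩
      simp only [X.thick_comm _ u]
      exact hcon
    have f3 : u ∉ emb3.image φ3 := by
      intro h
      obtain ⟨z, hz, rfl⟩ := mem_image.1 h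
      apply hfree
      rw [← ag43 z hz]
      exact mem_image_of_mem _ (hsub3 hz)
    have f2 : u ∉ emb2.image φ2 := by
      intro h
      obtain ⟨z, hz, rfl⟩ := mem_image.1 h
      apply f3
      rw [← ag32 z hz]
      exact mem_image_of_mem _ (s23 hz)
    have f1 : u ∉ (L.VM ∪ L.NB ∪ I1).image φ1 := by
      intro h
      obtain ⟨z, hz, rfl⟩ := mem_image.1 h
      apply f2
      rw [← ag21 z hz]
      exact mem_image_of_mem _ (s12 hz)
    have f0 : u ∉ (L.VM ∪ L.NB).image φ0 := by
      intro h
      obtain ⟨z, hz, rfl⟩ := mem_image.1 h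
      apply f1
      rw [← ag10 z hz]
      exact mem_image_of_mem _ (mem_union_left _ hz)
    cases b
    · have : u ∈ I2.image φ2 := by
        rw [him2, mem_sdiff]
        simp only [mem_union, not_or] at *
        tauto
      obtain ⟨z, hz, rfl⟩ := mem_image.1 this
      exact f2 (mem_image_of_mem _ (mem_union_right _ hz))
    · have : u ∈ I1.image φ1 := by
        rw [him1, mem_sdiff]
        simp only [mem_union, not_or] at *
        tauto
      obtain ⟨z, hz, rfl⟩ := mem_image.1 this
      exact f1 (mem_image_of_mem _ (mem_union_right _ hz))
  · intro c hc h0 h1 hfree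
    by_contra hcon
    push Not at hcon
    have hub : c ∈ badC := (hbadC c).2 ⟨hc, hcon⟩
    have f3 : c ∉ (X.colE L.M emb3).image σ3 := by
      intro h
      obtain ⟨e, he, rfl⟩ := mem_image.1 h
      apply hfree
      rw [← hσ4 e he]
      exact mem_image_of_mem _ (X.colE_mono _ hsub3 he)
    apply f3
    rw [him3]
    by_cases h : c ∈ (X.colE L.M emb2).image σ0
    · exact mem_union_left _ h
    · apply mem_union_right
      rw [hZC, mem_sdiff]
      simp only [mem_union, not_or]
      exact ⟨hub, ⟨h0, h1⟩, h⟩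

end Lay
end Ctx
end BU

namespace BU
namespace Ctx
namespace Lay

variable {V W : Type} [Fintype W] {X : Ctx V W} {L : X.Lay}

noncomputable def outV (X : Ctx V W) (P0 P1 : Bool → Finset V) (emb : Finset W) (φ : W → V) (b : Bool) : Finset V :=
  X.P b \ (P0 b ∪ P1 b ∪ emb.image φ)

noncomputable def outC (L : X.Lay) (C0 C1 : Finset V) (emb : Finset W) (σ : Sym2 W → V) : Finset V :=
  X.C \ (C0 ∪ C1 ∪ (X.colE L.M emb).image σ)

theorem mem_outV {P0 P1 : Bool → Finset V} {emb : Finset W} {φ : W → V} {b : Bool} {u : V} :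
    u ∈ outV X P0 P1 emb φ b ↔ u ∈ X.P b ∧ u ∉ P0 b ∧ u ∉ P1 b ∧ u ∉ emb.image φ := by
  simp only [outV, mem_sdiff, mem_union]; tauto

theorem mem_outC {C0 C1 : Finset V} {emb : Finset W} {σ : Sym2 W → V} {u : V} :
    u ∈ outC L C0 C1 emb σ ↔ u ∈ X.C ∧ u ∉ C0 ∧ u ∉ C1 ∧ u ∉ (X.colE L.M emb).image σ := by
  simp only [outC, mem_sdiff, mem_union]; tauto

/-- generic count -/
theorem count4 {A A0 A1 U : Finset V} (h0 : A0 ⊆ A) (h1 : A1 ⊆ A) (hd : Disjoint A0 A1) (hU : U ⊆ A)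
    (hU0 : Disjoint U A0) :
    U.card + A0.card + A1.card + (A \ (A0 ∪ A1 ∪ U)).card = A.card + (A1.filter (· ∈ U)).card := by
  have e1 : (A \ (A0 ∪ A1 ∪ U)).card + (A0 ∪ A1 ∪ U).card = A.card :=
    card_sdiff_add_card_eq_card (union_subset (union_subset h0 h1) hU)
  have e2 : (A0 ∪ A1 ∪ U).card = A0.card + (A1 ∪ U).card := by
    rw [union_assoc, card_union_of_disjoint]
    rw [disjoint_union_right]; exact ⟨hd, hU0.symm⟩
  have e3 := card_union_add_card_inter A1 U
  have e4 : A1.filter (· ∈ U) = A1 ∩ U := by ext; simp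
  rw [e4]
  omega

theorem Good.imageV {p : Par} {C0 C1 : Finset V} {P0 P1 : Bool → Finset V} {emb : Finset W}
    {φ : W → V} {σ : Sym2 W → V} (hG : L.Good p C0 C1 P0 P1 emb φ σ) (hN : L.Num p) (b : Bool) {u : V}
    (hu : u ∈ X.P b) : u ∈ emb.image φ ↔ u ∈ (emb.filter (fun z => X.side z = b)).image φ := by
  simp only [mem_image, mem_filter]
  constructor
  · rintro ⟨z, hz, rfl⟩
    refine ⟨z, ⟨hz, ?_⟩, rfl⟩
    have := hG.vs.mem z hz
    by_contra hne
    have hpd := hN.pd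
    rw [disjoint_left] at hpd
    cases b <;> cases h : X.side z <;> simp_all
  · rintro ⟨z, hz, rfl⟩
    exact ⟨z, hz.1, rfl⟩

theorem Good.cntV {p : Par} {C0 C1 : Finset V} {P0 P1 : Bool → Finset V} {emb : Finset W}
    {φ : W → V} {σ : Sym2 W → V} (hG : L.Good p C0 C1 P0 P1 emb φ σ) (hN : L.Num p) (b : Bool) :
    (emb.filter (fun z => X.side z = b)).card + p.m + p.s + (outV X P0 P1 emb φ b).card =
      (X.P b).card + ((P1 b).filter (· ∈ emb.image φ)).card := by
  have hU : (emb.filter (fun z => X.side z = b)).image φ ⊆ X.P b := by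
    intro u hu
    obtain ⟨z, hz, rfl⟩ := mem_image.1 hu
    rw [mem_filter] at hz
    rw [← hz.2]; exact hG.vs.mem z hz.1
  have hU0 : Disjoint ((emb.filter (fun z => X.side z = b)).image φ) (P0 b) := by
    rw [disjoint_left]
    intro u hu
    obtain ⟨z, hz, rfl⟩ := mem_image.1 hu
    rw [mem_filter] at hz
    exact hG.p0u b z hz.1
  have := count4 (hG.p0 b) (hG.p1 b) (hG.p01 b) hU hU0
  have e1 : ((emb.filter (fun z => X.side z = b)).image φ).card = (emb.filter (fun z => X.side z = b)).card :=
    card_image_of_injOn (hG.vs.inj.mono (by exact_mod_cast filter_subset _ _))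
  have e2 : X.P b \ (P0 b ∪ P1 b ∪ (emb.filter (fun z => X.side z = b)).image φ) = outV X P0 P1 emb φ b := by
    ext u
    rw [mem_outV]
    simp only [mem_sdiff, mem_union]
    by_cases hu : u ∈ X.P b
    · rw [hG.imageV hN b hu]; tauto
    · tauto
  have e3 : (P1 b).filter (· ∈ (emb.filter (fun z => X.side z = b)).image φ) = (P1 b).filter (· ∈ emb.image φ) := by
    apply filter_congr
    intro u hu
    rw [hG.imageV hN b (hG.p1 b hu)]
  rw [e1, e2, e3] at this
  have := hG.p0c b
  have := hG.p1c b
  omega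

theorem Good.cntC {p : Par} {C0 C1 : Finset V} {P0 P1 : Bool → Finset V} {emb : Finset W}
    {φ : W → V} {σ : Sym2 W → V} (hG : L.Good p C0 C1 P0 P1 emb φ σ) :
    (X.colE L.M emb).card + p.m3 + p.s3 + (outC L C0 C1 emb σ).card =
      X.C.card + (C1.filter (· ∈ (X.colE L.M emb).image σ)).card := by
  have hU : (X.colE L.M emb).image σ ⊆ X.C := by
    intro u hu
    obtain ⟨z, hz, rfl⟩ := mem_image.1 hu
    exact hG.cs.mem z hz
  have hU0 : Disjoint ((X.colE L.M emb).image σ) C0 := by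
    rw [disjoint_left]
    intro u hu
    obtain ⟨z, hz, rfl⟩ := mem_image.1 hu
    exact hG.c0u z hz
  have := count4 hG.c0 hG.c1 hG.c01 hU hU0
  have e1 : ((X.colE L.M emb).image σ).card = (X.colE L.M emb).card := card_image_of_injOn hG.cs.inj
  rw [e1] at this
  have := hG.c0c
  have := hG.c1c
  unfold outC
  omega

theorem sideLe {p : Par} (hN : L.Num p) {emb : Finset W} (hB : Disjoint L.BF emb) (b : Bool) :
    (emb.filter (fun z => X.side z = b)).card + p.m ≤ (X.P b).card := by
  rw [← hN.sidec b, ← hN.cardB b, ← L.card_Bf b, ← card_union_of_disjoint]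
  · apply card_le_card
    intro z hz
    rw [mem_union, mem_filter] at hz
    rw [mem_filter]
    rcases hz with hz | hz
    · exact ⟨mem_univ _, hz.2⟩
    · exact ⟨mem_univ _, L.side_Bf hz⟩
  · rw [disjoint_right]
    intro z hz hz'
    exact disjoint_left.1 hB (L.mem_BF.2 ⟨b, hz⟩) (mem_filter.1 hz').1

theorem colLe {p : Par} (hN : L.Num p) (emb : Finset W) : (X.colE L.M emb).card + p.m3 ≤ X.C.card := by
  rw [← hN.edgec, ← hN.cardI0, ← L.card_M, ← card_union_of_disjoint]
  · apply card_le_card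
    intro z hz
    rw [mem_union, X.mem_colE] at hz
    rw [mem_filter]
    rcases hz with hz | hz
    · exact ⟨mem_univ _, hz.1⟩
    · exact ⟨mem_univ _, (L.M_edge hz).1⟩
  · rw [disjoint_right]
    intro z hz hz'
    exact (X.mem_colE.1 hz').2.1 hz

/-- State during phase D. -/
structure DState (L : X.Lay) (p : Par) (C0 C1 : Finset V) (P0 P1 : Bool → Finset V) (emb : Finset W)
    (φ : W → V) (σ : Sym2 W → V) : Prop where
  good : L.Good p C0 C1 P0 P1 emb φ σ
  cl : Clean (X := X) C1 P0 P1 emb φ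
  clc : L.CleanC C0 C1 P1 emb σ
  dv : ∀ b, (∀ z ∈ emb, φ z ∈ P1 b → ∃ y ∈ L.Q, X.H.Adj y z) ∨ (outV X P0 P1 emb φ b).card < p.q
  dc : (∀ e ∈ X.colE L.M emb, σ e ∈ C1 → ∃ y ∈ e, y ∈ L.Q) ∨ (outC L C0 C1 emb σ).card < p.q

variable {p : Par} {C0 C1 : Finset V} {P0 P1 : Bool → Finset V} {emb : Finset W}
    {φ : W → V} {σ : Sym2 W → V}

theorem dvA (hN : L.Num p) {b : Bool} (h : ∀ z ∈ emb, φ z ∈ P1 b → ∃ y ∈ L.Q, X.H.Adj y z) :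
    ((P1 b).filter (· ∈ emb.image φ)).card ≤ X.Δ * p.x0 := by
  have : (P1 b).filter (· ∈ emb.image φ) ⊆ (L.Q.biUnion X.nb).image φ := by
    intro u hu
    rw [mem_filter] at hu
    obtain ⟨z, hz, rfl⟩ := mem_image.1 hu.2
    obtain ⟨y, hy, hyz⟩ := h z hz hu.1
    exact mem_image_of_mem _ (mem_biUnion.2 ⟨y, hy, X.mem_nb.2 hyz⟩)
  calc _ ≤ _ := card_le_card this
    _ ≤ _ := card_image_le
    _ ≤ L.Q.card * X.Δ := card_biUnion_le_card_mul _ _ _ (fun z _ => X.card_nb z)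
    _ ≤ X.Δ * p.x0 := by rw [mul_comm]; exact Nat.mul_le_mul_left _ hN.cardQ

theorem dcA (hN : L.Num p) (h : ∀ e ∈ X.colE L.M emb, σ e ∈ C1 → ∃ y ∈ e, y ∈ L.Q) :
    (C1.filter (· ∈ (X.colE L.M emb).image σ)).card ≤ X.Δ * p.x0 := by
  have : C1.filter (· ∈ (X.colE L.M emb).image σ) ⊆ (X.tch L.Q).image σ := by
    intro u hu
    rw [mem_filter] at hu
    obtain ⟨z, hz, rfl⟩ := mem_image.1 hu.2
    exact mem_image_of_mem _ (X.mem_tch.2 ⟨(X.mem_colE.1 hz).1, h z hz hu.1⟩)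
  calc _ ≤ _ := card_le_card this
    _ ≤ _ := card_image_le
    _ ≤ X.Δ * L.Q.card := X.card_tch _
    _ ≤ X.Δ * p.x0 := Nat.mul_le_mul_left _ hN.cardQ

theorem DState.useV (h : DState L p C0 C1 P0 P1 emb φ σ) (hN : L.Num p) (b : Bool) :
    ((P1 b).filter (· ∈ emb.image φ)).card ≤ X.Δ * p.x0 + p.s + p.q := by
  rcases h.dv b with h1 | h1
  · have := dvA hN h1; omega
  · have := h.good.cntV hN b
    have := sideLe hN h.good.buf b
    omega

theorem DState.useC (h : DState L p C0 C1 P0 P1 emb φ σ) (hN : L.Num p) :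
    (C1.filter (· ∈ (X.colE L.M emb).image σ)).card ≤ X.Δ * p.x0 + p.s3 + p.q := by
  rcases h.dc with h1 | h1
  · have := dcA hN h1; omega
  · have := h.good.cntC
    have := colLe hN emb
    omega

set_option maxHeartbeats 1000000 in
theorem DState.step [Nonempty V] (h : DState L p C0 C1 P0 P1 emb φ σ) (hN : L.Num p) (t : ℕ)
    (he : emb = ((L.S ∪ L.Q) \ (L.Lt ∪ L.BF)) ∪ L.Out.filter (fun z => L.lab z < t)) :
    ∃ φ' σ', DState L p C0 C1 P0 P1 (emb ∪ L.Out.filter (fun z => L.lab z = t)) φ' σ' := by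
  obtain ⟨K, hKd⟩ : ∃ K, K = L.Out.filter (fun z => L.lab z = t) := ⟨_, rfl⟩
  rw [← hKd]
  have hKO : ∀ z ∈ K, z ∈ L.Out := fun z hz => by rw [hKd] at hz; exact (mem_filter.1 hz).1
  have hKl : ∀ z ∈ K, L.lab z = t := fun z hz => by rw [hKd] at hz; exact (mem_filter.1 hz).2
  have hd : Disjoint K emb := by
    rw [disjoint_left]
    intro z hz hze
    have h1 := L.mem_Out.1 (hKO z hz)
    have h2 := hKl z hz
    rw [he] at hze
    simp only [mem_union, mem_sdiff, mem_filter] at hze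
    rcases hze with hze | hze
    · tauto
    · omega
  have hnQ : ∀ z ∈ K, ∀ y ∈ emb, X.H.Adj z y → y ∈ L.Q := by
    intro z hz y hy hzy
    have h1 := L.mem_Out.1 (hKO z hz)
    by_contra hyQ
    have hl := L.hlab z y hzy h1.2 hyQ
    rw [hKl z hz] at hl
    rw [he] at hy
    simp only [mem_union, mem_sdiff, mem_filter] at hy
    rcases hy with hy | hy
    · rcases hy.1 with hy | hy
      · have := L.hS y hy z hzy.symm
        rw [mem_union] at this; tauto
      · exact hyQ hy
    · omega
  have hBK : Disjoint L.BF K := by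
    rw [disjoint_left]
    intro z hz hzK
    exact (L.mem_Out.1 (hKO z hzK)).1 (L.BF_S hz)
  have hKc : K.card ≤ p.k := by rw [hKd]; exact hN.cardK t
  have hG := h.good
  have hτ := tau_pos (X := X)
  have hθ := X.hθ
  -- pools
  obtain ⟨PoolD, hPD⟩ : ∃ f : W → Finset V, ∀ z, f z = if z ∈ K ∧ (∀ y ∈ L.Q, ¬ X.H.Adj z y) ∧
      p.q ≤ (outV X P0 P1 emb φ (X.side z)).card then outV X P0 P1 emb φ (X.side z) else L.Pool2 P1 z := ⟨_, fun _ => rfl⟩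
  obtain ⟨TyD, hTD⟩ : ∃ f : Sym2 W → Finset V, ∀ e, f e = if (∀ z ∈ e, z ∈ K) ∧
      p.q ≤ (outC L C0 C1 emb σ).card then outC L C0 C1 emb σ else L.Ty2 C1 e := ⟨_, fun _ => rfl⟩
  have hI : X.Inv PoolD TyD emb φ := by
    apply Inv.congr X hG.inv
    · intro z hz hne y hy hzy
      rw [hPD] at hne
      split_ifs at hne with hc
      · exact hc.2.1 y (hnQ z hc.1 y hy hzy) hzy
      · exact hne rfl
    · intro z hz y hy hzy
      rw [hTD, if_neg]
      rintro ⟨hh, -⟩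
      exact disjoint_left.1 hd (hh y (by simp)) hy
  have hPC2 := hG.pc hN emb
  have hPC : X.PC PoolD TyD emb := by
    refine ⟨?_, ?_, ?_, ?_⟩
    · intro z hz
      rw [hPD]
      split_ifs with hc
      · exact fun u hu => (mem_outV.1 hu).1
      · exact hPC2.sub z hz
    · intro z hz
      rw [hPD]
      split_ifs with hc
      · refine (hN.dq1 _).trans ?_
        have : (p.q : ℝ) ≤ (outV X P0 P1 emb φ (X.side z)).card := by exact_mod_cast hc.2.2
        exact mul_le_mul_of_nonneg_left this hτ.le
      · exact hPC2.big z hz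
    · intro e
      rw [hTD]
      split_ifs with hc
      · exact fun u hu => (mem_outC.1 hu).1
      · exact hPC2.tsub e
    · intro e
      rw [hTD]
      split_ifs with hc
      · refine hN.dq2.trans ?_
        exact_mod_cast hc.2
      · exact hPC2.tbig e
  obtain ⟨φ', σ', h1, h2, h3, h4, h5, h6, -, h8⟩ := X.multi L.M hG.vs hG.cs hI hPC
    (fun _ => ∅) (fun _ => ∅) p.k K hKc hd (by
      intro z hz
      rw [hPD]
      split_ifs with hc
      · have e0 : (outV X P0 P1 emb φ (X.side z)).filter (fun w => w ∈ (∅ : Finset V) ∨ w ∈ emb.image φ) = ∅ := by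
          apply filter_false_of_mem
          intro u hu
          have := (mem_outV.1 hu).2.2.2
          simpa using this
        have : (p.q : ℝ) ≤ (outV X P0 P1 emb φ (X.side z)).card := by exact_mod_cast hc.2.2
        have := mul_le_mul_of_nonneg_left this hτ.le
        have := hN.dq3 (X.side z)
        rw [e0]
        simp only [card_empty, Nat.cast_zero]
        linarith
      · have e1 : L.Pool2 P1 z = P1 (X.side z) := if_pos (mem_union_right _ (hKO z hz))
        have e2 := h.useV hN (X.side z)
        have e3 := hN.dq5 (X.side z)
        have e2' : (((P1 (X.side z)).filter (· ∈ emb.image φ)).card : ℝ) ≤ ((X.Δ * p.x0 + p.s + p.q : ℕ) : ℝ) := by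
          exact_mod_cast e2
        rw [e1, hG.p1c]
        simp only [notMem_empty, false_or]
        push_cast at e2' e3 ⊢
        linarith) (by
      intro e hee
      have het := X.newE_sub _ _ _ hee
      rw [X.mem_tch] at het
      obtain ⟨z, hze, hzK⟩ := het.2
      rw [hTD]
      split_ifs with hc
      · have e0 : (outC L C0 C1 emb σ).filter (fun w => w ∈ (∅ : Finset V) ∨ w ∈ (X.colE L.M emb).image σ) = ∅ := by
          apply filter_false_of_mem
          intro u hu
          have := (mem_outC.1 hu).2.2.2
          simpa using this
        have : (p.q : ℝ) ≤ (outC L C0 C1 emb σ).card := by exact_mod_cast hc.2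
        have := mul_le_mul_of_nonneg_left this hθ.le
        have := hN.dq4
        rw [e0]
        simp only [card_empty, Nat.cast_zero]
        linarith
      · have e1 : L.Ty2 C1 e = C1 := if_pos ⟨z, hze, by
          unfold Sp; exact mem_union_right _ (hKO z hzK)⟩
        have e2 := h.useC hN
        have e3 := hN.dq6
        have e2' : ((C1.filter (· ∈ (X.colE L.M emb).image σ)).card : ℝ) ≤ ((X.Δ * p.x0 + p.s3 + p.q : ℕ) : ℝ) := by
          exact_mod_cast e2
        rw [e1, hG.c1c]
        simp only [notMem_empty, false_or]
        push_cast at e2' e3 ⊢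
        linarith)
  have hag : ∀ z ∈ emb, φ' z = φ z := fun z hz => h1 z (disjoint_right.1 hd hz)
  have hI' : X.Inv (L.Pool2 P1) (L.Ty2 C1) (emb ∪ K) φ' := by
    apply Inv.congr X h5
    · intro z hz hne
      exfalso; apply hne
      rw [hPD, if_neg]
      rintro ⟨hh, -⟩
      exact hz (mem_union_right _ hh)
    · intro z hz y hy hzy
      rw [hTD, if_neg]
      rintro ⟨hh, -⟩
      exact hz (mem_union_right _ (hh z (by simp)))
  have himg : emb.image φ ⊆ (emb ∪ K).image φ' := by
    intro u hu
    obtain ⟨z, hz, rfl⟩ := mem_image.1 hu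
    rw [← hag z hz]; exact mem_image_of_mem _ (mem_union_left _ hz)
  have himgC : (X.colE L.M emb).image σ ⊆ (X.colE L.M (emb ∪ K)).image σ' := by
    intro u hu
    obtain ⟨z, hz, rfl⟩ := mem_image.1 hu
    rw [← h2 z hz]; exact mem_image_of_mem _ (X.colE_mono _ subset_union_left hz)
  have hP2 : ∀ z ∈ K, L.Pool2 P1 z = P1 (X.side z) := fun z hz => if_pos (mem_union_right _ (hKO z hz))
  have hP0 : ∀ z ∈ K, φ' z ∉ P0 (X.side z) := by
    intro z hz
    have := (h6 z hz).1
    rw [hPD] at this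
    split_ifs at this with hc
    · exact (mem_outV.1 this).2.1
    · rw [hP2 z hz] at this
      exact disjoint_right.1 (hG.p01 _) this
  have hG' : L.Good p C0 C1 P0 P1 (emb ∪ K) φ' σ' := by
    apply hG.ext subset_union_left hag h2 h3 h4 hI'
    · rw [disjoint_union_right]; exact ⟨hG.buf, hBK⟩
    · intro b z hz hze
      have hzK : z ∈ K := by rw [mem_union] at hz; tauto
      exact hG.p0d hN (h3.mem z hz) (hP0 z hzK)
    · intro e he hne
      have he' := mem_sdiff.2 ⟨he, hne⟩
      have h9 := (h8 e he').1
      rw [hTD] at h9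
      split_ifs at h9 with hc
      · exact (mem_outC.1 h9).2.1
      · have het := X.newE_sub _ _ _ he'
        rw [X.mem_tch] at het
        obtain ⟨z, hze, hzK⟩ := het.2
        have e1 : L.Ty2 C1 e = C1 := if_pos ⟨z, hze, by
          unfold Sp; exact mem_union_right _ (hKO z hzK)⟩
        rw [e1] at h9
        exact disjoint_right.1 hG.c01 h9
  have hoV : ∀ b, outV X P0 P1 (emb ∪ K) φ' b ⊆ outV X P0 P1 emb φ b := by
    intro b u hu
    rw [mem_outV] at hu ⊢
    exact ⟨hu.1, hu.2.1, hu.2.2.1, fun hh => hu.2.2.2 (himg hh)⟩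
  have hoC : outC L C0 C1 (emb ∪ K) σ' ⊆ outC L C0 C1 emb σ := by
    intro u hu
    rw [mem_outC] at hu ⊢
    exact ⟨hu.1, hu.2.1, hu.2.2.1, fun hh => hu.2.2.2 (himgC hh)⟩
  refine ⟨φ', σ', hG', ?_, ?_, ?_, ?_⟩
  · intro b u hu hu0 hu1 hu2
    exact h.cl b u hu hu0 hu1 (fun hh => hu2 (himg hh))
  · intro c hc hc0 hc1 hc2
    exact h.clc c hc hc0 hc1 (fun hh => hc2 (himgC hh))
  · intro b
    by_cases hq : (outV X P0 P1 (emb ∪ K) φ' b).card < p.q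
    · exact Or.inr hq
    left
    have hq' : p.q ≤ (outV X P0 P1 emb φ b).card := by
      have := card_le_card (hoV b); omega
    have hA := (h.dv b).resolve_right (by omega)
    intro z hz hzP
    by_cases hze : z ∈ emb
    · rw [hag z hze] at hzP
      exact hA z hze hzP
    · have hzK : z ∈ K := by rw [mem_union] at hz; tauto
      have hb : X.side z = b := by
        have e1 := hG'.vs.mem z hz
        have e2 := hG.p1 b hzP
        by_contra hne
        have hpd := hN.pd
        rw [disjoint_left] at hpd
        cases b <;> cases h : X.side z <;> simp_all
      by_contra hcon
      push Not at hcon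
      have := (h6 z hzK).1
      rw [hPD, if_pos ⟨hzK, fun y hy hzy => hcon y hy hzy.symm, by rw [hb]; exact hq'⟩, hb] at this
      exact (mem_outV.1 this).2.2.1 hzP
  · by_cases hq : (outC L C0 C1 (emb ∪ K) σ').card < p.q
    · exact Or.inr hq
    left
    have hq' : p.q ≤ (outC L C0 C1 emb σ).card := by
      have := card_le_card hoC; omega
    have hA := h.dc.resolve_right (by omega)
    intro e he heC
    by_cases hee : e ∈ X.colE L.M emb
    · rw [h2 e hee] at heC
      exact hA e hee heC
    · have he' := mem_sdiff.2 ⟨he, hee⟩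
      have h9 := (h8 e he').1
      rw [hTD] at h9
      split_ifs at h9 with hc
      · exact absurd heC (mem_outC.1 h9).2.2.1
      · have hc' : ¬ ∀ z ∈ e, z ∈ K := fun hh => hc ⟨hh, hq'⟩
        push Not at hc'
        obtain ⟨y, hy, hyK⟩ := hc'
        have hye : y ∈ emb := by
          have := (X.mem_colE.1 he).2.2 y hy
          rw [mem_union] at this; tauto
        have het := X.newE_sub _ _ _ he'
        rw [X.mem_tch] at het
        obtain ⟨z, hze, hzK⟩ := het.2
        refine ⟨y, hy, hnQ z hzK y hye ?_⟩
        have hzy : z ≠ y := by rintro rfl; exact hyK hzK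
        have : e = s(z, y) := (Sym2.mem_and_mem_iff hzy).1 ⟨hze, hy⟩
        have h0 := het.1
        rw [this] at h0
        exact h0

theorem phaseD [Nonempty V] (hN : L.Num p) :
    ∃ (C0 C1 : Finset V) (P0 P1 : Bool → Finset V) (φ : W → V) (σ : Sym2 W → V),
      DState L p C0 C1 P0 P1 (univ \ (L.Lt ∪ L.BF)) φ σ := by
  obtain ⟨C0, C1, P0, P1, φ0, σ0, hG, hP, hC, hcl, hclc⟩ := phaseC hN
  refine ⟨C0, C1, P0, P1, ?_⟩
  have key : ∀ t, ∃ φ σ, DState L p C0 C1 P0 P1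
      (((L.S ∪ L.Q) \ (L.Lt ∪ L.BF)) ∪ L.Out.filter (fun z => L.lab z < t)) φ σ := by
    intro t
    induction t with
    | zero =>
      have : L.Out.filter (fun z => L.lab z < 0) = ∅ := by simp
      rw [this, union_empty]
      exact ⟨φ0, σ0, hG, hcl, hclc, fun b => Or.inl fun z hz h => absurd h (hP b z hz),
        Or.inl fun e he h => absurd h (hC e he)⟩
    | succ t ih =>
      obtain ⟨φ, σ, h⟩ := ih
      obtain ⟨φ', σ', h'⟩ := h.step hN t rfl
      refine ⟨φ', σ', ?_⟩
      convert h' using 1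
      ext z
      simp only [mem_union, mem_filter]
      constructor
      · rintro (hz | hz)
        · tauto
        · rcases Nat.lt_succ_iff_lt_or_eq.1 hz.2 with h1 | h1 <;> tauto
      · rintro ((hz | hz) | hz)
        · tauto
        · exact Or.inr ⟨hz.1, by omega⟩
        · exact Or.inr ⟨hz.1, by omega⟩
  obtain ⟨φ, σ, h⟩ := key L.gl
  refine ⟨φ, σ, ?_⟩
  convert h using 1
  ext z
  have h1 := L.hgl z
  have h2 : z ∈ L.Lt → z ∈ L.S := fun h => L.Lt_S h
  have h3 : z ∈ L.BF → z ∈ L.S := fun h => L.BF_S h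
  simp only [mem_union, mem_filter, mem_sdiff, L.mem_Out, mem_univ, true_and]
  tauto

end Lay
end Ctx
end BU

namespace BU
namespace Ctx
namespace Lay

variable {V W : Type} [Fintype W] {X : Ctx V W} {L : X.Lay}
variable {p : Par} {C0 C1 : Finset V} {P0 P1 : Bool → Finset V} {emb : Finset W}
    {φ : W → V} {σ : Sym2 W → V}

theorem Lt_BF {z} (h : z ∈ L.Lt) : z ∉ L.BF := by
  obtain ⟨o, ho⟩ := L.Lt_Zn.1 h
  exact Zn0_BF (by decide) ho

theorem DState.fewV (h : DState L p C0 C1 P0 P1 (univ \ (L.Lt ∪ L.BF)) φ σ) (hN : L.Num p) (b : Bool) :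
    (outV X P0 P1 (univ \ (L.Lt ∪ L.BF)) φ b).card < p.q := by
  rcases h.dv b with h1 | h1
  swap
  · exact h1
  have e1 := dvA hN h1
  have e2 := h.good.cntV hN b
  have e3 := hN.ls1
  have e4 := hN.qpos
  have e5 := hN.cardLt
  have e6 : (X.P b).card ≤ ((univ \ (L.Lt ∪ L.BF)).filter (fun z => X.side z = b)).card + L.Lt.card + (L.Bf b).card := by
    rw [← hN.sidec b]
    refine le_trans (card_le_card ?_) ((card_union_le _ _).trans (Nat.add_le_add_right (card_union_le _ _) _))
    intro z hz
    rw [mem_filter] at hz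
    by_cases h1 : z ∈ L.Bf b
    · exact mem_union_right _ h1
    apply mem_union_left
    by_cases h2 : z ∈ L.Lt
    · exact mem_union_right _ h2
    apply mem_union_left
    simp only [mem_filter, mem_sdiff, mem_univ, mem_union, true_and]
    refine ⟨?_, hz.2⟩
    rintro (h3 | h3)
    · exact h2 h3
    · obtain ⟨b', hb'⟩ := L.mem_BF.1 h3
      have := L.side_Bf hb'
      rw [hz.2] at this
      subst this
      exact h1 hb'
  rw [L.card_Bf, hN.cardB] at e6
  omega

theorem card_BF (hN : L.Num p) : L.BF.card ≤ 2 * p.m := by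
  refine (card_union_le _ _).trans ?_
  rw [L.card_Bf, L.card_Bf, hN.cardB, hN.cardB]
  omega

theorem edge_total (hN : L.Num p) (A : Finset W) :
    X.C.card ≤ (X.colE L.M (univ \ A)).card + p.m3 + X.Δ * A.card := by
  rw [← hN.edgec, ← hN.cardI0, ← L.card_M]
  refine le_trans (card_le_card (t := X.colE L.M (univ \ A) ∪ L.M ∪ X.tch A) ?_)
    ((card_union_le _ _).trans (Nat.add_le_add (card_union_le _ _) (X.card_tch _)))
  intro e he
  rw [mem_filter] at he
  by_cases h1 : ∃ z ∈ e, z ∈ A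
  · exact mem_union_right _ (X.mem_tch.2 ⟨he.2, h1⟩)
  apply mem_union_left
  by_cases h2 : e ∈ L.M
  · exact mem_union_right _ h2
  · apply mem_union_left
    rw [X.mem_colE]
    refine ⟨he.2, h2, fun z hz => ?_⟩
    simp only [mem_sdiff, mem_univ, true_and]
    exact fun hzA => h1 ⟨z, hz, hzA⟩

theorem DState.fewC (h : DState L p C0 C1 P0 P1 (univ \ (L.Lt ∪ L.BF)) φ σ) (hN : L.Num p) :
    (outC L C0 C1 (univ \ (L.Lt ∪ L.BF)) σ).card < p.q := by
  rcases h.dc with h1 | h1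
  swap
  · exact h1
  have e1 := dcA hN h1
  have e2 := h.good.cntC
  have e3 := hN.ls2
  have e4 := hN.qpos
  have e5 := hN.cardLt
  have e6 := edge_total hN (L.Lt ∪ L.BF)
  have e7 : X.Δ * (L.Lt ∪ L.BF).card ≤ X.Δ * (p.lam + 2 * p.m) :=
    Nat.mul_le_mul_left _ ((card_union_le _ _).trans (Nat.add_le_add e5 (card_BF hN)))
  omega

set_option maxHeartbeats 1000000 in
theorem coverLate (hN : L.Num p) (b : Bool) (hG : L.Good p C0 C1 P0 P1 emb φ σ)
    (hcl : Clean (X := X) C1 P0 P1 emb φ) (hz : ∀ z ∈ L.Zn 2 (some b) 2, z ∉ emb)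
    (hfew : (outV X P0 P1 emb φ b).card < p.q) :
    ∃ (φ' : W → V) (I' : Finset W), I' ⊆ L.Zn 2 (some b) 0 ∧
      (∀ z ∈ emb, φ' z = φ z) ∧
      L.Good p C0 C1 P0 P1 (emb ∪ I') φ' σ ∧ Clean (X := X) C1 P0 P1 (emb ∪ I') φ' ∧
      X.colE L.M (emb ∪ I') = X.colE L.M emb ∧
      outV X P0 P1 (emb ∪ I') φ' b = ∅ ∧ outV X P0 P1 (emb ∪ I') φ' (!b) = outV X P0 P1 emb φ (!b) ∧
      ∀ b', (P1 b').filter (· ∈ (emb ∪ I').image φ') = (P1 b').filter (· ∈ emb.image φ) := by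
  obtain ⟨Z, hZdef⟩ : ∃ Z, Z = outV X P0 P1 emb φ b := ⟨_, rfl⟩
  have hZm : ∀ u, u ∈ Z ↔ u ∈ X.P b ∧ u ∉ P0 b ∧ u ∉ P1 b ∧ u ∉ emb.image φ := by
    intro u; rw [hZdef, mem_outV]
  have hLt : ∀ k ≤ 2, ∀ z ∈ L.Zn 2 (some b) k, z ∈ L.Lt := fun k hk z hz =>
    L.Lt_Zn.2 ⟨_, L.Zn_mono _ _ hk hz⟩
  obtain ⟨φ', I', h1, h2, h3, h4, h5, h6⟩ := hG.coverV hN 2 (by decide) b hz Z (fun u hu => ((hZm u).1 hu).1)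
    (disjoint_left.2 fun u hu => ((hZm u).1 hu).2.2.2) (disjoint_left.2 fun u hu => ((hZm u).1 hu).2.1)
    (by rw [hZdef]; exact hfew.le.trans (hN.cardL _)) (by
      intro u hu x hx y hy hys
      have e1 : L.Pool2 P1 y = P1 (!b) := by
        rw [← hys]; exact if_pos (mem_union_left _ (hLt 1 (by norm_num) y hy))
      have e2 : L.Ty2 C1 s(y, x) = C1 := if_pos ⟨x, by simp, by
        unfold Sp; exact mem_union_left _ (mem_union_right _ (hLt 0 (by norm_num) x hx))⟩
      rw [e1, e2]
      obtain ⟨a1, a2, a3, a4⟩ := (hZm u).1 hu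
      exact hcl b u a1 a2 a3 a4)
  have hag : ∀ z ∈ emb, φ' z = φ z := fun z hz' => h3 z fun hI => hz z (L.Zn_mono _ _ (by norm_num) (h1 hI)) hz'
  have himg : (emb ∪ I').image φ' = emb.image φ ∪ Z := by
    rw [image_union, h5, image_congr (g := φ) (fun z hz => hag z hz)]
  refine ⟨φ', I', h1, hag, h4, ?_, h6, ?_, ?_, ?_⟩
  · intro b' u hu hu0 hu1 hu2
    rw [himg, mem_union] at hu2
    exact hcl b' u hu hu0 hu1 (by tauto)
  · ext u
    have := hZm u
    rw [mem_outV, himg, mem_union]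
    simp only [notMem_empty, iff_false]
    tauto
  · ext u
    rw [mem_outV, mem_outV, himg, mem_union]
    have : u ∈ X.P (!b) → u ∉ Z := by
      intro hu hz
      have h0 := ((hZm u).1 hz).1
      have hpd := hN.pd
      rw [disjoint_left] at hpd
      cases b
      · exact hpd hu h0
      · exact hpd h0 hu
    tauto
  · intro b'
    apply filter_congr
    intro u hu
    rw [himg, mem_union]
    have : u ∉ Z := by
      intro hz
      have h0 := (hZm u).1 hz
      have hbb : b' ≠ b := by rintro rfl; exact h0.2.2.1 hu
      have hpd := hN.pd
      rw [disjoint_left] at hpd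
      have hub := hG.p1 _ hu
      cases b <;> cases b' <;> simp_all
    tauto

set_option maxHeartbeats 1000000 in
theorem phaseE [Nonempty V] (hN : L.Num p) :
    ∃ (C0 C1 : Finset V) (P0 P1 : Bool → Finset V) (φ : W → V) (σ : Sym2 W → V),
      L.Good p C0 C1 P0 P1 (univ \ L.BF) φ σ ∧ (∀ b, outV X P0 P1 (univ \ L.BF) φ b = ∅) ∧
      outC L C0 C1 (univ \ L.BF) σ = ∅ := by
  obtain ⟨C0, C1, P0, P1, φ0, σ0, h0⟩ := phaseD (L := L) hN
  refine ⟨C0, C1, P0, P1, ?_⟩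
  have hu := h0.useV hN
  have huC := h0.useC hN
  have hfV := h0.fewV hN
  have hfC := h0.fewC hN
  obtain ⟨emb, hemb⟩ : ∃ emb, emb = (univ : Finset W) \ (L.Lt ∪ L.BF) := ⟨_, rfl⟩
  rw [← hemb] at h0 hu huC hfC
  simp only [← hemb] at hfV
  have hLe : ∀ o, ∀ z ∈ L.Zn 2 o 2, z ∉ emb := by
    intro o z hz
    rw [hemb]
    simp only [mem_sdiff, mem_union, not_and, not_not]
    exact fun _ => Or.inl (L.Lt_Zn.2 ⟨o, hz⟩)
  obtain ⟨φ1, I1, a1, a2, a3, a4, a5, a6, a7, a8⟩ := coverLate hN true h0.good h0.cl (hLe _) (hfV _)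
  obtain ⟨φ2, I2, b1, b2, b3, b4, b5, b6, b7, b8⟩ := coverLate hN false a3 a4 (by
    intro z hz hz'
    rcases mem_union.1 hz' with hz' | hz'
    · exact hLe _ z hz hz'
    · have := (zone_disj hz (by norm_num) (a1 hz') (by norm_num)).2
      simp at this) (by
    have : (!true) = false := rfl
    rw [this] at a7
    rw [a7]; exact hfV _)
  have hbt : (!false) = true := rfl
  rw [hbt, a6] at b7
  obtain ⟨emb2, he2⟩ : ∃ emb2, emb2 = emb ∪ I1 ∪ I2 := ⟨_, rfl⟩
  rw [← he2] at b3 b4 b5 b6 b7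
  simp only [← he2] at b8
  rw [a5] at b5
  have hout2 : ∀ b, outV X P0 P1 emb2 φ2 b = ∅ := by intro b; cases b <;> assumption
  have hu2 : ∀ b, ((P1 b).filter (· ∈ emb2.image φ2)).card ≤ X.Δ * p.x0 + p.s + p.q := by
    intro b; rw [b8, a8]; exact hu b
  obtain ⟨Z, hZdef⟩ : ∃ Z, Z = outC L C0 C1 emb σ0 := ⟨_, rfl⟩
  have hZm : ∀ u, u ∈ Z ↔ u ∈ X.C ∧ u ∉ C0 ∧ u ∉ C1 ∧ u ∉ (X.colE L.M emb).image σ0 := by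
    intro u; rw [hZdef, mem_outC]
  have hp1 : ∀ b, ((P1 b).card : ℝ) = ((p.l + p.s : ℕ) : ℝ) := fun b => by rw [h0.good.p1c b]
  obtain ⟨Bd, hBd1, hBd2⟩ : ∃ Bd : ℝ, (∀ b, ((X.Δ * p.x0 + p.s + p.q + p.lam + 2 * p.q + 1 : ℕ) : ℝ) +
      X.Δ * X.ε * (X.P b).card ≤ Bd) ∧ 2 * Bd < X.θ * ((p.l + p.s : ℕ) : ℝ) := by
    have e1 := hN.el3 true
    have e2 := hN.el3 false
    refine ⟨max (((X.Δ * p.x0 + p.s + p.q + p.lam + 2 * p.q + 1 : ℕ) : ℝ) + X.Δ * X.ε * (X.P true).card)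
      (((X.Δ * p.x0 + p.s + p.q + p.lam + 2 * p.q + 1 : ℕ) : ℝ) + X.Δ * X.ε * (X.P false).card), ?_, ?_⟩
    · intro b; cases b
      · exact le_max_right _ _
      · exact le_max_left _ _
    · rcases max_choice (((X.Δ * p.x0 + p.s + p.q + p.lam + 2 * p.q + 1 : ℕ) : ℝ) + X.Δ * X.ε * (X.P true).card)
        (((X.Δ * p.x0 + p.s + p.q + p.lam + 2 * p.q + 1 : ℕ) : ℝ) + X.Δ * X.ε * (X.P false).card) with h | h <;>
      rw [h] <;> assumption
  have hls : 0 < ((p.l + p.s : ℕ) : ℝ) := by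
    have e1 := hBd1 true
    have e3 : 0 ≤ X.Δ * X.ε * (X.P true).card := by have := X.hε; positivity
    have e4 : (0 : ℝ) ≤ ((X.Δ * p.x0 + p.s + p.q + p.lam + 2 * p.q + 1 : ℕ) : ℝ) := by positivity
    have e5 : 0 < X.θ * ((p.l + p.s : ℕ) : ℝ) := by
      have : 0 < Bd ∨ Bd = 0 := by
        rcases lt_or_eq_of_le (show 0 ≤ Bd by linarith) with h | h
        · exact Or.inl h
        · exact Or.inr h.symm
      rcases this with h | h <;> linarith
    exact pos_of_mul_pos_right e5 X.hθ.le
  obtain ⟨φ3, σ3, K, c1, c2, c3, c4, c5, c6⟩ := b3.coverC hN 2 (by decide) (by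
      intro z hz hz'
      rw [he2] at hz'
      rcases mem_union.1 hz' with hz' | hz'
      · rcases mem_union.1 hz' with hz' | hz'
        · exact hLe _ z (L.Zn_mono _ _ (by norm_num) hz) hz'
        · have := (zone_disj hz (by norm_num) (a1 hz') (by norm_num)).2
          simp at this
      · have := (zone_disj hz (by norm_num) (b1 hz') (by norm_num)).2
        simp at this) P1 h0.good.p1 ∅ (fun b u hu _ => disjoint_right.1 (h0.good.p01 b) hu) Bd p.q (by
      intro b
      have e1 := hBd1 b
      have e2 : (((P1 b).filter (· ∈ emb2.image φ2)).card : ℝ) ≤ ((X.Δ * p.x0 + p.s + p.q : ℕ) : ℝ) := by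
        exact_mod_cast hu2 b
      simp only [notMem_empty, false_or]
      push_cast at e1 e2 ⊢
      have : (0 : ℝ) ≤ p.lam := by positivity
      linarith) Z (fun u hu => ((hZm u).1 hu).1)
      (by rw [b5]; exact disjoint_left.2 fun u hu => ((hZm u).1 hu).2.2.2)
      (disjoint_left.2 fun u hu => ((hZm u).1 hu).2.1)
      (by rw [hZdef]; exact hfC.le.trans (hN.cardL _)) (by rw [hZdef]; exact hfC.le) (by
      intro c hc
      obtain ⟨d1, d2, d3, d4⟩ := (hZm c).1 hc
      have := h0.clc c d1 d2 d3 d4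
      refine lt_of_lt_of_le ?_ this
      rw [hp1, hp1]
      have := mul_lt_mul_of_pos_right hBd2 hls
      linarith)
  obtain ⟨emb3, he3⟩ : ∃ emb3, emb3 = emb2 ∪ K := ⟨_, rfl⟩
  rw [← he3] at c4 c6
  rw [b5] at c6
  have hKL : K ⊆ L.Lt := fun z hz => L.Lt_Zn.2 ⟨_, L.Zn_mono _ _ (by norm_num) (c1 hz)⟩
  have hK2 : ∀ z ∈ emb2, φ3 z = φ2 z := by
    intro z hz
    apply c2
    intro hK
    rw [he2] at hz
    rcases mem_union.1 hz with hz' | hz'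
    · rcases mem_union.1 hz' with hz' | hz'
      · exact hLe _ z (L.Zn_mono _ _ (by norm_num) (c1 hK)) hz'
      · have := (zone_disj (c1 hK) (by norm_num) (a1 hz') (by norm_num)).2
        simp at this
    · have := (zone_disj (c1 hK) (by norm_num) (b1 hz') (by norm_num)).2
      simp at this
  have himg3 : emb3.image φ3 = emb2.image φ2 ∪ K.image φ3 := by
    rw [he3, image_union, image_congr (g := φ2) (fun z hz => hK2 z hz)]
  have hu3 : ∀ b, ((P1 b).filter (· ∈ emb3.image φ3)).card ≤ X.Δ * p.x0 + p.s + p.q + p.lam := by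
    intro b
    have : (P1 b).filter (· ∈ emb3.image φ3) ⊆ (P1 b).filter (· ∈ emb2.image φ2) ∪ K.image φ3 := by
      intro u hu
      rw [mem_filter, himg3, mem_union] at hu
      rw [mem_union, mem_filter]
      tauto
    refine (card_le_card this).trans ((card_union_le _ _).trans (Nat.add_le_add (hu2 b) ?_))
    exact card_image_le.trans ((card_le_card hKL).trans hN.cardLt)
  have huC3 : (C1.filter (· ∈ (X.colE L.M emb3).image σ3)).card ≤ X.Δ * p.x0 + p.s3 + p.q := by
    refine le_trans (card_le_card ?_) huC
    intro c hc
    rw [mem_filter, c6, mem_union] at hc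
    rw [mem_filter]
    refine ⟨hc.1, hc.2.resolve_right fun h => ((hZm c).1 h).2.2.1 hc.1⟩
  have hKt : ∀ z ∈ L.Lt \ emb3, L.Pool2 P1 z = P1 (X.side z) := fun z hz =>
    if_pos (mem_union_left _ (mem_sdiff.1 hz).1)
  have hTt : ∀ e ∈ X.colE L.M (emb3 ∪ L.Lt \ emb3) \ X.colE L.M emb3, L.Ty2 C1 e = C1 := by
    intro e he
    have het := X.newE_sub _ _ _ he
    rw [X.mem_tch] at het
    obtain ⟨z, hze, hzK⟩ := het.2
    refine if_pos ⟨z, hze, ?_⟩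
    unfold Sp
    exact mem_union_left _ (mem_union_right _ (mem_sdiff.1 hzK).1)
  obtain ⟨φ4, σ4, d1, d2, d3, d4, d5⟩ := c4.multi hN ∅ ∅ p.lam (L.Lt \ emb3)
    ((card_le_card sdiff_subset).trans hN.cardLt) sdiff_disjoint
    (disjoint_right.2 fun z hz => Lt_BF (mem_sdiff.1 hz).1)
    (fun z hz u hu _ => by
      rw [hKt z hz] at hu
      exact disjoint_right.1 (h0.good.p01 _) hu)
    (fun e he c hc _ => by
      rw [hTt e he] at hc
      exact disjoint_right.1 h0.good.c01 hc)
    (by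
      intro z hz
      rw [hKt z hz, h0.good.p1c]
      have e1 := hN.el1 (X.side z)
      have e2 : (((P1 (X.side z)).filter (· ∈ emb3.image φ3)).card : ℝ) ≤ ((X.Δ * p.x0 + p.s + p.q + p.lam : ℕ) : ℝ) := by
        exact_mod_cast hu3 _
      simp only [notMem_empty, false_or]
      push_cast at e1 e2 ⊢
      linarith)
    (by
      intro e he
      rw [hTt e he, h0.good.c1c]
      have e1 := hN.el2
      have e2 : ((C1.filter (· ∈ (X.colE L.M emb3).image σ3)).card : ℝ) ≤ ((X.Δ * p.x0 + p.s3 + p.q : ℕ) : ℝ) := by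
        exact_mod_cast huC3
      simp only [notMem_empty, false_or]
      push_cast at e1 e2 ⊢
      have : (0 : ℝ) ≤ X.Δ * p.lam := by positivity
      linarith)
  have hfin : emb3 ∪ L.Lt \ emb3 = univ \ L.BF := by
    ext z
    constructor
    · intro hz
      rw [mem_sdiff]
      exact ⟨mem_univ _, disjoint_right.1 d3.buf hz⟩
    · intro hz
      by_cases hl : z ∈ L.Lt
      · simp only [mem_union, mem_sdiff]; tauto
      · apply mem_union_left
        rw [he3, he2, hemb]
        apply mem_union_left; apply mem_union_left; apply mem_union_left
        simp only [mem_sdiff, mem_univ, mem_union, true_and] at hz ⊢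
        tauto
  rw [hfin] at d3
  refine ⟨φ4, σ4, d3, ?_, ?_⟩
  · intro b
    rw [eq_empty_iff_forall_notMem]
    intro u hu
    rw [mem_outV] at hu
    have : u ∈ outV X P0 P1 emb2 φ2 b := by
      rw [mem_outV]
      refine ⟨hu.1, hu.2.1, hu.2.2.1, fun hh => hu.2.2.2 ?_⟩
      obtain ⟨z, hz, rfl⟩ := mem_image.1 hh
      have hz3 : z ∈ emb3 := by rw [he3]; exact mem_union_left _ hz
      rw [← hK2 z hz, ← d1 z (fun hh => (mem_sdiff.1 hh).2 hz3), ← hfin]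
      exact mem_image_of_mem _ (mem_union_left _ hz3)
    rw [hout2] at this
    exact notMem_empty _ this
  · rw [eq_empty_iff_forall_notMem]
    intro c hc
    rw [mem_outC] at hc
    apply hc.2.2.2
    have : c ∈ (X.colE L.M emb3).image σ3 := by
      rw [c6, mem_union]
      by_cases hh : c ∈ (X.colE L.M emb).image σ0
      · exact Or.inl hh
      · exact Or.inr ((hZm c).2 ⟨hc.1, hc.2.1, hc.2.2.1, hh⟩)
    obtain ⟨e, he, rfl⟩ := mem_image.1 this
    rw [← d2 e he, ← hfin]
    exact mem_image_of_mem _ (X.colE_mono _ subset_union_left he)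

end Lay
end Ctx
end BU

namespace BU
namespace Ctx
namespace Lay

variable {V W : Type} [Fintype W] {X : Ctx V W} {L : X.Lay}
variable {p : Par}

theorem side_total (hN : L.Num p) (b : Bool) :
    ((univ \ L.BF).filter (fun z => X.side z = b)).card + p.m = (X.P b).card := by
  apply le_antisymm (sideLe hN disjoint_sdiff b)
  rw [← hN.sidec b, ← hN.cardB b, ← L.card_Bf b]
  refine le_trans (card_le_card ?_) (card_union_le _ _)
  intro z hz
  rw [mem_filter] at hz
  by_cases h1 : z ∈ L.Bf b
  · exact mem_union_right _ h1
  apply mem_union_left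
  simp only [mem_filter, mem_sdiff, mem_univ, true_and]
  refine ⟨?_, hz.2⟩
  intro h3
  obtain ⟨b', hb'⟩ := L.mem_BF.1 h3
  have := L.side_Bf hb'
  rw [hz.2] at this
  subst this
  exact h1 hb'

theorem col_total (hN : L.Num p) : (X.colE L.M univ).card + p.m3 = X.C.card := by
  apply le_antisymm (colLe hN _)
  have := edge_total hN ∅
  simpa using this

set_option maxHeartbeats 1000000 in
theorem phaseF [Nonempty V] (hN : L.Num p) :
    ∃ (φ : W → V) (σ : Sym2 W → V), Function.Injective φ ∧ (∀ z, φ z ∈ X.P (X.side z)) ∧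
      Set.InjOn σ X.H.edgeSet ∧ (∀ e ∈ X.H.edgeSet, σ e ∈ X.C) ∧
      ∀ x y, X.H.Adj x y → X.T (φ x) (φ y) (σ s(x, y)) := by
  obtain ⟨C0, C1, P0, P1, φ0, σ0, hG, hoV, hoC⟩ := phaseE (L := L) hN
  obtain ⟨emb, hemb⟩ : ∃ emb, emb = univ \ L.BF := ⟨_, rfl⟩
  rw [← hemb] at hG hoC
  simp only [← hemb] at hoV
  have hme : ∀ z, z ∈ emb ↔ z ∉ L.BF := by intro z; rw [hemb]; simp
  -- free vertices
  have hfree : ∀ b, ((P1 b).filter (fun u => u ∉ emb.image φ0)).card = p.l := by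
    intro b
    have e1 := hG.cntV hN b
    have e2 := side_total hN b
    rw [← hemb] at e2
    have e3 := card_filter_add_card_filter_not (s := P1 b) (fun u => u ∈ emb.image φ0)
    have e4 := hG.p1c b
    rw [hoV b] at e1
    simp only [card_empty] at e1
    omega
  choose f hf1 hf2 hf3 using fun b => hG.absV b _ (filter_subset _ _) (hfree b)
  obtain ⟨φ, hφ⟩ : ∃ φ : W → V, ∀ z, φ z = if z ∈ L.BF then f (X.side z) z else φ0 z := ⟨_, fun _ => rfl⟩
  have hφe : ∀ z ∈ emb, φ z = φ0 z := fun z hz => by rw [hφ, if_neg ((hme z).1 hz)]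
  have hφB : ∀ b, ∀ z ∈ L.Bf b, φ z = f b z := fun b z hz => by
    rw [hφ, if_pos (L.mem_BF.2 ⟨b, hz⟩), L.side_Bf hz]
  have hBB : ∀ z ∈ L.BF, z ∈ L.Bf (X.side z) := by
    intro z hz
    obtain ⟨b, hb⟩ := L.mem_BF.1 hz
    rw [L.side_Bf hb]; exact hb
  have himgB : ∀ z ∈ L.BF, φ z ∈ P0 (X.side z) ∪ (P1 (X.side z)).filter (fun u => u ∉ emb.image φ0) := by
    intro z hz
    rw [hφB _ z (hBB z hz), ← hf2]
    exact mem_image_of_mem _ (hBB z hz)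
  have hmem : ∀ z, φ z ∈ X.P (X.side z) := by
    intro z
    by_cases hz : z ∈ L.BF
    · rcases mem_union.1 (himgB z hz) with h | h
      · exact hG.p0 _ h
      · exact hG.p1 _ (mem_filter.1 h).1
    · rw [hφe z ((hme z).2 hz)]
      exact hG.vs.mem z ((hme z).2 hz)
  have hBemb : ∀ z ∈ L.BF, ∀ y ∈ emb, φ z ≠ φ y := by
    intro z hz y hy h
    have h1 := himgB z hz
    rw [h, hφe y hy] at h1
    rcases mem_union.1 h1 with h | h
    · exact hG.p0u _ y hy h
    · exact (mem_filter.1 h).2 (mem_image_of_mem _ hy)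
  have hinj : Function.Injective φ := by
    intro x y hxy
    by_cases hx : x ∈ L.BF
    · by_cases hy : y ∈ L.BF
      · have hs : X.side x = X.side y := by
          have h1 := hmem x
          have h2 := hmem y
          rw [hxy] at h1
          have hpd := hN.pd
          rw [disjoint_left] at hpd
          by_contra hne
          cases hsx : X.side x <;> cases hsy : X.side y <;> simp_all
        have hx' := hBB x hx
        have hy' := hBB y hy
        rw [hs] at hx'
        rw [hφB _ x hx', hφB _ y hy'] at hxy
        exact hf1 _ hx' hy' hxy
      · exact absurd hxy (hBemb x hx y ((hme y).2 hy))
    · by_cases hy : y ∈ L.BF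
      · exact absurd hxy.symm (hBemb y hy x ((hme x).2 hx))
      · have hx' := (hme x).2 hx
        have hy' := (hme y).2 hy
        rw [hφe x hx', hφe y hy'] at hxy
        exact hG.vs.inj hx' hy' hxy
  have hthick : ∀ z ∈ L.BF, ∀ y, X.H.Adj z y → X.thick C1 (φ z) (φ y) := by
    intro z hz y hzy
    have hy : y ∈ emb := hG.early (mem_union_right _ (L.nb_BF hz hzy))
    rw [hφe y hy, hφB _ z (hBB z hz)]
    exact hf3 _ z (hBB z hz) y hzy
  -- colours
  have hC0 : X.CS (X.colE L.M emb) φ σ0 := by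
    apply CS.congr X hG.cs
    intro e he z hz
    exact hφe z ((X.mem_colE.1 he).2.2 z hz)
  have hsub : X.colE L.M emb ⊆ X.colE L.M univ := X.colE_mono _ (subset_univ _)
  have hcnt : (X.colE L.M univ \ X.colE L.M emb).card + (C1.filter (· ∈ (X.colE L.M emb).image σ0)).card = p.s3 := by
    have e1 := hG.cntC
    have e2 := col_total (L := L) hN
    have e3 := card_sdiff_add_card_eq_card hsub
    rw [hoC] at e1
    simp only [card_empty] at e1
    omega
  obtain ⟨σ1, hs1, hs2, hs3⟩ := X.colour_ext hC0 hsub (fun e => C1.filter (fun c => X.Tc φ e c)) (by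
    intro e he
    refine ⟨(filter_subset _ _).trans hG.c1, fun c hc => (mem_filter.1 hc).2, ?_⟩
    have hth : X.θ * (C1.card : ℝ) ≤ (C1.filter (fun c => X.Tc φ e c)).card := by
      rw [mem_sdiff, X.mem_colE, X.mem_colE] at he
      have : ∃ z ∈ e, z ∉ emb := by
        by_contra hcon
        push Not at hcon
        exact he.2 ⟨he.1.1, he.1.2.1, hcon⟩
      obtain ⟨z, hze, hz⟩ := this
      obtain ⟨y, rfl⟩ := hze
      have hzB : z ∈ L.BF := by by_contra h; exact hz ((hme z).2 h)
      have := hthick z hzB y he.1.1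
      unfold thick at this
      simpa only [X.Tc_mk] using this
    have e1 : ((C1.filter (fun c => X.Tc φ e c)).filter (fun c => c ∈ (X.colE L.M emb).image σ0)).card ≤
        (C1.filter (· ∈ (X.colE L.M emb).image σ0)).card := by
      apply card_le_card
      intro c hc
      rw [mem_filter, mem_filter] at hc
      exact mem_filter.2 ⟨hc.1.1, hc.2⟩
    have e2 : ((X.colE L.M univ \ X.colE L.M emb).card : ℝ) + ((C1.filter (fun c => X.Tc φ e c)).filter
        (fun c => c ∈ (X.colE L.M emb).image σ0)).card ≤ p.s3 := by
      have : (X.colE L.M univ \ X.colE L.M emb).card + ((C1.filter (fun c => X.Tc φ e c)).filter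
        (fun c => c ∈ (X.colE L.M emb).image σ0)).card ≤ p.s3 := by omega
      exact_mod_cast this
    have e3 := hN.fn
    rw [← hG.c1c] at e3
    linarith)
  have hsigC : ∀ e ∈ X.colE L.M univ, σ1 e ∉ C0 := by
    intro e he
    by_cases h : e ∈ X.colE L.M emb
    · rw [hs1 e (fun hh => (mem_sdiff.1 hh).2 h)]
      exact hG.c0u e h
    · have := (mem_filter.1 (hs3 e (mem_sdiff.2 ⟨he, h⟩)).1).1
      exact disjoint_right.1 hG.c01 this
  have hUc : (C1.filter (fun c => c ∉ (X.colE L.M univ).image σ1)).card = p.l3 := by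
    have e1 : C0 ∪ (C1.filter (fun c => c ∉ (X.colE L.M univ).image σ1)) = X.C \ (X.colE L.M univ).image σ1 := by
      ext c
      simp only [mem_union, mem_filter, mem_sdiff]
      constructor
      · rintro (h | h)
        · refine ⟨hG.c0 h, fun hh => ?_⟩
          obtain ⟨e, he, rfl⟩ := mem_image.1 hh
          exact hsigC e he h
        · exact ⟨hG.c1 h.1, h.2⟩
      · rintro ⟨h1, h2⟩
        by_contra hcon
        push Not at hcon
        have : c ∈ outC L C0 C1 emb σ0 := by
          rw [mem_outC]
          refine ⟨h1, hcon.1, fun h => h2 (hcon.2 h), fun hh => h2 ?_⟩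
          obtain ⟨e, he, rfl⟩ := mem_image.1 hh
          rw [← hs1 e (fun hh => (mem_sdiff.1 hh).2 he)]
          exact mem_image_of_mem _ (hsub he)
        rw [hoC] at this
        exact notMem_empty _ this
    have e2 : (X.C \ (X.colE L.M univ).image σ1).card + ((X.colE L.M univ).image σ1).card = X.C.card := by
      apply card_sdiff_add_card_eq_card
      intro c hc
      obtain ⟨e, he, rfl⟩ := mem_image.1 hc
      exact hs2.mem e he
    have e3 : ((X.colE L.M univ).image σ1).card = (X.colE L.M univ).card := card_image_of_injOn hs2.inj
    have e4 := col_total (L := L) hN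
    rw [← e1, card_union_of_disjoint (disjoint_of_subset_right (filter_subset _ _) hG.c01)] at e2
    have e5 := hG.c0c
    omega
  obtain ⟨g, hg1, hg2, hg3⟩ := hG.absC _ (filter_subset _ _) hUc
  have hM : ∀ e, ∃ x, e ∈ L.M → x ∈ L.I 0 none ∧ s(x, L.mate x) = e := by
    intro e
    by_cases he : e ∈ L.M
    · obtain ⟨x, hx, hxe⟩ := mem_image.1 he
      exact ⟨x, fun _ => ⟨hx, hxe⟩⟩
    · exact ⟨e.out.1, fun h => absurd h he⟩
  choose r hr using hM
  obtain ⟨σ, hσ⟩ : ∃ σ : Sym2 W → V, ∀ e, σ e = if e ∈ L.M then g (r e) else σ1 e := ⟨_, fun _ => rfl⟩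
  have hgm : ∀ e ∈ L.M, σ e ∈ C0 ∪ C1.filter (fun c => c ∉ (X.colE L.M univ).image σ1) := by
    intro e he
    rw [hσ, if_pos he, ← hg2]
    exact mem_image_of_mem _ (hr e he).1
  have hcm : ∀ e ∈ X.H.edgeSet, e ∉ L.M → e ∈ X.colE L.M univ := fun e he h =>
    X.mem_colE.2 ⟨he, h, fun _ _ => mem_univ _⟩
  have hsep : ∀ e ∈ L.M, ∀ e' ∈ X.H.edgeSet, e' ∉ L.M → σ e ≠ σ e' := by
    intro e he e' he' hne h
    have h1 := hgm e he
    have h2 := hcm e' he' hne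
    rw [h, hσ e', if_neg hne] at h1
    rcases mem_union.1 h1 with h | h
    · exact hsigC e' h2 h
    · exact (mem_filter.1 h).2 (mem_image_of_mem _ h2)
  refine ⟨φ, σ, hinj, hmem, ?_, ?_, ?_⟩
  · intro e he e' he' h
    by_cases h1 : e ∈ L.M
    · by_cases h2 : e' ∈ L.M
      · rw [hσ, hσ e', if_pos h1, if_pos h2] at h
        have := hg1 (hr e h1).1 (hr e' h2).1 h
        rw [← (hr e h1).2, ← (hr e' h2).2, this]
      · exact absurd h (hsep e h1 e' he' h2)
    · by_cases h2 : e' ∈ L.M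
      · exact absurd h.symm (hsep e' h2 e he h1)
      · rw [hσ, hσ e', if_neg h1, if_neg h2] at h
        exact hs2.inj (hcm e he h1) (hcm e' he' h2) h
  · intro e he
    by_cases h1 : e ∈ L.M
    · rcases mem_union.1 (hgm e h1) with h | h
      · exact hG.c0 h
      · exact hG.c1 (mem_filter.1 h).1
    · rw [hσ, if_neg h1]
      exact hs2.mem e (hcm e he h1)
  · intro x y hxy
    rw [← X.Tc_mk]
    by_cases h1 : s(x, y) ∈ L.M
    · have h2 := hr _ h1
      have h3 := hg3 _ h2.1
      have hVM : ∀ w ∈ s(x, y), φ w = φ0 w := by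
        intro w hw
        exact hφe w (hG.early (mem_union_left _ ((L.M_edge h1).2 w hw)))
      rw [X.Tc_congr hVM, hσ, if_pos h1]
      nth_rewrite 1 [← h2.2]
      rw [X.Tc_mk]
      exact h3
    · rw [hσ, if_neg h1]
      exact hs2.col _ (hcm _ hxy h1)

end Lay
end Ctx
end BU

namespace BU

/-- Greedy independent set. -/
theorem greedy {W : Type} (Cd : Finset W) (N : W → Finset W) (B : ℕ) (hB : ∀ x, (N x).card ≤ B) (hB1 : 1 ≤ B)
    (hself : ∀ x, x ∈ N x) (hsymm : ∀ x y, y ∈ N x → x ∈ N y) (r : ℕ) (hr : r * B ≤ Cd.card) :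
    ∃ J ⊆ Cd, J.card = r ∧ ∀ x ∈ J, ∀ y ∈ J, y ∈ N x → x = y := by
  induction r with
  | zero => exact ⟨∅, by simp, by simp, by simp⟩
  | succ r ih =>
    rw [Nat.add_mul, one_mul] at hr
    obtain ⟨J, hJ, hJc, hJi⟩ := ih (by omega)
    have h1 : (J.biUnion N).card < Cd.card := by
      have := card_biUnion_le_card_mul J N B (fun x _ => hB x)
      rw [hJc] at this
      omega
    obtain ⟨x, hx, hxN⟩ := exists_mem_notMem_of_card_lt_card h1
    have hxN' : ∀ y ∈ J, x ∉ N y := fun y hy h => hxN (mem_biUnion.2 ⟨y, hy, h⟩)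
    have hxJ : x ∉ J := fun h => hxN' x h (hself x)
    refine ⟨insert x J, ?_, ?_, ?_⟩
    · intro y hy
      rcases mem_insert.1 hy with rfl | hy
      · exact hx
      · exact hJ hy
    · rw [card_insert_of_notMem hxJ, hJc]
    · intro a ha b hb hab
      rcases mem_insert.1 ha with ha' | ha'
      · rcases mem_insert.1 hb with hb' | hb'
        · rw [ha', hb']
        · rw [ha'] at hab
          exact absurd (hsymm _ _ hab) (hxN' b hb')
      · rcases mem_insert.1 hb with hb' | hb'
        · rw [hb'] at hab
          exact absurd hab (hxN' a ha')
        · exact hJi a ha' b hb' hab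

/-- splitting a set into pieces of given sizes -/
theorem split_sets {W κ : Type} [Fintype κ] [Nonempty W] (J : Finset W) (sz : κ → ℕ) (h : ∑ i, sz i ≤ J.card) :
    ∃ I : κ → Finset W, (∀ i, I i ⊆ J) ∧ (∀ i, (I i).card = sz i) ∧ ∀ i j x, x ∈ I i → x ∈ I j → i = j := by
  have : Fintype.card (Σ i, Fin (sz i)) ≤ Fintype.card J := by simpa using h
  obtain ⟨f⟩ := Function.Embedding.nonempty_of_card_le this
  refine ⟨fun i => (univ : Finset (Fin (sz i))).image (fun a => (f ⟨i, a⟩ : W)), ?_, ?_, ?_⟩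
  · intro i x hx
    obtain ⟨a, -, rfl⟩ := mem_image.1 hx
    exact (f ⟨i, a⟩).2
  · intro i
    rw [card_image_of_injective]
    · simp
    · intro a b hab
      have := f.injective (Subtype.ext hab)
      simpa using this
  · intro i j x hi hj
    obtain ⟨a, -, rfl⟩ := mem_image.1 hi
    obtain ⟨b, -, hb⟩ := mem_image.1 hj
    have := f.injective (Subtype.ext hb)
    exact (congrArg Sigma.fst this).symm

namespace Ctx

variable {V W : Type} [Fintype W] (X : Ctx V W)

theorem ball_ball (j : ℕ) (A A' : Finset W) (h : A' ⊆ X.ball j A) (k : ℕ) : X.ball k A' ⊆ X.ball (j + k) A := by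
  induction k with
  | zero => exact h
  | succ k ih =>
    intro z hz
    rcases mem_union.1 hz with hz | hz
    · exact X.ball_succ _ _ (ih hz)
    · obtain ⟨y, hy, hyz⟩ := mem_biUnion.1 hz
      exact X.ball_adj (ih hy) (X.mem_nb.1 hyz)

theorem ball_subset {A B : Finset W} (h : A ⊆ B) (k : ℕ) : X.ball k A ⊆ X.ball k B := by
  have := X.ball_ball 0 B A h k
  rwa [zero_add] at this

theorem ball_symm {k : ℕ} {x z : W} (h : z ∈ X.ball k {x}) : x ∈ X.ball k {z} := by
  induction k generalizing z with
  | zero => simpa [ball, eq_comm] using h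
  | succ k ih =>
    rcases mem_union.1 h with hz | hz
    · exact X.ball_succ _ _ (ih hz)
    · obtain ⟨y, hy, hyz⟩ := mem_biUnion.1 hz
      have h1 : ({y} : Finset W) ⊆ X.ball 1 {z} := by
        rw [singleton_subset_iff]
        exact X.ball_adj (k := 0) (by simp [ball]) (X.mem_nb.1 hyz).symm
      have := X.ball_ball 1 _ _ h1 k (ih hy)
      rwa [add_comm] at this

theorem ball_card (k : ℕ) (A : Finset W) : (X.ball k A).card ≤ (X.Δ + 1) ^ k * A.card := by
  induction k with
  | zero => simp [ball]
  | succ k ih =>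
    have h1 : (X.ball (k + 1) A).card ≤ (X.ball k A).card + (X.ball k A).card * X.Δ :=
      (card_union_le _ _).trans (Nat.add_le_add_left (card_biUnion_le_card_mul _ _ _ (fun x _ => X.card_nb x)) _)
    calc _ ≤ _ := h1
      _ = (X.Δ + 1) * (X.ball k A).card := by ring
      _ ≤ (X.Δ + 1) * ((X.Δ + 1) ^ k * A.card) := Nat.mul_le_mul_left _ ih
      _ = _ := by ring

/-- find an initial piece of prescribed size -/
theorem initial_find (f : ℕ → ℕ) (k : ℕ) (h0 : f 0 = 0) (hk : ∀ t, f (t + 1) ≤ f t + k) (A g : ℕ) (hA : A ≤ f g) :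
    ∃ t, A ≤ f t ∧ f t ≤ A + k := by
  have hex : ∃ t, A ≤ f t := ⟨g, hA⟩
  refine ⟨Nat.find hex, Nat.find_spec hex, ?_⟩
  rcases Nat.eq_zero_or_pos (Nat.find hex) with h | h
  · rw [h, h0]; omega
  · have h1 := Nat.find_min hex (m := Nat.find hex - 1) (by omega)
    have h2 := hk (Nat.find hex - 1)
    rw [Nat.sub_add_cancel h] at h2
    omega

set_option maxHeartbeats 1000000 in
theorem layout (Q : Finset W) (lab : W → ℕ) (gl k A : ℕ) [Nonempty W]
    (hlab : ∀ x y, X.H.Adj x y → x ∉ Q → y ∉ Q → lab x = lab y) (hgl : ∀ x, lab x < gl)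
    (hk : ∀ t, ((univ \ Q).filter (fun z => lab z = t)).card ≤ k)
    (hA : X.Δ * A + X.Δ * Q.card ≤ ((univ : Finset (Sym2 W)).filter (fun e => e ∈ X.H.edgeSet)).card)
    (sz : Fin 3 → Option Bool → ℕ)
    (hsz : (X.Δ + 1) * ((∑ i : Fin 3 × Option Bool, sz i.1 i.2) * (X.Δ + 1) ^ 8 + (X.Δ + 1) ^ 4 * Q.card) ≤ A) :
    ∃ L : X.Lay, L.Q = Q ∧ L.lab = lab ∧ L.S.card ≤ A + k ∧ ∀ i o, (L.I i o).card = sz i o := by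
  -- S
  obtain ⟨Sf, hSf⟩ : ∃ Sf : ℕ → Finset W, ∀ t z, z ∈ Sf t ↔ z ∉ Q ∧ lab z < t ∧ ∃ y, y ∉ Q ∧ X.H.Adj z y :=
    ⟨fun t => univ.filter (fun z => z ∉ Q ∧ lab z < t ∧ ∃ y, y ∉ Q ∧ X.H.Adj z y), by simp⟩
  have htot : A ≤ (Sf gl).card := by
    have h1 : ((univ : Finset (Sym2 W)).filter (fun e => e ∈ X.H.edgeSet)) ⊆ X.tch (Sf gl) ∪ X.tch Q := by
      intro e he
      rw [mem_filter] at he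
      rw [mem_union, X.mem_tch, X.mem_tch]
      by_cases h : ∃ z ∈ e, z ∈ Q
      · exact Or.inr ⟨he.2, h⟩
      · left
        refine ⟨he.2, ?_⟩
        push Not at h
        have h2 := he.2
        clear he
        induction e using Sym2.ind with
        | _ x y =>
          refine ⟨x, by simp, ?_⟩
          rw [hSf]
          exact ⟨h x (by simp), hgl x, y, h y (by simp), h2⟩
    have h2 := (card_le_card h1).trans ((card_union_le _ _).trans (Nat.add_le_add (X.card_tch _) (X.card_tch _)))
    have h3 : X.Δ * A ≤ X.Δ * (Sf gl).card := by omega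
    exact Nat.le_of_mul_le_mul_left h3 X.hΔ
  obtain ⟨t, ht1, ht2⟩ := initial_find (fun t => (Sf t).card) k (by
      simp only [card_eq_zero, eq_empty_iff_forall_notMem]
      intro z hz
      rw [hSf] at hz
      omega) (by
      intro t
      refine le_trans (card_le_card ?_) ((card_union_le _ _).trans (Nat.add_le_add_left (hk t) _))
      intro z hz
      rw [hSf] at hz
      rw [mem_union, hSf, mem_filter, mem_sdiff]
      rcases Nat.lt_succ_iff_lt_or_eq.1 hz.2.1 with h | h
      · exact Or.inl ⟨hz.1, h, hz.2.2⟩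
      · exact Or.inr ⟨⟨mem_univ _, hz.1⟩, h⟩) A gl htot
  obtain ⟨S, hSdef⟩ : ∃ S, S = Sf t := ⟨_, rfl⟩
  simp only [← hSdef] at ht1 ht2
  have hS : ∀ z, z ∈ S ↔ z ∉ Q ∧ lab z < t ∧ ∃ y, y ∉ Q ∧ X.H.Adj z y := by intro z; rw [hSdef, hSf]
  have hSc : ∀ x ∈ S, ∀ y, X.H.Adj x y → y ∉ Q → y ∈ S := by
    intro x hx y hxy hy
    rw [hS] at hx ⊢
    refine ⟨hy, ?_, x, hx.1, hxy.symm⟩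
    rw [← hlab x y hxy hx.1 hy]; exact hx.2.1
  have hmex : ∀ x, ∃ y, x ∈ S → X.H.Adj x y ∧ y ∈ S := by
    intro x
    by_cases hx : x ∈ S
    · obtain ⟨y, hy, hxy⟩ := ((hS x).1 hx).2.2
      exact ⟨y, fun _ => ⟨hxy, hSc x hx y hxy hy⟩⟩
    · exact ⟨x, fun h => absurd h hx⟩
  choose mate hmate using hmex
  -- side true part
  have hSt : A ≤ (X.Δ + 1) * (S.filter (fun x => X.side x = true)).card := by
    have h1 : S ⊆ S.filter (fun x => X.side x = true) ∪ (S.filter (fun x => X.side x = true)).biUnion X.nb := by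
      intro x hx
      rw [mem_union, mem_filter, mem_biUnion]
      cases hsx : X.side x
      · right
        refine ⟨mate x, mem_filter.2 ⟨(hmate x hx).2, ?_⟩, X.mem_nb.2 (hmate x hx).1.symm⟩
        rw [X.hside _ _ (hmate x hx).1, hsx]; rfl
      · exact Or.inl ⟨hx, rfl⟩
    have h2 := (card_le_card h1).trans ((card_union_le _ _).trans
      (Nat.add_le_add_left (card_biUnion_le_card_mul _ _ _ (fun x _ => X.card_nb x)) _))
    calc A ≤ _ := ht1
      _ ≤ _ := h2
      _ = _ := by ring
  obtain ⟨Cd, hCd⟩ : ∃ Cd, Cd = S.filter (fun x => X.side x = true) \ X.ball 4 Q := ⟨_, rfl⟩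
  have hCdc : (∑ i : Fin 3 × Option Bool, sz i.1 i.2) * (X.Δ + 1) ^ 8 ≤ Cd.card := by
    have h1 := (hsz.trans hSt)
    have h2 := Nat.le_of_mul_le_mul_left h1 (Nat.succ_pos _)
    have h3 := X.ball_card 4 Q
    have h4 := le_card_sdiff (X.ball 4 Q) (S.filter (fun x => X.side x = true))
    rw [← hCd] at h4
    omega
  have hCdS : ∀ x ∈ Cd, x ∈ S ∧ X.side x = true ∧ x ∉ X.ball 4 Q := by
    intro x hx
    rw [hCd, mem_sdiff, mem_filter] at hx
    exact ⟨hx.1.1, hx.1.2, hx.2⟩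
  obtain ⟨J, hJ, hJc, hJi⟩ := greedy Cd (fun x => X.ball 8 {x}) ((X.Δ + 1) ^ 8)
    (fun x => by simpa using X.ball_card 8 {x}) (Nat.one_le_pow _ _ (Nat.succ_pos _))
    (fun x => X.ball_mono (Nat.zero_le 8) _ (by simp [ball])) (fun x y h => X.ball_symm h) _ hCdc
  obtain ⟨I, hI1, hI2, hI3⟩ := split_sets J (fun i : Fin 3 × Option Bool => sz i.1 i.2) hJc.ge
  have hIJ : ∀ i x, x ∈ I i → x ∈ S ∧ X.side x = true ∧ x ∉ X.ball 4 Q := fun i x hx => hCdS x (hJ (hI1 i hx))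
  have hpair : ∀ x ∈ S, X.ball 3 {x, mate x} ⊆ X.ball 4 {x} := by
    intro x hx
    apply X.ball_ball 1
    intro z hz
    rw [mem_insert, mem_singleton] at hz
    rcases hz with rfl | rfl
    · exact X.ball_succ _ _ (by simp [ball])
    · exact X.ball_adj (k := 0) (by simp [ball]) (hmate x hx).1
  refine ⟨⟨S, Q, lab, gl, mate, fun i o => I (i, o), hlab, hgl, ?_, ?_, ?_, ?_, ?_⟩, rfl, rfl, ht2,
    fun i o => hI2 (i, o)⟩
  · intro x hx y hxy
    by_cases hy : y ∈ Q
    · exact mem_union_right _ hy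
    · exact mem_union_left _ (hSc x hx y hxy hy)
  · intro x hx
    exact ((hS x).1 hx).1
  · intro i o x hx
    have := hIJ _ x hx
    exact ⟨(hmate x this.1).1, this.2.1⟩
  · intro i o x hx
    obtain ⟨h1, h2, h3⟩ := hIJ _ x hx
    refine (hpair x h1).trans ?_
    have hno : ∀ z ∈ X.ball 4 {x}, z ∉ Q := by
      intro z hz hzQ
      exact h3 (X.ball_subset (singleton_subset_iff.2 hzQ) 4 (X.ball_symm hz))
    have : ∀ j ≤ 4, X.ball j {x} ⊆ S := by
      intro j
      induction j with
      | zero => intro _ z hz; simp only [ball, mem_singleton] at hz; rw [hz]; exact h1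
      | succ j ih =>
        intro hj z hz
        rcases mem_union.1 hz with hz' | hz'
        · exact ih (by omega) hz'
        · obtain ⟨y, hy, hyz⟩ := mem_biUnion.1 hz'
          exact hSc y (ih (by omega) hy) z (X.mem_nb.1 hyz) (hno z (X.ball_mono hj _ hz))
    exact this 4 le_rfl
  · intro i o x hx i' o' x' hx' z hz hz'
    have h1 := hpair x (hIJ _ x hx).1 hz
    have h2 := X.ball_symm (hpair x' (hIJ _ x' hx').1 hz')
    have h3 := X.ball_ball 4 _ _ (singleton_subset_iff.2 h1) 4 h2
    have h4 := hJi x (hI1 _ hx) x' (hI1 _ hx') h3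
    subst h4
    have := hI3 _ _ x hx hx'
    rw [Prod.mk.injEq] at this
    exact ⟨rfl, this⟩

end Ctx
end BU

namespace BU

/-- labels of the vertices outside the separator by components -/
theorem labels {W : Type} [Fintype W] (H : SimpleGraph W) (Q : Finset W) (k : ℕ)
    (hK : ∀ K : (SimpleGraph.induce ((↑Q : Set W)ᶜ) H).ConnectedComponent, K.supp.ncard ≤ k) :
    ∃ (lab : W → ℕ) (gl : ℕ), (∀ x y, H.Adj x y → x ∉ Q → y ∉ Q → lab x = lab y) ∧ (∀ z, lab z < gl) ∧
      ∀ t, ((univ \ Q).filter (fun z => lab z = t)).card ≤ k := by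
  obtain ⟨G, hG⟩ : ∃ G, G = SimpleGraph.induce ((↑Q : Set W)ᶜ) H := ⟨_, rfl⟩
  have hm : ∀ z, z ∉ Q → z ∈ ((↑Q : Set W)ᶜ) := fun z hz => by simpa using hz
  have : Finite (SimpleGraph.induce ((↑Q : Set W)ᶜ) H).ConnectedComponent :=
    Finite.of_surjective (SimpleGraph.connectedComponentMk _) (fun K => by
      induction K using SimpleGraph.ConnectedComponent.ind with
      | _ v => exact ⟨v, rfl⟩)
  let e := Finite.equivFin (SimpleGraph.induce ((↑Q : Set W)ᶜ) H).ConnectedComponent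
  refine ⟨fun z => if h : z ∉ Q then (e (SimpleGraph.connectedComponentMk _ ⟨z, hm z h⟩) : ℕ) else 0,
    Nat.card (SimpleGraph.induce ((↑Q : Set W)ᶜ) H).ConnectedComponent + 1, ?_, ?_, ?_⟩
  · intro x y hxy hx hy
    simp only [hx, hy, not_false_eq_true, dif_pos]
    congr 2
    apply SimpleGraph.ConnectedComponent.sound
    apply SimpleGraph.Adj.reachable
    simpa using hxy
  · intro z
    dsimp only
    split_ifs with h
    · omega
    · exact (Fin.is_lt _).trans (Nat.lt_succ_self _)
  · intro t
    by_cases ht : t < Nat.card (SimpleGraph.induce ((↑Q : Set W)ᶜ) H).ConnectedComponent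
    · refine le_trans ?_ (hK (e.symm ⟨t, ht⟩))
      rw [← Set.ncard_coe_finset]
      rw [← Set.ncard_image_of_injective (e.symm ⟨t, ht⟩).supp Subtype.val_injective]
      apply Set.ncard_le_ncard _ (Set.toFinite _)
      intro z hz
      simp only [coe_filter, mem_sdiff, mem_univ, true_and, Set.mem_ofPred_eq] at hz
      obtain ⟨h1, h2⟩ := hz
      simp only [h1, not_false_eq_true, dif_pos] at h2
      refine ⟨⟨z, hm z h1⟩, ?_, rfl⟩
      rw [SimpleGraph.ConnectedComponent.mem_supp_iff, Equiv.eq_symm_apply]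
      exact Fin.ext h2
    · have : ((univ \ Q).filter (fun z => (if h : z ∉ Q then (e (SimpleGraph.connectedComponentMk _ ⟨z, hm z h⟩) : ℕ) else 0) = t)) = ∅ := by
        rw [eq_empty_iff_forall_notMem]
        intro z hz
        simp only [mem_filter, mem_sdiff, mem_univ, true_and] at hz
        obtain ⟨h1, h2⟩ := hz
        simp only [h1, not_false_eq_true, dif_pos] at h2
        exact ht (h2 ▸ Fin.is_lt _)
      rw [this]; simp

end BU

namespace BU

theorem thick_sum {V : Type} (U : Finset V) (f : V → ℕ) (K θ : ℝ) (hK : 0 ≤ K) (hθ : 0 ≤ θ) (hf : ∀ v ∈ U, (f v : ℝ) ≤ K) :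
    ∑ v ∈ U, (f v : ℝ) ≤ ((U.filter (fun v => θ * K ≤ (f v : ℝ))).card : ℝ) * K + U.card * (θ * K) := by
  have h1 : ∀ v ∈ U, (f v : ℝ) ≤ (if θ * K ≤ (f v : ℝ) then 1 else 0) * K + θ * K := by
    intro v hv
    split_ifs with h
    · have := hf v hv
      have := mul_nonneg hθ hK
      linarith
    · push Not at h
      linarith
  refine (sum_le_sum h1).trans ?_
  rw [sum_add_distrib, ← sum_mul, card_filter, sum_const]
  push_cast
  rw [nsmul_eq_mul]

theorem card_prod_filter {V : Type} (A B : Finset V) (Q : V → V → Prop) :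
    (((A ×ˢ B).filter (fun p => Q p.1 p.2)).card : ℝ) = ∑ a ∈ A, ((B.filter (fun b => Q a b)).card : ℝ) := by
  simp only [card_filter, sum_product]
  push_cast
  rfl

theorem card_triple_filter {V : Type} (A B C : Finset V) (Q : V → V → V → Prop) :
    (((A ×ˢ B ×ˢ C).filter (fun p => Q p.1 p.2.1 p.2.2)).card : ℝ) =
      ∑ a ∈ A, ∑ b ∈ B, ((C.filter (fun c => Q a b c)).card : ℝ) := by
  simp only [card_filter, sum_product]
  push_cast
  rfl

theorem bad_bound {V : Type} (T : V → V → V → Prop) (A U D : Finset V) (d θ ε a : ℝ) (hθ : 0 < θ) (hd : 4 * θ ≤ d)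
    (hU : 0 < (U.card : ℝ)) (hD : 0 < (D.card : ℝ)) (ha : 0 ≤ ε * a)
    (hr : ∀ B ⊆ A, ε * a ≤ B.card → d * B.card * U.card * D.card ≤
      ∑ u ∈ B, ∑ v ∈ U, ((D.filter (fun c => T u v c)).card : ℝ)) :
    ((A.filter (fun u => ((U.filter (fun v => θ * (D.card : ℝ) ≤
      ((D.filter (fun c => T u v c)).card : ℝ))).card : ℝ) < θ * U.card)).card : ℝ) ≤ ε * a := by
  by_contra hcon
  push Not at hcon
  obtain ⟨B, hB⟩ : ∃ B, B = A.filter (fun u => ((U.filter (fun v => θ * (D.card : ℝ) ≤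
      ((D.filter (fun c => T u v c)).card : ℝ))).card : ℝ) < θ * U.card) := ⟨_, rfl⟩
  rw [← hB] at hcon
  have h1 := hr B (by rw [hB]; exact filter_subset _ _) hcon.le
  have h2 : ∀ u ∈ B, ∑ v ∈ U, ((D.filter (fun c => T u v c)).card : ℝ) ≤ 2 * θ * U.card * D.card := by
    intro u hu
    rw [hB, mem_filter] at hu
    have h3 := thick_sum U (fun v => (D.filter (fun c => T u v c)).card) D.card θ hD.le hθ.le
      (fun v _ => by exact_mod_cast card_filter_le _ _)
    have h4 := mul_le_mul_of_nonneg_right hu.2.le hD.le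
    linarith
  have h5 := h1.trans (sum_le_sum h2)
  rw [sum_const, nsmul_eq_mul] at h5
  have hBp : 0 < (B.card : ℝ) := lt_of_le_of_lt ha hcon
  have h6 : 0 < (B.card : ℝ) * U.card * D.card := by positivity
  have h7 := mul_le_mul_of_nonneg_right hd h6.le
  have h8 := mul_pos hθ h6
  linarith

theorem deg_thick {V : Type} (U : Finset V) (f : V → ℕ) (K θ : ℝ) (hK : 0 < K) (hθ : 0 < θ) (hf : ∀ v ∈ U, (f v : ℝ) ≤ K)
    (h : 2 * θ * U.card * K ≤ ∑ v ∈ U, (f v : ℝ)) :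
    θ * U.card ≤ ((U.filter (fun v => θ * K ≤ (f v : ℝ))).card : ℝ) := by
  have h1 := h.trans (thick_sum U f K θ hK.le hθ.le hf)
  refine le_of_mul_le_mul_right ?_ hK
  linarith

theorem mkCtx {V W : Type} [Fintype W] (V₁ V₂ V₃ : Finset V) (T : V → V → V → Prop)
    (Tsymm : ∀ u v c, T u v c → T v u c) (H : SimpleGraph W) (side : W → Bool)
    (hside : ∀ x y, H.Adj x y → side y = !side x) (Δ : ℕ) (hΔ : 1 ≤ Δ)
    (hdeg : ∀ w, ((univ : Finset W).filter (fun y => H.Adj w y)).card ≤ Δ) (d θ ε : ℝ)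
    (hθ : 0 < θ) (hθ1 : θ ≤ 1) (hε : 0 < ε) (hd : 4 * θ ≤ d)
    (h1 : 0 < (V₁.card : ℝ)) (h2 : 0 < (V₂.card : ℝ)) (h3 : 0 < (V₃.card : ℝ))
    (hr : ∀ U₁ ⊆ V₁, ∀ U₂ ⊆ V₂, ∀ U₃ ⊆ V₃,
        ε * (V₁.card : ℝ) ≤ (U₁.card : ℝ) → ε * (V₂.card : ℝ) ≤ (U₂.card : ℝ) →
        ε * (V₃.card : ℝ) ≤ (U₃.card : ℝ) →
        d * (U₁.card : ℝ) * (U₂.card : ℝ) * (U₃.card : ℝ) ≤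
          ∑ u ∈ U₁, ∑ v ∈ U₂, ((U₃.filter (fun c => T u v c)).card : ℝ))
    (hd1 : ∀ u ∈ V₁, 2 * θ * V₂.card * V₃.card ≤ ∑ v ∈ V₂, ((V₃.filter (fun c => T u v c)).card : ℝ))
    (hd2 : ∀ u ∈ V₂, 2 * θ * V₁.card * V₃.card ≤ ∑ v ∈ V₁, ((V₃.filter (fun c => T u v c)).card : ℝ))
    (hd3 : ∀ c ∈ V₃, θ * V₁.card * V₂.card ≤ ∑ v ∈ V₁, ((V₂.filter (fun u => T v u c)).card : ℝ)) :
    ∃ X : Ctx V W, X.P true = V₁ ∧ X.P false = V₂ ∧ X.C = V₃ ∧ X.T = T ∧ X.H = H ∧ X.side = side ∧ X.Δ = Δ ∧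
      X.θ = θ ∧ X.ε = ε := by
  have Tc : ∀ u v c, T u v c ↔ T v u c := fun u v c => ⟨Tsymm _ _ _, Tsymm _ _ _⟩
  refine ⟨⟨fun b => cond b V₁ V₂, V₃, T, Tsymm, H, side, hside, Δ, hΔ, hdeg, θ, ε, hθ, hθ1, hε, ?_, ?_, ?_, ?_⟩,
    rfl, rfl, rfl, rfl, rfl, rfl, rfl, rfl, rfl⟩
  · intro b U hU D hD hUc hDc
    cases b
    · simp only [Bool.not_false, cond_true, cond_false] at *
      refine bad_bound T V₂ U D d θ ε V₂.card hθ hd (lt_of_lt_of_le (by positivity) hUc)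
        (lt_of_lt_of_le (by positivity) hDc) (by positivity) ?_
      intro B hB hBc
      have := hr U hU B hB D hD hUc hBc hDc
      rw [sum_comm] at this
      simp only [Tc _ _] at this ⊢
      calc _ = d * (U.card : ℝ) * (B.card : ℝ) * (D.card : ℝ) := by ring
        _ ≤ _ := this
        _ = _ := by
          refine sum_congr rfl fun u _ => sum_congr rfl fun v _ => ?_
          congr 2
    · simp only [Bool.not_true, cond_true, cond_false] at *
      refine bad_bound T V₁ U D d θ ε V₁.card hθ hd (lt_of_lt_of_le (by positivity) hUc)
        (lt_of_lt_of_le (by positivity) hDc) (by positivity) ?_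
      intro B hB hBc
      exact hr B hB U hU D hD hBc hUc hDc
  · intro b u hu
    cases b
    · exact deg_thick V₁ (fun v => (V₃.filter (fun c => T u v c)).card) V₃.card θ h3 hθ
        (fun v _ => by exact_mod_cast card_filter_le _ _) (hd2 u hu)
    · exact deg_thick V₂ (fun v => (V₃.filter (fun c => T u v c)).card) V₃.card θ h3 hθ
        (fun v _ => by exact_mod_cast card_filter_le _ _) (hd1 u hu)
  · intro c hc
    simp only [cond_true, cond_false]
    rw [card_prod_filter V₁ V₂ (fun u v => T u v c)]
    exact hd3 c hc
  · intro U₁ hU₁ U₂ hU₂ hc₁ hc₂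
    simp only [cond_true, cond_false] at *
    by_contra hcon
    push Not at hcon
    obtain ⟨D, hD⟩ : ∃ D, D = V₃.filter (fun c => (((U₁ ×ˢ U₂).filter (fun p => T p.1 p.2 c)).card : ℝ) <
      θ * (U₁.card : ℝ) * U₂.card) := ⟨_, rfl⟩
    rw [← hD] at hcon
    have h4 := hr U₁ hU₁ U₂ hU₂ D (by rw [hD]; exact filter_subset _ _) hc₁ hc₂ hcon.le
    have h5 : ∑ u ∈ U₁, ∑ v ∈ U₂, ((D.filter (fun c => T u v c)).card : ℝ) =
        ∑ c ∈ D, (((U₁ ×ˢ U₂).filter (fun p => T p.1 p.2 c)).card : ℝ) := by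
      rw [← sum_product' (f := fun u v => ((D.filter (fun c => T u v c)).card : ℝ))]
      simp only [card_filter]
      push_cast
      rw [sum_comm]
    rw [h5] at h4
    have h6 : ∀ c ∈ D, (((U₁ ×ˢ U₂).filter (fun p => T p.1 p.2 c)).card : ℝ) ≤ θ * (U₁.card : ℝ) * U₂.card := by
      intro c hc
      rw [hD, mem_filter] at hc
      exact hc.2.le
    have h7 := h4.trans (sum_le_sum h6)
    rw [sum_const, nsmul_eq_mul] at h7
    have p1 : 0 < (U₁.card : ℝ) := lt_of_lt_of_le (by positivity) hc₁
    have p2 : 0 < (U₂.card : ℝ) := lt_of_lt_of_le (by positivity) hc₂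
    have p3 : 0 < (D.card : ℝ) := lt_trans (by positivity) hcon
    have h8 : 0 < (U₁.card : ℝ) * U₂.card * D.card := by positivity
    have h9 := mul_le_mul_of_nonneg_right hd h8.le
    have h10 := mul_pos hθ h8
    linarith

/-- degree in a 3-partite 3-graph -/
theorem hdeg_le {V : Type} [Fintype V] (E : Set (Finset V)) (A B C : Finset V) (hAB : Disjoint A B)
    (hAC : Disjoint A C) (hBC : Disjoint B C) (v : V) (hv : v ∈ A)
    (hE : ∀ e ∈ E, e.card = 3 ∧ (e ∩ B).card = 1 ∧ (e ∩ C).card = 1) :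
    (((univ : Finset (Finset V)).filter (fun e => e ∈ E ∧ v ∈ e)).card : ℝ) ≤
      ∑ y ∈ B, ((C.filter (fun c => ({v, y, c} : Finset V) ∈ E)).card : ℝ) := by
  rw [← card_prod_filter B C (fun y c => ({v, y, c} : Finset V) ∈ E)]
  rw [Nat.cast_le]
  refine (card_le_card ?_).trans (card_image_le (f := fun p : V × V => ({v, p.1, p.2} : Finset V)))
  intro e he
  rw [mem_filter] at he
  obtain ⟨-, heE, hve⟩ := he
  obtain ⟨h3, hB, hC⟩ := hE e heE
  obtain ⟨y, hy⟩ := card_pos.1 (by rw [hB]; exact one_pos)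
  obtain ⟨c, hc⟩ := card_pos.1 (by rw [hC]; exact one_pos)
  rw [mem_inter] at hy hc
  have n1 : v ≠ y := fun h => disjoint_left.1 hAB hv (h ▸ hy.2)
  have n2 : v ≠ c := fun h => disjoint_left.1 hAC hv (h ▸ hc.2)
  have n3 : y ≠ c := fun h => disjoint_left.1 hBC hy.2 (h ▸ hc.2)
  have hs : ({v, y, c} : Finset V) = e := by
    apply eq_of_subset_of_card_le
    · intro z hz
      simp only [mem_insert, mem_singleton] at hz
      rcases hz with rfl | rfl | rfl
      · exact hve
      · exact hy.1
      · exact hc.1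
    · rw [h3, card_eq_three.2 ⟨v, y, c, n1, n2, n3, rfl⟩]
  exact mem_image.2 ⟨(y, c), mem_filter.2 ⟨mem_product.2 ⟨hy.2, hc.2⟩, by rw [hs]; exact heE⟩, hs⟩

end BU

namespace BU

theorem tail_bound (M a : ℝ) (l G : ℕ) (ha : 0 < a) (ha1 : a ≤ 1) (hG : 2 ≤ a * G)
    (hM : 720 * M < (l : ℝ) ^ 6) (hM0 : 0 ≤ M) : M * 2 ^ l * (1 - a) ^ (G * l) < 1 := by
  have h1 : (1 - a) ^ (G * l) ≤ Real.exp (-(2 * l)) := by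
    calc (1 - a) ^ (G * l) ≤ (Real.exp (-a)) ^ (G * l) :=
          pow_le_pow_left₀ (by linarith) (Real.one_sub_le_exp_neg a) _
      _ = Real.exp (-(a * G * l)) := by
          rw [← Real.exp_nat_mul]; push_cast; congr 1; ring
      _ ≤ _ := by
          apply Real.exp_le_exp.2
          have := mul_le_mul_of_nonneg_right hG (Nat.cast_nonneg (α := ℝ) l)
          linarith
  have h2 : (2 : ℝ) ^ l ≤ Real.exp l := by
    have : (2 : ℝ) ≤ Real.exp 1 := by
      have := Real.add_one_le_exp (1 : ℝ)
      linarith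
    calc (2 : ℝ) ^ l ≤ (Real.exp 1) ^ l := pow_le_pow_left₀ (by norm_num) this _
      _ = _ := by rw [← Real.exp_nat_mul]; simp
  have h3 := Real.pow_div_factorial_le_exp (l : ℝ) (Nat.cast_nonneg _) 6
  have h4 : M < Real.exp l := by
    refine lt_of_lt_of_le ?_ h3
    rw [lt_div_iff₀ (by positivity)]
    have : ((Nat.factorial 6 : ℕ) : ℝ) = 720 := by norm_num [Nat.factorial]
    rw [this]; linarith
  calc M * 2 ^ l * (1 - a) ^ (G * l) ≤ M * Real.exp l * Real.exp (-(2 * l)) := by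
        apply mul_le_mul _ h1 (pow_nonneg (by linarith) _) (by positivity)
        exact mul_le_mul_of_nonneg_left h2 hM0
    _ < Real.exp l * Real.exp l * Real.exp (-(2 * l)) := by
        have := Real.exp_pos (l : ℝ)
        have := Real.exp_pos (-(2 * l : ℝ))
        gcongr
    _ = 1 := by
        rw [← Real.exp_add, ← Real.exp_add, ← Real.exp_zero]; congr 1; ring

end BU

namespace BU
namespace Ctx
namespace Lay

variable {V W : Type} [Fintype W] {X : Ctx V W} (L : X.Lay)

theorem card_Lt (q : ℕ) (h : ∀ o, (L.I 2 o).card = q) : L.Lt.card ≤ 6 * (X.Δ + 1) ^ 2 * q := by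
  unfold Lt
  have h1 : ∀ o ∈ (univ : Finset (Option Bool)), (L.Zn 2 o 2).card ≤ q * ((X.Δ + 1) ^ 2 * 2) := by
    intro o _
    unfold Zn
    rw [← h o]
    apply card_biUnion_le_card_mul
    intro x _
    unfold R
    exact (X.ball_card 2 _).trans (Nat.mul_le_mul_left _ card_le_two)
  refine (card_biUnion_le_card_mul _ _ _ h1).trans (le_of_eq ?_)
  have : (univ : Finset (Option Bool)).card = 3 := rfl
  rw [this]; ring

/-- the parameters -/
def par (Δ : ℕ) (b : ℕ → ℕ) : Par :=
  { m3 := b 8, l3 := b 7, s3 := b 6, m := b 5, l := b 4, s := b 3, q := b 2, k := b 0, s0 := b 9, x0 := b 0,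
    lam := 6 * (Δ + 1) ^ 2 * b 2 }

set_option maxHeartbeats 4000000 in
theorem mkNum (b : ℕ → ℕ) (E Gn : ℕ) (c Λ τ : ℝ) (hτ : τ = X.θ ^ X.Δ) (hΛ : 1 ≤ Λ)
    (hc : c = (τ / 2) ^ 3 / (128 * Λ))
    (hE : E = 10 * (X.Δ + 1) ^ 9 + Gn) (hGn : 2 ≤ (τ / 2) ^ 3 / 64 * Gn)
    (hb0 : 1 ≤ b 0) (hstep : ∀ j, 100 * ((E : ℝ) * b j) ≤ c * b (j + 1))
    (hbm : ∀ j, b j ≤ b (j + 1))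
    (lo : ∀ o, (b 10 : ℝ) ≤ Λ * (X.P o).card) (loC : (b 10 : ℝ) ≤ Λ * X.C.card)
    (t3 : 720 * ((b 8 : ℝ) * X.C.card) < (b 7 : ℝ) ^ 6)
    (t1 : ∀ o, 720 * ((b 5 : ℝ) * (X.P o).card) < (b 4 : ℝ) ^ 6)
    (ep : ∀ o, X.ε * (X.P o).card ≤ b 0) (epC : X.ε * X.C.card ≤ b 0)
    (hI0 : (L.I 0 none).card = b 8) (hI0b : ∀ o, (L.I 0 (some o)).card = b 5)
    (hI1 : ∀ o, (L.I 1 o).card = b 2) (hI2 : ∀ o, (L.I 2 o).card = b 2)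
    (hS : (L.S ∪ L.Q).card ≤ b 9) (hQ : L.Q.card ≤ b 0)
    (hK : ∀ t, (L.Out.filter (fun z => L.lab z = t)).card ≤ b 0)
    (sidec : ∀ b, ((univ : Finset W).filter (fun z => X.side z = b)).card = (X.P b).card)
    (edgec : ((univ : Finset (Sym2 W)).filter (fun e => e ∈ X.H.edgeSet)).card = X.C.card)
    (pd : Disjoint (X.P true) (X.P false)) : L.Num (par X.Δ b) := by
  have hθ := X.hθ
  have hθ1 := X.hθ1
  have τ0 : 0 < τ := by rw [hτ]; positivity
  have τθ : τ ≤ X.θ := by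
    rw [hτ]
    calc X.θ ^ X.Δ ≤ X.θ ^ 1 := pow_le_pow_of_le_one hθ.le hθ1 X.hΔ
      _ = _ := pow_one _
  have τ1 : τ ≤ 1 := τθ.trans hθ1
  have Λ0 : 0 < Λ := by linarith
  have c0 : 0 < c := by rw [hc]; positivity
  -- basic comparisons for c
  have hcc : c * Λ = (τ / 2) ^ 3 / 128 := by rw [hc]; field_simp
  have cτ3 : c ≤ (τ / 2) ^ 3 / 128 := by
    rw [← hcc]; exact le_mul_of_one_le_right c0.le hΛ
  have q2 : (τ / 2) ^ 2 ≤ 1 / 4 := by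
    calc (τ / 2) ^ 2 ≤ (1 / 2) ^ 2 := pow_le_pow_left₀ (by positivity) (by linarith) _
      _ = _ := by norm_num
  have q32 : (τ / 2) ^ 3 ≤ (τ / 2) ^ 2 := pow_le_pow_of_le_one (by positivity) (by linarith) (by norm_num)
  have q31 : (τ / 2) ^ 3 ≤ τ / 2 := by
    calc (τ / 2) ^ 3 ≤ (τ / 2) ^ 1 := pow_le_pow_of_le_one (by positivity) (by linarith) (by norm_num)
      _ = _ := pow_one _
  have t2θ : (τ / 2) ^ 2 ≤ (X.θ / 2) ^ 2 := pow_le_pow_left₀ (by positivity) (by linarith) _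
  have t3θ : (τ / 2) ^ 3 ≤ (X.θ / 2) ^ 3 := pow_le_pow_left₀ (by positivity) (by linarith) _
  have a1 : (X.θ / 2) ^ 3 ≤ 1 := pow_le_one₀ (by positivity) (by linarith)
  -- E comparisons
  have D1 : (1 : ℝ) ≤ (X.Δ : ℝ) + 1 := by have := Nat.cast_nonneg (α := ℝ) X.Δ; linarith
  have Dp : ∀ i ≤ 9, ((X.Δ : ℝ) + 1) ^ i ≤ ((X.Δ : ℝ) + 1) ^ 9 := fun i hi => pow_le_pow_right₀ D1 hi
  have ER : (E : ℝ) = 10 * ((X.Δ : ℝ) + 1) ^ 9 + Gn := by rw [hE]; push_cast; ring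
  have D9 : 1 ≤ ((X.Δ : ℝ) + 1) ^ 9 := one_le_pow₀ D1
  have Gn0 : (0 : ℝ) ≤ Gn := Nat.cast_nonneg _
  have E1 : (1 : ℝ) ≤ E := by linarith
  have EΔ : (X.Δ : ℝ) ≤ E := by have := Dp 1 (by norm_num); linarith
  have EG : (Gn : ℝ) ≤ E := by linarith
  have El : 6 * ((X.Δ : ℝ) + 1) ^ 2 ≤ E := by have := Dp 2 (by norm_num); linarith
  have EΔl : (X.Δ : ℝ) * (6 * ((X.Δ : ℝ) + 1) ^ 2) ≤ E := by
    have h1 := Dp 3 (by norm_num)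
    have h2 : (X.Δ : ℝ) * (6 * ((X.Δ : ℝ) + 1) ^ 2) ≤ 6 * ((X.Δ : ℝ) + 1) ^ 3 := by
      have : (0 : ℝ) ≤ 6 * ((X.Δ : ℝ) + 1) ^ 2 := by positivity
      linarith
    linarith
  -- g
  obtain ⟨g, hg⟩ : ∃ g : ℕ → ℝ, ∀ j, g j = (E : ℝ) * b j := ⟨_, fun _ => rfl⟩
  have bn : ∀ j, (0 : ℝ) ≤ b j := fun j => Nat.cast_nonneg _
  have gb : ∀ j, (b j : ℝ) ≤ g j := fun j => by rw [hg]; exact le_mul_of_one_le_left (bn j) E1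
  have gΔ : ∀ j, (X.Δ : ℝ) * b j ≤ g j := fun j => by
    rw [hg]; exact mul_le_mul_of_nonneg_right EΔ (bn j)
  have gG : ∀ j, (Gn : ℝ) * b j ≤ g j := fun j => by
    rw [hg]; exact mul_le_mul_of_nonneg_right EG (bn j)
  have gl : 6 * ((X.Δ : ℝ) + 1) ^ 2 * b 2 ≤ g 2 := by
    rw [hg]; exact mul_le_mul_of_nonneg_right El (bn 2)
  have gΔl : (X.Δ : ℝ) * (6 * ((X.Δ : ℝ) + 1) ^ 2 * b 2) ≤ g 2 := by
    rw [hg, ← mul_assoc]; exact mul_le_mul_of_nonneg_right EΔl (bn 2)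
  have gm : ∀ j, g j ≤ g (j + 1) := fun j => by
    rw [hg, hg]; exact mul_le_mul_of_nonneg_left (by exact_mod_cast hbm j) (by linarith)
  have st : ∀ j, 100 * g j ≤ c * b (j + 1) := fun j => by rw [hg]; exact hstep j
  have hb0' : (1 : ℝ) ≤ b 0 := by exact_mod_cast hb0
  have g0 : 1 ≤ g 0 := hb0'.trans (gb 0)
  have c1 : c ≤ 1 / 512 := by linarith
  have cb : ∀ j, c * b j ≤ b j / 512 := fun j => by
    have := mul_le_mul_of_nonneg_right c1 (bn j); linarith
  have cτ : ∀ j, c * b j ≤ τ * b j := fun j => mul_le_mul_of_nonneg_right (by linarith) (bn j)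
  have cθ : ∀ j, c * b j ≤ X.θ * b j := fun j => mul_le_mul_of_nonneg_right (by linarith) (bn j)
  have τn : ∀ j, 0 ≤ τ * b j := fun j => mul_nonneg τ0.le (bn j)
  have θn : ∀ j, 0 ≤ X.θ * b j := fun j => mul_nonneg hθ.le (bn j)
  have cP : ∀ o, c * b 10 ≤ (τ / 2) ^ 3 / 128 * (X.P o).card := fun o => by
    have := mul_le_mul_of_nonneg_left (lo o) c0.le
    rwa [← mul_assoc, hcc] at this
  have cC : c * b 10 ≤ (τ / 2) ^ 3 / 128 * X.C.card := by
    have := mul_le_mul_of_nonneg_left loC c0.le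
    rwa [← mul_assoc, hcc] at this
  have Pn : ∀ o, (0 : ℝ) ≤ (X.P o).card := fun o => Nat.cast_nonneg _
  have Cn : (0 : ℝ) ≤ X.C.card := Nat.cast_nonneg _
  have cPτ : ∀ o, c * b 10 ≤ τ / 4 * (X.P o).card := fun o =>
    (cP o).trans (mul_le_mul_of_nonneg_right (by linarith) (Pn o))
  have cPθ : ∀ o, c * b 10 ≤ X.θ / 4 * (X.P o).card := fun o =>
    (cP o).trans (mul_le_mul_of_nonneg_right (by linarith) (Pn o))
  have cCθ : c * b 10 ≤ X.θ / 4 * X.C.card := 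
    cC.trans (mul_le_mul_of_nonneg_right (by linarith) Cn)
  have cC3 : c * b 10 ≤ (X.θ / 2) ^ 3 / 64 * (X.C.card / 2) := by
    have := mul_le_mul_of_nonneg_right t3θ Cn
    linarith
  have cP3 : ∀ o, c * b 10 ≤ (τ / 2) ^ 3 / 64 * ((X.P o).card / 2) := fun o => by
    have := cP o
    linarith
  have c2θ : ∀ j, c * b j ≤ (X.θ / 2) ^ 2 / 16 * b j := fun j =>
    mul_le_mul_of_nonneg_right (by linarith) (bn j)
  have c2τ : ∀ j, c * b j ≤ (τ / 2) ^ 2 / 16 * b j := fun j =>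
    mul_le_mul_of_nonneg_right (by linarith) (bn j)
  have eΔ : ∀ o, (X.Δ : ℝ) * X.ε * (X.P o).card ≤ g 0 := fun o => by
    rw [mul_assoc]
    exact (mul_le_mul_of_nonneg_left (ep o) (Nat.cast_nonneg _)).trans (gΔ 0)
  have m0 := gm 0
  have m1 := gm 1
  have m2 := gm 2
  have m3 := gm 3
  have m4 := gm 4
  have m5 := gm 5
  have m6 := gm 6
  have m7 := gm 7
  have m8 := gm 8
  have s0 := st 0
  have s1 := st 1
  have s2 := st 2
  have s3 := st 3
  have s4 := st 4
  have s5 := st 5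
  have s6 := st 6
  have s7 := st 7
  have s8 := st 8
  have s9 := st 9
  norm_num at m0 m1 m2 m3 m4 m5 m6 m7 m8 s0 s1 s2 s3 s4 s5 s6 s7 s8 s9
  have bmono : ∀ j, 1 ≤ b j := fun j => by
    induction j with
    | zero => exact hb0
    | succ j ih => exact ih.trans (hbm j)
  have cΔ0 := gΔ 0
  have cΔ5 := gΔ 5
  have cΔ9 := gΔ 9
  have v0 := gb 0
  have v2 := gb 2
  have v3 := gb 3
  have v5 := gb 5
  have v6 := gb 6
  have v7 := gb 7
  have v8 := gb 8
  have v9 := gb 9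
  refine ⟨hI0, hI0b, ?_, ?_, ?_, hS, hQ, L.card_Lt _ hI2, hK, sidec, edgec, bmono 8, bmono 5, bmono 2,
    ?hsz, ?hcz, ?ac1, ?ac2, ?ac3, ?ac4, ?av1, ?av2, ?av3, ?av4, ?pc1, ?pc2, ?ec, ?dq1, ?dq2, ?dq3, ?dq4, ?dq5, ?dq6,
    ?ls1, ?ls2, ?el1, ?el2, ?el3, pd, ?fn⟩
  all_goals try simp only [par, ← hτ]
  · intro o
    rw [hI1]
    exact (ep o).trans (by linarith [cb 1, cb 2])
  · rw [hI1]
    exact epC.trans (by linarith [cb 1, cb 2])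
  · intro o; rw [hI2]
  case hsz =>
    intro o
    push_cast
    have := eΔ o
    have := cPτ o
    have := mul_nonneg τ0.le (Pn o)
    linarith
  case hcz =>
    push_cast
    have := mul_nonneg hθ.le Cn
    linarith
  case ac1 =>
    have := c2θ 8
    linarith
  case ac2 => linarith
  case ac3 => push_cast; linarith
  case ac4 =>
    refine ⟨Gn * b 7, ?_, ?_⟩
    · push_cast
      have := gG 7
      have := c2θ 8
      linarith
    · apply tail_bound _ _ _ _ (by positivity) (by linarith) _ t3 (by positivity)
      refine hGn.trans (mul_le_mul_of_nonneg_right (by linarith) Gn0)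
  case av1 =>
    have := c2τ 5
    linarith [gb 4]
  case av2 =>
    intro o
    have := cP3 o
    linarith
  case av3 =>
    intro o
    push_cast
    have := cP3 o
    linarith [gb 4]
  case av4 =>
    refine ⟨Gn * b 4, ?_, ?_⟩
    · push_cast
      have := gG 4
      have := c2τ 5
      linarith
    · intro o
      apply tail_bound _ _ _ _ (by positivity) (by linarith) hGn (t1 o) (by positivity)
  case pc1 =>
    intro o
    push_cast
    linarith [ep o, cτ 4, τn 3]
  case pc2 =>
    push_cast
    linarith [gb 0, bn 7, cb 6, cb 7]
  case ec =>
    refine ⟨(b 5 : ℝ) + b 3 + 3 * b 9 + 1 + g 0, ?_, ?_⟩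
    · intro o
      push_cast
      linarith [eΔ o]
    · have hBd : ∀ o, (b 5 : ℝ) + b 3 + 3 * b 9 + 1 + g 0 < X.θ / 4 * (X.P o).card := fun o => by
        linarith [cPθ o]
      have pp : ∀ o, 0 < ((X.P o).card : ℝ) := fun o => by
        by_contra h
        have : ((X.P o).card : ℝ) = 0 := le_antisymm (not_lt.1 h) (Pn o)
        have h2 := cPθ o
        rw [this] at h2
        linarith
      have h1 := mul_lt_mul_of_pos_right (hBd false) (pp true)
      have h2 := mul_lt_mul_of_pos_right (hBd true) (pp false)
      have h3 : 0 < X.θ * (X.P true).card * (X.P false).card := mul_pos (mul_pos hθ (pp _)) (pp _)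
      linarith
  case dq1 => intro o; linarith [ep o, cτ 2]
  case dq2 => linarith [cb 2]
  case dq3 => intro o; linarith [eΔ o, cτ 2]
  case dq4 => linarith [cθ 2]
  case dq5 => intro o; push_cast; linarith [eΔ o, cτ 4, τn 3]
  case dq6 => push_cast; linarith [cθ 7, θn 6]
  case ls1 =>
    have : ((6 * (X.Δ + 1) ^ 2 * b 2 + X.Δ * b 0 : ℕ) : ℝ) ≤ (b 3 : ℕ) := by
      push_cast; linarith [cb 3]
    exact_mod_cast this
  case ls2 =>
    have : ((X.Δ * (6 * (X.Δ + 1) ^ 2 * b 2 + 2 * b 5) + X.Δ * b 0 : ℕ) : ℝ) ≤ (b 6 : ℕ) := by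
      push_cast; linarith [cb 6]
    exact_mod_cast this
  case el1 => intro o; push_cast; linarith [eΔ o, cτ 4, τn 3]
  case el2 => push_cast; linarith [cθ 7, θn 6]
  case el3 => intro o; push_cast; linarith [eΔ o, cθ 4, θn 3]
  case fn => push_cast; linarith [cθ 7, θn 6]

end Lay
end Ctx
end BU

namespace BU
namespace Ctx

variable {V W : Type} [Fintype W] (X : Ctx V W)

set_option maxHeartbeats 1000000 in
theorem embed [Nonempty V] [Nonempty W] (B u E Gn : ℕ) (c Λ τ : ℝ) (hτ : τ = X.θ ^ X.Δ) (hΛ : 1 ≤ Λ)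
    (hc : c = (τ / 2) ^ 3 / (128 * Λ))
    (hE : E = 10 * (X.Δ + 1) ^ 9 + Gn) (hGn : 2 ≤ (τ / 2) ^ 3 / 64 * Gn) (hu : 1 ≤ u)
    (hB : 100 * (E : ℝ) ≤ c * B) (hε : X.ε = 1 / (Λ * (B : ℝ) ^ 10))
    (lo : ∀ o, (B : ℝ) ^ 10 * u ≤ Λ * (X.P o).card) (loC : (B : ℝ) ^ 10 * u ≤ Λ * X.C.card)
    (hi : ∀ o, ((X.P o).card : ℝ) ≤ Λ * ((B : ℝ) ^ 10 * u)) (hiC : (X.C.card : ℝ) ≤ Λ * ((B : ℝ) ^ 10 * u))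
    (sidec : ∀ b, ((univ : Finset W).filter (fun z => X.side z = b)).card = (X.P b).card)
    (edgec : ((univ : Finset (Sym2 W)).filter (fun e => e ∈ X.H.edgeSet)).card = X.C.card)
    (pd : Disjoint (X.P true) (X.P false)) (Q : Finset W) (hQ : Q.card ≤ u)
    (hK : ∀ K : (SimpleGraph.induce ((↑Q : Set W)ᶜ) X.H).ConnectedComponent, K.supp.ncard ≤ u) :
    ∃ (φ : W → V) (σ : Sym2 W → V), Function.Injective φ ∧ (∀ z, φ z ∈ X.P (X.side z)) ∧
      Set.InjOn σ X.H.edgeSet ∧ (∀ e ∈ X.H.edgeSet, σ e ∈ X.C) ∧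
      ∀ x y, X.H.Adj x y → X.T (φ x) (φ y) (σ s(x, y)) := by
  have hθ := X.hθ
  have τ0 : 0 < τ := by rw [hτ]; positivity
  have τ1 : τ ≤ 1 := by rw [hτ]; exact pow_le_one₀ hθ.le X.hθ1
  have Λ0 : 0 < Λ := by linarith
  have c0 : 0 < c := by rw [hc]; positivity
  have hcc : c * Λ ≤ 1 / 1024 := by
    have h1 : c * Λ = (τ / 2) ^ 3 / 128 := by rw [hc]; field_simp
    have h2 : (τ / 2) ^ 3 ≤ (1 / 2) ^ 3 := pow_le_pow_left₀ (by positivity) (by linarith) _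
    rw [h1]; norm_num at h2 ⊢; linarith
  have c1 : c ≤ 1 := by
    have := le_mul_of_one_le_right c0.le hΛ
    linarith
  have D1 : (1 : ℝ) ≤ (X.Δ : ℝ) + 1 := by have := Nat.cast_nonneg (α := ℝ) X.Δ; linarith
  have ER : (E : ℝ) = 10 * ((X.Δ : ℝ) + 1) ^ 9 + Gn := by rw [hE]; push_cast; ring
  have D9 : 1 ≤ ((X.Δ : ℝ) + 1) ^ 9 := one_le_pow₀ D1
  have Gn0 : (0 : ℝ) ≤ Gn := Nat.cast_nonneg _
  have E10 : (10 : ℝ) ≤ E := by linarith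
  have Bn : (0 : ℝ) ≤ B := Nat.cast_nonneg _
  have B1000 : (1000 : ℝ) ≤ B := by
    have := mul_le_mul_of_nonneg_right c1 Bn
    linarith
  have B1 : (1 : ℝ) ≤ B := by linarith
  have B1n : 1 ≤ B := by exact_mod_cast B1
  have hΛB : 720 * Λ < B := by
    have h1 : 1000 * Λ ≤ c * B * Λ := mul_le_mul_of_nonneg_right (by linarith) Λ0.le
    have h2 : c * B * Λ = c * Λ * B := by ring
    have h3 := mul_le_mul_of_nonneg_right hcc Bn
    linarith
  have u1 : (1 : ℝ) ≤ u := by exact_mod_cast hu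
  have u0 : (0 : ℝ) ≤ u := by linarith
  obtain ⟨b, hb⟩ : ∃ b : ℕ → ℕ, ∀ j, b j = B ^ j * u := ⟨_, fun _ => rfl⟩
  have hbR : ∀ j, (b j : ℝ) = (B : ℝ) ^ j * u := fun j => by rw [hb]; push_cast; rfl
  have hb0 : b 0 = u := by rw [hb]; simp
  have hstep : ∀ j, 100 * ((E : ℝ) * b j) ≤ c * b (j + 1) := fun j => by
    rw [hbR, hbR]
    have := mul_le_mul_of_nonneg_right hB (show (0 : ℝ) ≤ (B : ℝ) ^ j * u by positivity)
    calc _ = 100 * (E : ℝ) * ((B : ℝ) ^ j * u) := by ring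
      _ ≤ _ := this
      _ = _ := by ring
  have hbm : ∀ j, b j ≤ b (j + 1) := fun j => by
    rw [hb, hb]
    exact Nat.mul_le_mul_right _ (Nat.pow_le_pow_right B1n (Nat.le_succ _))
  have ee : ∀ s : ℝ, s ≤ Λ * ((B : ℝ) ^ 10 * u) → X.ε * s ≤ b 0 := by
    intro s hs
    rw [hε, hb0, one_div, inv_mul_le_iff₀ (by positivity)]
    linarith
  have tb : ∀ (i k : ℕ) (s : ℝ), s ≤ Λ * ((B : ℝ) ^ 10 * u) → i + 11 ≤ k * 6 →
      720 * ((b i : ℝ) * s) < (b k : ℝ) ^ 6 := by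
    intro i k s hs hik
    rw [hbR, hbR]
    have p1 : 0 < (B : ℝ) ^ i * u := by positivity
    have p2 : 0 < (B : ℝ) ^ (i + 10) * u ^ 2 := by positivity
    calc 720 * ((B : ℝ) ^ i * u * s) ≤ 720 * ((B : ℝ) ^ i * u * (Λ * ((B : ℝ) ^ 10 * u))) := by
          have := mul_le_mul_of_nonneg_left hs p1.le
          linarith
      _ = 720 * Λ * ((B : ℝ) ^ (i + 10) * u ^ 2) := by ring
      _ < B * ((B : ℝ) ^ (i + 10) * u ^ 2) := mul_lt_mul_of_pos_right hΛB p2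
      _ = (B : ℝ) ^ (i + 11) * u ^ 2 := by ring
      _ ≤ (B : ℝ) ^ (k * 6) * u ^ 6 := by
          apply mul_le_mul (pow_le_pow_right₀ B1 hik) (pow_le_pow_right₀ u1 (by norm_num)) (by positivity) (by positivity)
      _ = _ := by ring
  obtain ⟨lab, gl, hlab, hgl, hk⟩ := labels X.H Q u hK
  -- the layout
  obtain ⟨A, hA⟩ : ∃ A, A = b 9 - 2 * u := ⟨_, rfl⟩
  have bn : ∀ j, (0 : ℝ) ≤ b j := fun j => Nat.cast_nonneg _
  have hub8 : ∀ j, u ≤ b j := fun j => by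
    rw [hb]; exact Nat.le_mul_of_pos_left _ (Nat.pow_pos B1n)
  have h89 : 1000 * (X.Δ + 1) ^ 9 * b 8 ≤ b 9 := by
    have h1 := hstep 8
    have h2 := mul_le_mul_of_nonneg_right c1 (bn 9)
    have h3 : 10 * ((X.Δ : ℝ) + 1) ^ 9 * b 8 ≤ E * b 8 := mul_le_mul_of_nonneg_right (by linarith) (bn 8)
    have : ((1000 * (X.Δ + 1) ^ 9 * b 8 : ℕ) : ℝ) ≤ (b 9 : ℕ) := by
      push_cast
      norm_num at h1
      linarith
    exact_mod_cast this
  have h8p : b 8 ≤ (X.Δ + 1) ^ 9 * b 8 := Nat.le_mul_of_pos_left _ (Nat.pow_pos (Nat.succ_pos _))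
  have hA2 : A + 2 * u = b 9 := by
    have := hub8 8
    have : 1000 * ((X.Δ + 1) ^ 9 * b 8) ≤ b 9 := by rw [← mul_assoc]; exact h89
    omega
  have hedge : X.Δ * A + X.Δ * Q.card ≤ ((univ : Finset (Sym2 W)).filter (fun e => e ∈ X.H.edgeSet)).card := by
    rw [edgec]
    have h0 : X.Δ * A + X.Δ * Q.card ≤ X.Δ * b 9 := by
      rw [← mul_add]; apply Nat.mul_le_mul_left; omega
    refine h0.trans ?_
    have h1 := hstep 9
    norm_num at h1
    have h2 : (X.Δ : ℝ) * b 9 ≤ E * b 9 := by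
      apply mul_le_mul_of_nonneg_right _ (bn 9)
      have := pow_le_pow_right₀ D1 (show 1 ≤ 9 by norm_num)
      linarith
    have h3 : c * b 10 ≤ X.C.card := by
      rw [hbR]
      have h4 := mul_le_mul_of_nonneg_left loC c0.le
      have h5 := mul_le_mul_of_nonneg_right hcc (Nat.cast_nonneg (α := ℝ) X.C.card)
      have h6 : c * (Λ * (X.C.card : ℝ)) = c * Λ * X.C.card := by ring
      have := Nat.cast_nonneg (α := ℝ) X.C.card
      linarith
    have h7 : (0 : ℝ) ≤ E * b 9 := mul_nonneg (by linarith) (bn 9)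
    have : ((X.Δ * b 9 : ℕ) : ℝ) ≤ (X.C.card : ℕ) := by
      push_cast; linarith
    exact_mod_cast this
  obtain ⟨sz, hsz0, hsz1, hsz2, hsz3⟩ : ∃ sz : Fin 3 → Option Bool → ℕ, sz 0 none = b 8 ∧ (∀ o, sz 0 (some o) = b 5) ∧
      (∀ o, sz 1 o = b 2) ∧ (∀ o, sz 2 o = b 2) :=
    ⟨fun i o => if i = 0 then (if o = none then b 8 else b 5) else b 2, by simp, by simp, by simp, by simp⟩
  have hmon : ∀ i j, i ≤ j → b i ≤ b j := fun i j h => monotone_nat_of_le_succ hbm h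
  have hsum : ∑ i : Fin 3 × Option Bool, sz i.1 i.2 ≤ 9 * b 8 := by
    have h1 : ∀ i ∈ (univ : Finset (Fin 3 × Option Bool)), sz i.1 i.2 ≤ b 8 := by
      rintro ⟨i, o⟩ -
      fin_cases i
      · cases o
        · exact hsz0.le
        · exact (hsz1 _).le.trans (hmon _ _ (by norm_num))
      · exact (hsz2 _).le.trans (hmon _ _ (by norm_num))
      · exact (hsz3 _).le.trans (hmon _ _ (by norm_num))
    have h2 := sum_le_card_nsmul _ _ _ h1
    have h3 : (univ : Finset (Fin 3 × Option Bool)).card = 9 := rfl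
    rw [h3] at h2
    simpa using h2
  have hszA : (X.Δ + 1) * ((∑ i : Fin 3 × Option Bool, sz i.1 i.2) * (X.Δ + 1) ^ 8 + (X.Δ + 1) ^ 4 * Q.card) ≤ A := by
    have h1 : (X.Δ + 1) ^ 4 * Q.card ≤ (X.Δ + 1) ^ 8 * b 8 :=
      Nat.mul_le_mul (Nat.pow_le_pow_right (Nat.succ_pos _) (by norm_num)) (hQ.trans (hub8 8))
    have h2 := Nat.mul_le_mul_right ((X.Δ + 1) ^ 8) hsum
    have h3 : (X.Δ + 1) * ((∑ i : Fin 3 × Option Bool, sz i.1 i.2) * (X.Δ + 1) ^ 8 + (X.Δ + 1) ^ 4 * Q.card) ≤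
        (X.Δ + 1) * (9 * b 8 * (X.Δ + 1) ^ 8 + (X.Δ + 1) ^ 8 * b 8) := Nat.mul_le_mul_left _ (Nat.add_le_add h2 h1)
    have h4 : (X.Δ + 1) * (9 * b 8 * (X.Δ + 1) ^ 8 + (X.Δ + 1) ^ 8 * b 8) = 10 * ((X.Δ + 1) ^ 9 * b 8) := by ring
    have h5 : 1000 * ((X.Δ + 1) ^ 9 * b 8) ≤ b 9 := by rw [← mul_assoc]; exact h89
    have := hub8 8
    omega
  obtain ⟨L, hLQ, hLl, hLS, hLI⟩ := X.layout Q lab gl u A hlab hgl hk hedge sz hszA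
  refine Lay.phaseF (L := L) (p := Lay.par X.Δ b) (L.mkNum b E Gn c Λ τ hτ hΛ hc hE hGn (by rw [hb0]; exact hu) hstep hbm
    (fun o => by rw [hbR]; exact lo o) (by rw [hbR]; exact loC) (tb 8 7 _ hiC (by norm_num))
    (fun o => tb 5 4 _ (hi o) (by norm_num)) (fun o => ee _ (hi o)) (ee _ hiC)
    (by rw [hLI, hsz0]) (fun o => by rw [hLI, hsz1]) (fun o => by rw [hLI, hsz2]) (fun o => by rw [hLI, hsz3]) ?_ ?_ ?_
    sidec edgec pd)
  · refine (card_union_le _ _).trans ?_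
    rw [hLQ]
    omega
  · rw [hLQ, hb0]; exact hQ
  · intro t
    rw [hb0, hLl]
    refine le_trans (card_le_card ?_) (hk t)
    intro z hz
    rw [mem_filter] at hz ⊢
    refine ⟨?_, hz.2⟩
    have h1 := hz.1
    unfold Lay.Out at h1
    rw [hLQ] at h1
    rw [mem_sdiff] at h1 ⊢
    exact ⟨h1.1, fun h => h1.2 (mem_union_right _ h)⟩

end Ctx
end BU

theorem stmt3 (Δ : ℕ) (hΔ : 1 ≤ Δ) (d δ : ℝ) (hd : 0 < d) (hδ : 0 < δ) :
    ∃ (ε μ : ℝ) (n₀ : ℕ), 0 < ε ∧ 0 < μ ∧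
    ∀ n : ℕ, n₀ ≤ n →
    ∀ (V : Type) [Fintype V] (V₁ V₂ V₃ : Finset V) (E : Set (Finset V)),
      Disjoint V₁ V₂ → Disjoint V₁ V₃ → Disjoint V₂ V₃ →
      (∀ e ∈ E, e.card = 3 ∧ (e ∩ V₁).card = 1 ∧ (e ∩ V₂).card = 1 ∧ (e ∩ V₃).card = 1) →
      n ≤ V₁.card → V₁.card ≤ V₂.card → (V₂.card : ℝ) ≤ (n : ℝ) / δ →
      δ * (n : ℝ) ≤ (V₃.card : ℝ) →
      (∀ U₁ ⊆ V₁, ∀ U₂ ⊆ V₂, ∀ U₃ ⊆ V₃,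
        ε * (V₁.card : ℝ) ≤ (U₁.card : ℝ) → ε * (V₂.card : ℝ) ≤ (U₂.card : ℝ) →
        ε * (V₃.card : ℝ) ≤ (U₃.card : ℝ) →
        d * (U₁.card : ℝ) * (U₂.card : ℝ) * (U₃.card : ℝ) ≤ (tripCount E U₁ U₂ U₃ : ℝ)) →
      (∀ v ∈ V₁ ∪ V₂ ∪ V₃, d * (n : ℝ) ^ 2 ≤ (hDeg E v : ℝ)) →
      ∀ (W : Type) [Fintype W] (H : SimpleGraph W) (A₁ A₂ : Finset W),
        Disjoint A₁ A₂ → A₁ ∪ A₂ = (univ : Finset W) →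
        (∀ x y, H.Adj x y → (x ∈ A₁ ∧ y ∈ A₂) ∨ (x ∈ A₂ ∧ y ∈ A₁)) →
        A₁.card = V₁.card → A₂.card = V₂.card →
        Separable H μ → (∀ w, degOf H w ≤ Δ) → edgeCnt H = V₃.card →
        ∃ (ρv : W → V) (ρe : Sym2 W → V),
          Function.Injective ρv ∧ Set.InjOn ρe H.edgeSet ∧
          (∀ x, ∀ e ∈ H.edgeSet, ρv x ≠ ρe e) ∧
          (∀ x y, H.Adj x y → ρe s(x, y) ∈ V₃ ∧
            ({ρv x, ρv y, ρe s(x, y)} : Finset V) ∈ E) := by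
  obtain ⟨Λ₁, hΛ₁⟩ : ∃ Λ₁ : ℝ, Λ₁ = Δ / δ + 1 / δ + 1 := ⟨_, rfl⟩
  have hp1 : 0 ≤ (Δ : ℝ) / δ := by positivity
  have hp2 : 0 < 1 / δ := by positivity
  have L1 : 1 ≤ Λ₁ := by linarith
  have L0 : 0 < Λ₁ := by linarith
  obtain ⟨θ, hθdef⟩ : ∃ θ : ℝ, θ = min 1 (d / (4 * Λ₁ ^ 2)) := ⟨_, rfl⟩
  have hθ : 0 < θ := by rw [hθdef]; exact lt_min one_pos (by positivity)
  have hθ1 : θ ≤ 1 := by rw [hθdef]; exact min_le_left _ _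
  have hθd : 4 * θ * Λ₁ ^ 2 ≤ d := by
    have : θ ≤ d / (4 * Λ₁ ^ 2) := by rw [hθdef]; exact min_le_right _ _
    rw [le_div_iff₀ (by positivity)] at this
    linarith
  have hθd' : 4 * θ ≤ d := by
    refine le_trans ?_ hθd
    exact le_mul_of_one_le_right (by positivity) (one_le_pow₀ L1)
  obtain ⟨Λ, hΛ⟩ : ∃ Λ : ℝ, Λ = 2 * Λ₁ := ⟨_, rfl⟩
  have hΛ1 : 1 ≤ Λ := by linarith
  have hΛ0 : 0 < Λ := by linarith
  obtain ⟨τ, hτ⟩ : ∃ τ : ℝ, τ = θ ^ Δ := ⟨_, rfl⟩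
  have τ0 : 0 < τ := by rw [hτ]; positivity
  obtain ⟨c, hc⟩ : ∃ c : ℝ, c = (τ / 2) ^ 3 / (128 * Λ) := ⟨_, rfl⟩
  have c0 : 0 < c := by rw [hc]; positivity
  obtain ⟨Gn, hGn⟩ : ∃ Gn : ℕ, 2 ≤ (τ / 2) ^ 3 / 64 * (Gn : ℝ) := by
    obtain ⟨Gn, h⟩ := exists_nat_ge (2 / ((τ / 2) ^ 3 / 64))
    refine ⟨Gn, ?_⟩
    rw [div_le_iff₀ (by positivity)] at h
    linarith
  obtain ⟨E0, hE0⟩ : ∃ E0 : ℕ, E0 = 10 * (Δ + 1) ^ 9 + Gn := ⟨_, rfl⟩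
  have hE0p : 0 < E0 := by rw [hE0]; positivity
  obtain ⟨B, hB⟩ : ∃ B : ℕ, 100 * (E0 : ℝ) ≤ c * (B : ℝ) := by
    obtain ⟨B, h⟩ := exists_nat_ge (100 * (E0 : ℝ) / c)
    refine ⟨B, ?_⟩
    rw [div_le_iff₀ c0] at h
    linarith
  have hBp : 0 < B := by
    rcases Nat.eq_zero_or_pos B with h | h
    · exfalso
      rw [h] at hB
      have : (0 : ℝ) < E0 := by exact_mod_cast hE0p
      simp at hB
      linarith
    · exact h
  have hBR : (0 : ℝ) < B := by exact_mod_cast hBp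
  refine ⟨1 / (Λ * (B : ℝ) ^ 10), 1 / (2 * Λ * (B : ℝ) ^ 10), B ^ 10, by positivity, by positivity, ?_⟩
  intro n hn V _ V₁ V₂ V₃ E d12 d13 d23 hE h1 h12 h2 h3 hreg hdegE W _ H A₁ A₂ dA hA hbip hc1 hc2 hsep hdegH hedge
  obtain ⟨Q, hQ, hK⟩ := hsep
  obtain ⟨u, hu⟩ : ∃ u, u = n / B ^ 10 := ⟨_, rfl⟩
  have hB10 : 0 < B ^ 10 := Nat.pow_pos hBp
  have hu1 : 1 ≤ u := by rw [hu]; exact Nat.div_pos hn hB10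
  have hNn : B ^ 10 * u ≤ n := by rw [hu]; exact Nat.mul_div_le _ _
  have hnN : n ≤ 2 * (B ^ 10 * u) := by
    have := Nat.lt_mul_div_succ n hB10
    rw [← hu] at this
    have h5 : B ^ 10 * (u + 1) = B ^ 10 * u + B ^ 10 := by ring
    have h6 : B ^ 10 ≤ B ^ 10 * u := Nat.le_mul_of_pos_right _ hu1
    omega
  have hNnR : (B : ℝ) ^ 10 * u ≤ n := by exact_mod_cast hNn
  have hnNR : (n : ℝ) ≤ 2 * ((B : ℝ) ^ 10 * u) := by exact_mod_cast hnN
  have hu1R : (1 : ℝ) ≤ u := by exact_mod_cast hu1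
  have hNp : 0 < (B : ℝ) ^ 10 * u := by positivity
  have hnp : (0 : ℝ) < n := by linarith
  -- sizes
  have s1 : (n : ℝ) ≤ V₁.card := by exact_mod_cast h1
  have s12 : (V₁.card : ℝ) ≤ V₂.card := by exact_mod_cast h12
  have hδn : (n : ℝ) / δ = 1 / δ * n := by ring
  have s2 : (V₂.card : ℝ) ≤ Λ₁ * n := by
    refine h2.trans ?_
    rw [hδn]
    exact mul_le_mul_of_nonneg_right (by linarith) hnp.le
  have s3lo : (n : ℝ) ≤ Λ₁ * V₃.card := by
    have h5 := mul_le_mul_of_nonneg_left h3 hp2.le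
    have h6 : 1 / δ * (δ * n) = (n : ℝ) := by field_simp
    have h7 : 1 / δ * (V₃.card : ℝ) ≤ Λ₁ * V₃.card :=
      mul_le_mul_of_nonneg_right (by linarith) (Nat.cast_nonneg _)
    linarith
  have s3hi : (V₃.card : ℝ) ≤ Λ₁ * n := by
    have h5 : V₃.card ≤ A₁.card * Δ := by
      rw [← hedge]
      unfold edgeCnt
      have h6 : ((univ : Finset (Sym2 W)).filter (fun e => e ∈ H.edgeSet)) ⊆
          A₁.biUnion (fun x => ((univ : Finset W).filter (fun y => H.Adj x y)).image (fun y => s(x, y))) := by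
        intro e he
        rw [mem_filter] at he
        have h7 := he.2
        clear he
        induction e using Sym2.ind with
        | _ x y =>
          rw [SimpleGraph.mem_edgeSet] at h7
          rw [mem_biUnion]
          rcases hbip x y h7 with h | h
          · exact ⟨x, h.1, mem_image.2 ⟨y, mem_filter.2 ⟨mem_univ _, h7⟩, rfl⟩⟩
          · exact ⟨y, h.2, mem_image.2 ⟨x, mem_filter.2 ⟨mem_univ _, h7.symm⟩, Sym2.eq_swap⟩⟩
      refine (card_le_card h6).trans (card_biUnion_le_card_mul _ _ _ ?_)
      intro x _
      exact card_image_le.trans (hdegH x)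
    have h6 : (V₃.card : ℝ) ≤ A₁.card * Δ := by exact_mod_cast h5
    rw [hc1] at h6
    have h7 : (V₁.card : ℝ) * Δ ≤ 1 / δ * n * Δ :=
      mul_le_mul_of_nonneg_right (by rw [← hδn]; linarith) (Nat.cast_nonneg _)
    have h8 : 1 / δ * n * Δ = Δ / δ * (n : ℝ) := by ring
    have h9 : Δ / δ * (n : ℝ) ≤ Λ₁ * n := mul_le_mul_of_nonneg_right (by linarith) hnp.le
    linarith
  have nL : (n : ℝ) ≤ Λ₁ * n := le_mul_of_one_le_left hnp.le L1
  have c1p : (0 : ℝ) < V₁.card := by linarith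
  have c2p : (0 : ℝ) < V₂.card := by linarith
  have c3p : (0 : ℝ) < V₃.card := by
    by_contra h
    have : (V₃.card : ℝ) = 0 := le_antisymm (not_lt.1 h) (Nat.cast_nonneg _)
    rw [this] at s3lo
    linarith
  have s1hi : (V₁.card : ℝ) ≤ Λ₁ * n := by linarith
  have prodb : ∀ a b : ℝ, 0 ≤ b → 0 ≤ a → a ≤ Λ₁ * n → b ≤ Λ₁ * n → 4 * θ * a * b ≤ d * (n : ℝ) ^ 2 := by
    intro a b hb0 ha0 ha hb
    have h5 : a * b ≤ (Λ₁ * n) * (Λ₁ * n) := mul_le_mul ha hb hb0 (by positivity)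
    have h6 := mul_le_mul_of_nonneg_left h5 (show 0 ≤ 4 * θ by linarith)
    have h7 := mul_le_mul_of_nonneg_right hθd (show 0 ≤ (n : ℝ) ^ 2 by positivity)
    calc 4 * θ * a * b = 4 * θ * (a * b) := by ring
      _ ≤ _ := h6
      _ = 4 * θ * Λ₁ ^ 2 * (n : ℝ) ^ 2 := by ring
      _ ≤ _ := h7
  have hsw : ∀ x y z : V, ({x, y, z} : Finset V) = {y, x, z} := fun x y z => by
    ext w; simp only [mem_insert, mem_singleton]; tauto
  have hro : ∀ x y z : V, ({z, x, y} : Finset V) = {x, y, z} := fun x y z => by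
    ext w; simp only [mem_insert, mem_singleton]; tauto
  have nn : ∀ a : ℕ, (0 : ℝ) ≤ a := fun a => Nat.cast_nonneg _
  have memA : ∀ x, x ∈ A₁ ∨ x ∈ A₂ := fun x => by
    rw [← mem_union, hA]; exact mem_univ _
  have hA2 : ∀ x, x ∈ A₂ ↔ x ∉ A₁ := fun x =>
    ⟨fun h h' => disjoint_left.1 dA h' h, fun h => (memA x).resolve_left h⟩
  obtain ⟨X, XP1, XP2, XC, XT, XH, Xs, XΔ, Xθ, Xε⟩ := BU.mkCtx V₁ V₂ V₃
    (fun x y z => ({x, y, z} : Finset V) ∈ E) (fun x y z h => by rw [hsw]; exact h) H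
    (fun x => decide (x ∈ A₁)) (by
      intro x y hxy
      rcases hbip x y hxy with ⟨hx, hy⟩ | ⟨hx, hy⟩
      · rw [hA2] at hy; simp [hx, hy]
      · rw [hA2] at hx; simp [hx, hy]) Δ hΔ hdegH d θ (1 / (Λ * (B : ℝ) ^ 10)) hθ hθ1 (by positivity) hθd'
    c1p c2p c3p (by
      intro U₁ hU₁ U₂ hU₂ U₃ hU₃ g1 g2 g3
      refine (hreg U₁ hU₁ U₂ hU₂ U₃ hU₃ g1 g2 g3).trans (le_of_eq ?_)
      exact BU.card_triple_filter U₁ U₂ U₃ (fun x y z => ({x, y, z} : Finset V) ∈ E)) (by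
      intro v hv
      have h5 := hdegE v (by simp [hv])
      have h6 := BU.hdeg_le E V₁ V₂ V₃ d12 d13 d23 v hv (fun e he => ⟨(hE e he).1, (hE e he).2.2⟩)
      have h7 := prodb _ _ (nn V₃.card) (nn V₂.card) s2 s3hi
      have h8 : 0 ≤ θ * V₂.card * V₃.card := by positivity
      unfold hDeg at h5
      linarith) (by
      intro v hv
      have h5 := hdegE v (by simp [hv])
      have h6 := BU.hdeg_le E V₂ V₁ V₃ d12.symm d23 d13 v hv
        (fun e he => ⟨(hE e he).1, (hE e he).2.1, (hE e he).2.2.2⟩)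
      have h7 := prodb _ _ (nn V₃.card) (nn V₁.card) s1hi s3hi
      have h8 : 0 ≤ θ * V₁.card * V₃.card := by positivity
      unfold hDeg at h5
      linarith) (by
      intro v hv
      have h5 := hdegE v (by simp [hv])
      have h6 := BU.hdeg_le E V₃ V₁ V₂ d13.symm d23.symm d12 v hv
        (fun e he => ⟨(hE e he).1, (hE e he).2.1, (hE e he).2.2.1⟩)
      simp only [hro _ _ v] at h6
      have h7 := prodb _ _ (nn V₂.card) (nn V₁.card) s1hi s2
      have h8 : 0 ≤ θ * V₁.card * V₂.card := by positivity
      unfold hDeg at h5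
      linarith)
  have neV : Nonempty V := by
    have : 0 < V₁.card := by exact_mod_cast c1p
    obtain ⟨x, _⟩ := card_pos.1 this
    exact ⟨x⟩
  have neW : Nonempty W := by
    have : 0 < A₁.card := by rw [hc1]; exact_mod_cast c1p
    obtain ⟨x, _⟩ := card_pos.1 this
    exact ⟨x⟩
  have hWc : (Fintype.card W : ℝ) ≤ 2 * Λ * ((B : ℝ) ^ 10 * u) := by
    have h5 : Fintype.card W = V₁.card + V₂.card := by
      rw [← hc1, ← hc2, ← card_union_of_disjoint dA, hA]; rfl
    rw [h5]
    push_cast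
    have h6 := mul_le_mul_of_nonneg_left hnNR L0.le
    rw [hΛ]
    linarith
  have hμ : 1 / (2 * Λ * (B : ℝ) ^ 10) * (Fintype.card W : ℝ) ≤ u := by
    rw [one_div, inv_mul_le_iff₀ (by positivity)]
    linarith
  have bl : ∀ a : ℝ, (n : ℝ) ≤ Λ₁ * a → 0 ≤ a → (B : ℝ) ^ 10 * u ≤ Λ * a := by
    intro a ha ha0
    have := mul_nonneg L0.le ha0
    rw [hΛ]
    linarith
  have bh : ∀ a : ℝ, a ≤ Λ₁ * n → a ≤ Λ * ((B : ℝ) ^ 10 * u) := by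
    intro a ha
    have h6 := mul_le_mul_of_nonneg_left hnNR L0.le
    rw [hΛ]
    linarith
  have s1lo : (n : ℝ) ≤ Λ₁ * V₁.card := s1.trans (le_mul_of_one_le_left (nn _) L1)
  have s2lo : (n : ℝ) ≤ Λ₁ * V₂.card := (s1.trans s12).trans (le_mul_of_one_le_left (nn _) L1)
  obtain ⟨φ, σ, r1, r2, r3, r4, r5⟩ := X.embed B u E0 Gn c Λ τ (by rw [hτ, Xθ, XΔ]) hΛ1 hc (by rw [hE0, XΔ]) hGn hu1 hB Xε
    (by
      intro o; cases o
      · rw [XP2]; exact bl _ s2lo (nn _)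
      · rw [XP1]; exact bl _ s1lo (nn _))
    (by rw [XC]; exact bl _ s3lo (nn _))
    (by
      intro o; cases o
      · rw [XP2]; exact bh _ s2
      · rw [XP1]; exact bh _ s1hi)
    (by rw [XC]; exact bh _ s3hi)
    (by
      intro o; rw [Xs]; cases o
      · rw [XP2, ← hc2]
        congr 1
        ext x
        simp [hA2]
      · rw [XP1, ← hc1]
        congr 1
        ext x
        simp)
    (by rw [XC, XH]; exact hedge)
    (by rw [XP1, XP2]; exact d12) Q
    (by
      have := hQ.trans hμ
      exact_mod_cast this)
    (by
      rw [XH]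
      intro K
      have := (hK K).trans hμ
      exact_mod_cast this)
  rw [XH] at r3 r4 r5
  rw [XC] at r4
  refine ⟨φ, σ, r1, r3, ?_, ?_⟩
  · intro x e he heq
    have h5 := r4 e he
    have h6 := r2 x
    rw [← heq] at h5
    cases hs : X.side x
    · rw [hs, XP2] at h6; exact disjoint_left.1 d23 h6 h5
    · rw [hs, XP1] at h6; exact disjoint_left.1 d13 h6 h5
  · intro x y hxy
    refine ⟨r4 _ hxy, ?_⟩
    have := r5 x y hxy
    rw [XT] at this
    exact this
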